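/- arXiv:1903.02317 — 3 statements merged into one kernel-verified Lean document; each statement's English description precedes it below -/
import Mathlib

section
/- FC(3,7) = 4: every family of 4 distinct 3-element subsets of [7] generates a Frankl-Complete family, and there exists a family of 3 distinct 3-element subsets of [7] whose generated union-closed family is Non–Frankl-Complete. -/
/-- A family of sets is union-closed. -/
def UC (F : Finset (Finset ℕ)) : Prop := ∀ A ∈ F, ∀ B ∈ F, A ∪ B ∈ F

/-- `famU F` is the union `U(F)` of all members of the family `F`. -/
def famU (F : Finset (Finset ℕ)) : Finset ℕ := F.sup id

/-- `memFam F i` is the subfamily `F_i` of sets in `F` containing `i`. -/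
def memFam (F : Finset (Finset ℕ)) (i : ℕ) : Finset (Finset ℕ) :=
  F.filter (fun S => i ∈ S)

/-- `A` is Frankl-Complete: every union-closed family containing `A` has an
element of `U(A)` belonging to at least half of its sets. -/
def FC (A : Finset (Finset ℕ)) : Prop :=
  ∀ F : Finset (Finset ℕ), UC F → A ⊆ F →
    ∃ i ∈ famU A, 2 * (memFam F i).card ≥ F.card

/-- `A` is Non–Frankl-Complete: some union-closed family containing `A` has every
element of `U(A)` in fewer than half of its sets. -/
def NonFC (A : Finset (Finset ℕ)) : Prop :=
  ∃ F : Finset (Finset ℕ), UC F ∧ A ⊆ F ∧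
    ∀ i ∈ famU A, 2 * (memFam F i).card < F.card

/-- `gen S` is the union-closed family generated by `S`: the smallest
union-closed family containing `S`, given explicitly as all unions of
nonempty subfamilies of `S`. -/
def gen (S : Finset (Finset ℕ)) : Finset (Finset ℕ) :=
  (S.powerset.filter (fun T => T.Nonempty)).image (fun T => T.sup id)

namespace UnionClosed

/-! ### Evaluation helpers -/

/-- `forced n k` is `k n`; kernel evaluation normalises `n` before passing it on. -/
def forced {α : Type} (n : ℕ) (k : ℕ → α) : α := Nat.rec (k 0) (fun p _ => k p.succ) n

/-- `salted c n k` is `k n`; the tag `c` keeps evaluation caches from colliding on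
numbers with equal low bits. -/
def salted {α : Type} (c n : ℕ) (k : ℕ → α) : α :=
  Nat.rec (k 0) (fun p _ => k (p.add (c.succ.sub c))) n

@[simp] lemma forced_eq {α : Type} (n : ℕ) (k : ℕ → α) : forced n k = k n := by
  cases n <;> rfl

@[simp] lemma salted_eq {α : Type} (c n : ℕ) (k : ℕ → α) : salted c n k = k n := by
  cases n with
  | zero => rfl
  | succ p =>
    have h : c.succ.sub c = 1 := Nat.add_sub_cancel_left c 1
    change k (p.add (c.succ.sub c)) = k (p + 1)
    rw [h]

/-- Evaluate the entries of a list before passing it on. -/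
def forcedList {α : Type} : List ℕ → (List ℕ → α) → α
  | [], k => k []
  | a :: l, k => forced a fun b => forcedList l fun m => k (b :: m)

/-- Evaluate the entries of a list of pairs before passing it on. -/
def forcedPairs {α : Type} : List (ℕ × ℕ) → (List (ℕ × ℕ) → α) → α
  | [], k => k []
  | (a, b) :: l, k => forced a fun x => forced b fun y => forcedPairs l fun m => k ((x, y) :: m)

@[simp] lemma forcedList_eq {α : Type} (l : List ℕ) (k : List ℕ → α) :
    forcedList l k = k l := by
  induction l generalizing k with
  | nil => rfl
  | cons a l ih => simp [forcedList, ih]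

@[simp] lemma forcedPairs_eq {α : Type} (l : List (ℕ × ℕ)) (k : List (ℕ × ℕ) → α) :
    forcedPairs l k = k l := by
  induction l generalizing k with
  | nil => rfl
  | cons a l ih => obtain ⟨a, b⟩ := a; simp [forcedPairs, ih]

/-! ### Finite sets of naturals as binary codes -/

/-- The set of positions of the binary digits `1` of `x`. -/
def ones (x : ℕ) : Finset ℕ := x.bitIndices.toFinset

@[simp] lemma mem_ones {x i : ℕ} : i ∈ ones x ↔ x.testBit i = true := by
  simp [ones, Nat.mem_bitIndices]

lemma ones_injective : Function.Injective ones := fun x y h =>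
  Nat.eq_of_testBit_eq fun i => by
    have := Finset.ext_iff.1 h i
    simp only [mem_ones] at this
    exact Bool.eq_iff_iff.2 this

@[simp] lemma ones_zero : ones 0 = ∅ := by ext; simp

lemma ones_or (x y : ℕ) : ones (x ||| y) = ones x ∪ ones y := by
  ext; simp

lemma lt_two_pow_of_mem_ones {x i n : ℕ} (hx : x < 2 ^ n) (hi : i ∈ ones x) : i < n := by
  by_contra h
  rw [mem_ones, Nat.testBit_lt_two_pow
    (hx.trans_le (Nat.pow_le_pow_right two_pos (by omega)))] at hi
  cases hi

/-- `bit F x` is the `x`-th binary digit of `F`. -/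
def bit (F x : ℕ) : Bool := ((F.shiftRight x).land 1).beq 1

lemma bit_eq (F x : ℕ) : bit F x = F.testBit x := by
  rw [Bool.eq_iff_iff, bit, Nat.beq_eq]
  change (F >>> x) &&& 1 = 1 ↔ _
  rw [Nat.testBit_eq_decide_div_mod_eq, Nat.and_one_is_mod, Nat.shiftRight_eq_div_pow,
    decide_eq_true_eq]

lemma testBit_add_two_pow {x i : ℕ} (h : x.testBit i = false) (j : ℕ) :
    (x + 2 ^ i).testBit j = (x.testBit j || decide (j = i)) := by
  have hb : x % 2 ^ i < 2 ^ i := Nat.mod_lt _ (by positivity)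
  have hx : x = 2 ^ i * (x / 2 ^ i) + x % 2 ^ i := (Nat.div_add_mod x (2 ^ i)).symm
  have hx' : x + 2 ^ i = 2 ^ i * (x / 2 ^ i + 1) + x % 2 ^ i := by
    conv_lhs => rw [hx]
    ring
  have he : x / 2 ^ i % 2 = 0 := by
    rw [Nat.testBit_eq_decide_div_mod_eq] at h
    have := of_decide_eq_false h
    omega
  rw [hx', Nat.testBit_two_pow_mul_add _ hb]
  conv_rhs => rw [hx, Nat.testBit_two_pow_mul_add _ hb]
  rcases lt_trichotomy j i with hj | rfl | hj
  · simp [hj, hj.ne]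
  · simp [Nat.testBit_zero]; omega
  · obtain ⟨k, rfl⟩ : ∃ k, j = i + 1 + k := ⟨j - (i + 1), by omega⟩
    have h1 : i + 1 + k - i = k + 1 := by omega
    have h2 : (x / 2 ^ i + 1) / 2 = x / 2 ^ i / 2 := by omega
    simp only [h1, Nat.testBit_succ, h2]
    simp [show ¬ (i + 1 + k < i) by omega, show ¬ (i + 1 + k = i) by omega]

/-- The code of `{x < n | p x}`, added to `acc`. -/
def maskOf (p : ℕ → Bool) : ℕ → ℕ → ℕ
  | 0, acc => acc
  | n + 1, acc => forced (cond (p n) (acc.lor (Nat.shiftLeft 1 n)) acc) (maskOf p n)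

lemma testBit_or_shiftLeft_one (a n x : ℕ) :
    (a.lor (Nat.shiftLeft 1 n)).testBit x = (a.testBit x || decide (x = n)) := by
  change (a ||| (1 <<< n)).testBit x = _
  rw [Nat.testBit_or, Nat.one_shiftLeft, Nat.testBit_two_pow]
  simp [eq_comm]

lemma testBit_maskOf (p : ℕ → Bool) (n acc x : ℕ) :
    (maskOf p n acc).testBit x = ((decide (x < n) && p x) || acc.testBit x) := by
  induction n generalizing acc with
  | zero => simp [maskOf]
  | succ n ih =>
    rw [maskOf, forced_eq, ih]
    have hc : (cond (p n) (acc.lor (Nat.shiftLeft 1 n)) acc).testBit x =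
        (acc.testBit x || (decide (x = n) && p n)) := by
      cases p n
      · simp
      · rw [cond_true, testBit_or_shiftLeft_one, Bool.and_true]
    rw [hc]
    rcases lt_trichotomy x n with h | rfl | h
    · simp [h, h.ne, h.trans n.lt_succ_self]
    · simp [Bool.or_comm]
    · simp [h.ne', h.not_gt, show ¬ x < n + 1 by omega]

/-- `masks n` lists, for `i < n`, the code of `{x < 2 ^ n | i ∈ ones x}`. -/
def masks (n : ℕ) : List ℕ := (List.range n).map fun i => maskOf (fun x => x.testBit i) (2 ^ n) 0

/-- `join g (masks n) c 1 F` encodes `{x ||| g | x ∈ ones F}`. -/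
noncomputable def join (g : ℕ) (ms : List ℕ) : ℕ → ℕ → ℕ → ℕ :=
  List.rec (fun _ _ F => F) (fun m _ ih c s F =>
    forced c.succ fun c' => forced (s.add s) fun s' =>
    Bool.rec (salted c ((F.land m).lor ((F.xor (F.land m)).shiftLeft s)) fun F' => ih c' s' F')
     (ih c' s' F) ((g.land s).beq 0)) ms

lemma land_two_pow_beq (g i : ℕ) : (g.land (2 ^ i)).beq 0 = !g.testBit i := by
  rw [Bool.eq_iff_iff, Nat.beq_eq]
  change g &&& 2 ^ i = 0 ↔ _
  rw [Nat.and_two_pow]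
  cases g.testBit i <;> simp

lemma join_cons (g m : ℕ) (ms : List ℕ) (c s F : ℕ) :
    join g (m :: ms) c s F = cond ((g.land s).beq 0) (join g ms c.succ (s.add s) F)
      (join g ms c.succ (s.add s) ((F.land m).lor ((F.xor (F.land m)).shiftLeft s))) := by
  change forced c.succ (fun c' => forced (s.add s) fun s' => Bool.rec (motive := fun _ => ℕ)
    (salted c ((F.land m).lor ((F.xor (F.land m)).shiftLeft s)) fun F' =>
    join g ms c' s' F') (join g ms c' s' F) ((g.land s).beq 0)) = _
  simp only [forced_eq, salted_eq]
  cases (g.land s).beq 0 <;> rfl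

lemma exists_of_testBit_join_aux (g n : ℕ) (k : ℕ) : ∀ (i c F : ℕ), i + k = n →
    (∀ x ∈ ones F, x < 2 ^ n) → ∀ z ∈ ones (join g
      ((List.range' i k).map fun i => maskOf (fun x => x.testBit i) (2 ^ n) 0) c (2 ^ i) F),
      ∃ x ∈ ones F, ∀ j, z.testBit j =
        (x.testBit j || (decide (i ≤ j) && decide (j < n) && g.testBit j)) := by
  induction k with
  | zero =>
    intro i c F hik hF z hz
    refine ⟨z, hz, fun j => ?_⟩
    have : ¬ (i ≤ j ∧ j < n) := by omega
    rw [← Bool.decide_and, decide_eq_false this]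
    simp
  | succ k ih =>
    intro i c F hik hF z hz
    have hs : (2 ^ i).add (2 ^ i) = 2 ^ (i + 1) := by
      change 2 ^ i + 2 ^ i = _
      ring
    cases hg : g.testBit i with
    | false =>
      have hz' : z ∈ ones (join g ((List.range' (i + 1) k).map fun i =>
          maskOf (fun x => x.testBit i) (2 ^ n) 0) c.succ (2 ^ (i + 1)) F) := by
        rw [List.range'_succ, List.map_cons] at hz
        rwa [join_cons, land_two_pow_beq, hg, hs] at hz
      obtain ⟨x, hx, h⟩ := ih (i + 1) _ F (by omega) hF z hz'
      refine ⟨x, hx, fun j => ?_⟩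
      rw [h j]
      rcases eq_or_ne j i with rfl | hj
      · simp [hg]
      · rw [show decide (i + 1 ≤ j) = decide (i ≤ j) from decide_eq_decide.2 (by omega)]
    | true =>
      set m := maskOf (fun x => x.testBit i) (2 ^ n) 0 with hm
      set F' := (F.land m).lor ((F.xor (F.land m)).shiftLeft (2 ^ i)) with hF'
      have hz' : z ∈ ones (join g ((List.range' (i + 1) k).map fun i =>
          maskOf (fun x => x.testBit i) (2 ^ n) 0) c.succ (2 ^ (i + 1)) F') := by
        rw [List.range'_succ, List.map_cons] at hz
        rwa [join_cons, land_two_pow_beq, hg, hs] at hz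
      have key : ∀ y ∈ ones F', ∃ x ∈ ones F, y < 2 ^ n ∧
          ∀ j, y.testBit j = (x.testBit j || decide (j = i)) := by
        intro y hy
        change y ∈ ones ((F &&& m) ||| ((F ^^^ (F &&& m)) <<< (2 ^ i))) at hy
        simp only [mem_ones, Nat.testBit_or, Nat.testBit_and, Nat.testBit_shiftLeft,
          Nat.testBit_xor, hm, testBit_maskOf, Nat.zero_testBit, Bool.or_false] at hy
        rcases Bool.or_eq_true_iff.1 hy with h | h
        · simp only [Bool.and_eq_true, decide_eq_true_eq] at h
          refine ⟨y, mem_ones.2 h.1, h.2.1, fun j => ?_⟩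
          rcases eq_or_ne j i with rfl | hj
          · simp [h.2.2]
          · simp [hj]
        · rw [Bool.and_eq_true, decide_eq_true_eq] at h
          obtain ⟨hle, h⟩ := h
          obtain ⟨x, rfl⟩ : ∃ x, y = x + 2 ^ i := ⟨y - 2 ^ i, by omega⟩
          rw [Nat.add_sub_cancel] at h
          have hxF : F.testBit x = true := by
            cases hh : F.testBit x
            · simp [hh] at h
            · rfl
          have hx := hF x (mem_ones.2 hxF)
          have hxi : x.testBit i = false := by simpa [hxF, hx] using h
          have ht := testBit_add_two_pow hxi
          refine ⟨x, mem_ones.2 hxF, Nat.lt_pow_two_of_testBit _ fun j hj => ?_, ht⟩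
          rw [ht, Nat.testBit_lt_two_pow (hx.trans_le (Nat.pow_le_pow_right two_pos hj))]
          simp; omega
      obtain ⟨y, hy, h⟩ := ih (i + 1) _ F' (by omega)
        (fun y hy => (key y hy).elim fun x h => h.2.1) z hz'
      obtain ⟨x, hx, -, hxy⟩ := key y hy
      refine ⟨x, hx, fun j => ?_⟩
      rw [h j, hxy j]
      rcases eq_or_ne j i with rfl | hj
      · simp [hg, show j < n by omega]
      · rw [show decide (i + 1 ≤ j) = decide (i ≤ j) from decide_eq_decide.2 (by omega)]
        simp [hj]

lemma exists_of_mem_ones_join {g n c F z : ℕ} (hg : g < 2 ^ n) (hF : ∀ x ∈ ones F, x < 2 ^ n)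
    (hz : z ∈ ones (join g (masks n) c 1 F)) : ∃ x ∈ ones F, z = x ||| g := by
  rw [masks, List.range_eq_range'] at hz
  obtain ⟨x, hx, h⟩ := exists_of_testBit_join_aux g n n 0 c F (by omega) hF z (by simpa using hz)
  refine ⟨x, hx, Nat.eq_of_testBit_eq fun j => ?_⟩
  rw [h j, Nat.testBit_or]
  by_cases hj : j < n
  · simp [hj]
  · simp [hj, Nat.testBit_lt_two_pow (hg.trans_le (Nat.pow_le_pow_right two_pos (not_lt.1 hj)))]

/-- `joins (masks n) A` encodes `0` together with all joins of members of `A`. -/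
noncomputable def joins (ms : List ℕ) : List ℕ → ℕ
  | [] => 1
  | a :: A => forced (joins ms A) fun G => G.lor (join a ms 1 1 G)

lemma ones_lor (x y : ℕ) : ones (x.lor y) = ones x ∪ ones y := ones_or x y

lemma joins_induction {n : ℕ} {A : List ℕ} (hA : ∀ a ∈ A, a < 2 ^ n) {p : ℕ → Prop} (h0 : p 0)
    (ha : ∀ a ∈ A, p a) (hor : ∀ x y, p x → p y → p (x ||| y)) :
    ∀ y ∈ ones (joins (masks n) A), y < 2 ^ n ∧ p y := by
  induction A with
  | nil =>
    intro y hy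
    have : y = 0 := by
      by_contra h
      obtain ⟨k, rfl⟩ := Nat.exists_eq_succ_of_ne_zero h
      simp [joins, Nat.testBit_succ] at hy
    subst this
    exact ⟨by positivity, h0⟩
  | cons a A ih =>
    have ih := ih (fun b hb => hA b (by simp [hb])) fun b hb => ha b (by simp [hb])
    intro y hy
    rw [joins, forced_eq, ones_lor, Finset.mem_union] at hy
    rcases hy with hy | hy
    · exact ih y hy
    · obtain ⟨x, hx, rfl⟩ := exists_of_mem_ones_join (hA a (by simp)) (fun x hx => (ih x hx).1) hy
      exact ⟨Nat.or_lt_two_pow (ih x hx).1 (hA a (by simp)), hor _ _ (ih x hx).2 (ha a (by simp))⟩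

/-! ### The branching certificate checker -/

/-- `consume k d c t` erases up to `d` of the lowest binary digits `1` of `t` and calls `k`
on what is left, together with the number of digits that were missing. -/
noncomputable def consume (k : ℕ → ℕ → ℕ → Bool) (d : ℕ) : ℕ → ℕ → Bool :=
  Nat.rec (fun c t => k c t 0) (fun d ih c t =>
    Bool.rec (forced c.succ fun c' => salted c (t.land (t.sub 1)) fun t' => ih c' t')
      (k c 0 d.succ) (t.beq 0)) d

lemma consume_succ (k : ℕ → ℕ → ℕ → Bool) (d c t : ℕ) :
    consume k (d + 1) c t =
      cond (t.beq 0) (k c 0 (d + 1)) (consume k d c.succ (t.land (t.sub 1))) := by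
  change Bool.rec (motive := fun _ => Bool) (forced c.succ fun c' =>
    salted c (t.land (t.sub 1)) fun t' => consume k d c' t') (k c 0 d.succ) (t.beq 0) = _
  simp only [forced_eq, salted_eq]
  cases t.beq 0 <;> rfl

lemma exists_of_consume {k : ℕ → ℕ → ℕ → Bool} {d c t : ℕ} (h : consume k d c t = true) :
    ∃ c' t' s, k c' t' s = true ∧ ones t' ⊆ ones t ∧
      d + (ones t').card ≤ s + (ones t).card := by
  induction d generalizing c t with
  | zero => exact ⟨c, t, 0, h, subset_rfl, le_rfl⟩
  | succ d ih =>
    rw [consume_succ] at h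
    cases ht : t.beq 0 with
    | true =>
      obtain rfl := Nat.eq_of_beq_eq_true ht
      exact ⟨c, 0, d + 1, by simpa using h, subset_rfl, le_rfl⟩
    | false =>
      rw [ht] at h
      obtain ⟨c', t', s, hk, hsub, hle⟩ := ih h
      have h0 : t ≠ 0 := Nat.ne_of_beq_eq_false ht
      have hsub' : ones (t.land (t.sub 1)) ⊆ ones t := by
        intro z hz
        change z ∈ ones (t &&& _) at hz
        simp only [mem_ones, Nat.testBit_and, Bool.and_eq_true] at hz
        exact mem_ones.2 hz.1
      have hlt : (ones (t.land (t.sub 1))).card < (ones t).card := by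
        refine Finset.card_lt_card (hsub'.ssubset_of_ne fun h => ?_)
        have h1 : t &&& (t - 1) = t := ones_injective h
        have h2 : t &&& (t - 1) ≤ t - 1 := Nat.and_le_right
        omega
      exact ⟨c', t', s, hk, hsub.trans hsub', by omega⟩

/-- The code of `k` disjoint copies of a unit, spaced by `N`. -/
def rep (N : ℕ) : ℕ → ℕ
  | 0 => 0
  | k + 1 => 2 ^ N * rep N k + 1

lemma mod_mem_ones_of_mem_ones_mul_rep {N T k z : ℕ} (hT : ∀ x ∈ ones T, x < N)
    (hz : z ∈ ones (T.mul (rep N k))) : z % N ∈ ones T := by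
  induction k generalizing z with
  | zero => simp [rep] at hz
  | succ k ih =>
    have hT' : T < 2 ^ N := Nat.lt_pow_two_of_testBit _ fun i hi => by
      by_contra h
      exact absurd (hT i (by simpa using h)) hi.not_gt
    have h : T.mul (rep N (k + 1)) = 2 ^ N * T.mul (rep N k) + T := by
      change T * (2 ^ N * rep N k + 1) = 2 ^ N * (T * rep N k) + T
      ring
    rw [h, mem_ones, Nat.testBit_two_pow_mul_add _ hT'] at hz
    split_ifs at hz with hlt
    · rw [Nat.mod_eq_of_lt hlt]
      exact mem_ones.2 hz
    · rw [Nat.mod_eq_sub_mod (not_lt.1 hlt)]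
      exact ih (mem_ones.2 hz)

lemma ones_xor_xor {m t t' : ℕ} (ht' : ones t' ⊆ ones t) (ht : ones t ⊆ ones m) :
    ones (m.xor (t.xor t')) = ones m \ (ones t \ ones t') := by
  ext z
  change z ∈ ones (m ^^^ (t ^^^ t')) ↔ _
  have h1 := @ht z
  have h2 := @ht' z
  simp only [mem_ones, Finset.mem_sdiff, Nat.testBit_xor] at h1 h2 ⊢
  revert h1 h2
  cases m.testBit z <;> cases t.testBit z <;> cases t'.testBit z <;> simp

/-- Match the deficits in `L` greedily against the surplus cells `m` that they force. -/
noncomputable def greedy (ms : List ℕ) (r Q F E H : ℕ) (L : List (ℕ × ℕ)) :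
    ℕ → ℕ → ℕ → Bool :=
  List.rec (fun c _ R => consume (fun _ _ s => s.beq 0) R c Q) (fun gd _ ih c m R =>
    Bool.rec
      (Bool.rec
        (forced (c.add 16) fun c' =>
          salted c' (m.land ((join gd.1 ms c 1 H).mul r)) fun t =>
            consume (fun c'' t' s => salted c'' (m.xor (t.xor t')) fun m' =>
              forced c''.succ fun c₁ => forced (R.add s) fun R' => ih c₁ m' R')
              gd.2 c'.succ t)
        (forced (R.add gd.2) fun R' => ih c m R') (bit F gd.1))
      (ih c m R) (bit E gd.1)) L

lemma greedy_cons (ms : List ℕ) (r Q F E H : ℕ) (gd : ℕ × ℕ) (L : List (ℕ × ℕ)) (c m R : ℕ) :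
    greedy ms r Q F E H (gd :: L) c m R =
      cond (bit E gd.1) (greedy ms r Q F E H L c m R)
        (cond (bit F gd.1) (greedy ms r Q F E H L c m (R + gd.2))
          (consume (fun c'' t' s => greedy ms r Q F E H L c''.succ
            (m.xor ((m.land ((join gd.1 ms c 1 H).mul r)).xor t')) (R + s))
            gd.2 (c.add 16).succ (m.land ((join gd.1 ms c 1 H).mul r)))) := by
  change Bool.rec (motive := fun _ => Bool) (Bool.rec (motive := fun _ => Bool)
    (forced (c.add 16) fun c' =>
          salted c' (m.land ((join gd.1 ms c 1 H).mul r)) fun t =>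
            consume (fun c'' t' s => salted c'' (m.xor (t.xor t')) fun m' =>
              forced c''.succ fun c₁ => forced (R.add s) fun R' =>
                greedy ms r Q F E H L c₁ m' R')
              gd.2 c'.succ t)
        (forced (R.add gd.2) fun R' => greedy ms r Q F E H L c m R') (bit F gd.1))
      (greedy ms r Q F E H L c m R) (bit E gd.1) = _
  simp only [forced_eq, salted_eq]
  cases bit E gd.1 <;> cases bit F gd.1 <;> rfl

/-- The total deficit of the members of `B` listed in `L`. -/
def deficitOf (B : Finset ℕ) (L : List (ℕ × ℕ)) : ℕ :=
  (L.map fun gd => if gd.1 ∈ B then gd.2 else 0).sum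

lemma deficitOf_cons (B : Finset ℕ) (gd : ℕ × ℕ) (L : List (ℕ × ℕ)) :
    deficitOf B (gd :: L) = (if gd.1 ∈ B then gd.2 else 0) + deficitOf B L := by
  simp [deficitOf]

/-- The cells of `m` lying over `B`. -/
def cellsOver (B : Finset ℕ) (N m : ℕ) : Finset ℕ := (ones m).filter fun z => z % N ∈ B

section Soundness

variable {n : ℕ} {B : Finset ℕ} {F E G H P : ℕ}

lemma le_of_greedy (k : ℕ) {L : List (ℕ × ℕ)} (hL : ∀ gd ∈ L, gd.1 < 2 ^ n)
    (hE : ∀ x ∈ ones E, x ∉ B) (hH : ∀ x ∈ ones H, x < 2 ^ n)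
    (hHB : ∀ x ∈ ones H, ∀ g ∈ B, x ||| g ∈ B) {Q c m R : ℕ}
    (h : greedy (masks n) (rep (2 ^ n) k) Q F E H L c m R = true) :
    R + deficitOf B L ≤ (ones Q).card + (cellsOver B (2 ^ n) m).card := by
  induction L generalizing c m R with
  | nil =>
    obtain ⟨c', t', s, hs, -, hle⟩ := exists_of_consume (show consume _ R c Q = true from h)
    have := Nat.eq_of_beq_eq_true hs
    simp only [deficitOf, List.map_nil, List.sum_nil]
    omega
  | cons gd L ih =>
    have ih {c m R} := @ih (fun gd' h' => hL gd' (by simp [h'])) c m R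
    have hg := hL gd (by simp)
    rw [greedy_cons, bit_eq, bit_eq] at h
    rw [deficitOf_cons]
    cases hEg : E.testBit gd.1 with
    | true =>
      rw [hEg] at h
      rw [if_neg (hE _ (mem_ones.2 hEg)), zero_add]
      exact ih h
    | false =>
      cases hFg : F.testBit gd.1 with
      | true =>
        rw [hEg, hFg] at h
        have := ih h
        split_ifs <;> omega
      | false =>
        rw [hEg, hFg, cond_false, cond_false] at h
        set J := join gd.1 (masks n) c 1 H with hJ
        set t := m.land (J.mul (rep (2 ^ n) k)) with ht
        obtain ⟨c', t', s, hk, hsub, hle⟩ := exists_of_consume h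
        have hrec := ih hk
        have htm : ones t ⊆ ones m := by
          intro z hz
          change z ∈ ones (m &&& _) at hz
          simp only [mem_ones, Nat.testBit_and, Bool.and_eq_true] at hz
          exact mem_ones.2 hz.1
        have hm' : ones (m.xor (t.xor t')) = ones m \ (ones t \ ones t') :=
          ones_xor_xor hsub htm
        have hcells : cellsOver B (2 ^ n) (m.xor (t.xor t')) ⊆ cellsOver B (2 ^ n) m := by
          rw [cellsOver, hm']
          exact Finset.filter_subset_filter _ Finset.sdiff_subset
        split_ifs with hgB
        · have hJB : ∀ z ∈ ones t, z % 2 ^ n ∈ B := by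
            intro z hz
            change z ∈ ones (m &&& _) at hz
            simp only [mem_ones, Nat.testBit_and, Bool.and_eq_true] at hz
            have hJlt : ∀ x ∈ ones J, x < 2 ^ n := by
              intro x hx
              obtain ⟨y, hy, rfl⟩ := exists_of_mem_ones_join hg hH hx
              exact Nat.or_lt_two_pow (hH y hy) hg
            obtain ⟨y, hy, hyz⟩ := exists_of_mem_ones_join hg hH
              (mod_mem_ones_of_mem_ones_mul_rep hJlt (mem_ones.2 hz.2))
            rw [hyz]
            exact hHB y hy _ hgB
          have hdisj : cellsOver B (2 ^ n) (m.xor (t.xor t')) ⊆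
              cellsOver B (2 ^ n) m \ (ones t \ ones t') := by
            intro z hz
            refine Finset.mem_sdiff.2 ⟨hcells hz, ?_⟩
            rw [cellsOver, hm', Finset.mem_filter, Finset.mem_sdiff] at hz
            exact hz.1.2
          have hsub' : ones t \ ones t' ⊆ cellsOver B (2 ^ n) m := by
            intro z hz
            have hz := (Finset.mem_sdiff.1 hz).1
            exact Finset.mem_filter.2 ⟨htm hz, hJB z hz⟩
          have h1 := Finset.card_le_card hdisj
          rw [Finset.card_sdiff_of_subset hsub', Finset.card_sdiff_of_subset hsub] at h1
          have h2 := Finset.card_le_card hsub'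
          rw [Finset.card_sdiff_of_subset hsub] at h2
          have h3 := Finset.card_le_card hsub
          omega
        · have := Finset.card_le_card hcells
          omega

/-- A pseudorandom cache tag for the left branch at tag `u`. -/
def leftTag (u : ℕ) : ℕ := ((u.mul 48271).add 11).mod 2147483647

/-- A pseudorandom tag for the right branch at tag `u`. -/
def rightTag (u : ℕ) : ℕ := ((u.mul 69621).add 7).mod 2147483647

/-- A tag for the leaf at tag `u`. -/
def leafTag (u : ℕ) : ℕ := u.mul 8192

/-- The greedy check when exactly the cells over `F` are known to be available. -/
noncomputable def leaf (ms : List ℕ) (L : List (ℕ × ℕ)) (P G r u F E : ℕ) : Bool :=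
  forced (leafTag u) fun c => salted c (P.land (F.mul r)) fun Q =>
  forced c.succ fun c => salted c (P.xor Q) fun m =>
  forced c.succ fun c => salted c (F.lor G) fun H => forced c.succ fun c =>
  greedy ms r Q F E H L c m 0

/-- A family of codes closed under joins with its own members and with those of `G`. -/
structure Closed (G : ℕ) (B : Finset ℕ) : Prop where
  or_mem : ∀ x ∈ B, ∀ y ∈ B, x ||| y ∈ B
  or_mem' : ∀ x ∈ ones G, ∀ y ∈ B, x ||| y ∈ B

lemma le_of_leaf (k : ℕ) {L : List (ℕ × ℕ)} (hL : ∀ gd ∈ L, gd.1 < 2 ^ n)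
    (hG : ∀ x ∈ ones G, x < 2 ^ n) (hB : Closed G B) (hBlt : ∀ x ∈ B, x < 2 ^ n)
    (hF : ∀ x ∈ ones F, x ∈ B) (hE : ∀ x ∈ ones E, x ∉ B) {u : ℕ}
    (h : leaf (masks n) L P G (rep (2 ^ n) k) u F E = true) :
    deficitOf B L ≤ (cellsOver B (2 ^ n) P).card := by
  simp only [leaf, forced_eq, salted_eq] at h
  set Q := P.land (F.mul (rep (2 ^ n) k)) with hQ
  have hH : ∀ x ∈ ones (F.lor G), x ∈ ones F ∨ x ∈ ones G := fun x hx => by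
    simpa only [ones_lor, Finset.mem_union] using hx
  have hle := le_of_greedy (B := B) k hL hE
    (fun x hx => (hH x hx).elim (fun h => hBlt x (hF x h)) (hG x))
    (fun x hx g hg => (hH x hx).elim (fun h => hB.or_mem x (hF x h) g hg)
      fun h => hB.or_mem' x h g hg) h
  have hQ' : ∀ z ∈ ones Q, P.testBit z = true ∧ z % 2 ^ n ∈ B := by
    intro z hz
    change z ∈ ones (P &&& _) at hz
    simp only [mem_ones, Nat.testBit_and, Bool.and_eq_true] at hz
    exact ⟨hz.1, hF _ (mod_mem_ones_of_mem_ones_mul_rep (fun x hx => hBlt x (hF x hx))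
      (mem_ones.2 hz.2))⟩
  have hsub : ones Q ⊆ cellsOver B (2 ^ n) P := fun z hz =>
    Finset.mem_filter.2 ⟨mem_ones.2 (hQ' z hz).1, (hQ' z hz).2⟩
  have hsub' : cellsOver B (2 ^ n) (P.xor Q) ⊆ cellsOver B (2 ^ n) P \ ones Q := by
    intro z hz
    obtain ⟨hz, hzB⟩ := Finset.mem_filter.1 hz
    change z ∈ ones (P ^^^ Q) at hz
    have h1 := hQ' z
    simp only [mem_ones, Nat.testBit_xor, cellsOver, Finset.mem_sdiff, Finset.mem_filter] at hz h1 ⊢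
    cases hq : Q.testBit z with
    | false => simpa [hq, hzB] using hz
    | true => simp [hq, (h1 hq).1] at hz
  have h1 := Finset.card_le_card hsub'
  rw [Finset.card_sdiff_of_subset hsub] at h1
  have h2 := Finset.card_le_card hsub
  omega

/-- Branch on the membership of the codes in `l`, running `leaf` as soon as it succeeds. -/
noncomputable def search (ms : List ℕ) (L : List (ℕ × ℕ)) (P G r : ℕ) (l : List (ℕ × ℕ)) :
    ℕ → ℕ → ℕ → Bool :=
  List.rec (fun u F E => leaf ms L P G r u F E) (fun gd _ ih u F E =>
    Bool.rec
      (Bool.rec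
        (forced (leftTag u) fun u₁ =>
          forced (rightTag u) fun u₂ =>
          forced (leafTag u₁) fun c =>
          salted c (F.lor (join gd.1 ms c.succ 1 (F.lor G))) fun F' =>
          salted u₂ (E.lor (Nat.shiftLeft 1 gd.1)) fun E' =>
          Bool.rec (ih u₂ F E') (Bool.rec false (ih u₂ F E') (ih u₁ F' E)) ((F'.land E).beq 0))
        true (leaf ms L P G r u F E))
      (ih u F E) (bit (F.lor E) gd.1)) l

lemma search_cons (ms : List ℕ) (L : List (ℕ × ℕ)) (P G r : ℕ) (gd : ℕ × ℕ)
    (l : List (ℕ × ℕ)) (u F E : ℕ) : ∃ c u₁ u₂,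
    search ms L P G r (gd :: l) u F E =
      cond (bit (F.lor E) gd.1) (search ms L P G r l u F E) (leaf ms L P G r u F E ||
        (search ms L P G r l u₂ F (E.lor (Nat.shiftLeft 1 gd.1)) &&
          (!((F.lor (join gd.1 ms c 1 (F.lor G))).land E).beq 0 ||
            search ms L P G r l u₁ (F.lor (join gd.1 ms c 1 (F.lor G))) E))) := by
  refine ⟨(leafTag (leftTag u)).succ, leftTag u, rightTag u, ?_⟩
  change Bool.rec (motive := fun _ => Bool) (Bool.rec (motive := fun _ => Bool)
    (forced (leftTag u) fun u₁ =>
      forced (rightTag u) fun u₂ =>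
      forced (leafTag u₁) fun c =>
      salted c (F.lor (join gd.1 ms c.succ 1 (F.lor G))) fun F' =>
      salted u₂ (E.lor (Nat.shiftLeft 1 gd.1)) fun E' =>
      Bool.rec (motive := fun _ => Bool) (search ms L P G r l u₂ F E')
        (Bool.rec (motive := fun _ => Bool) false (search ms L P G r l u₂ F E')
          (search ms L P G r l u₁ F' E)) ((F'.land E).beq 0))
    true (leaf ms L P G r u F E)) (search ms L P G r l u F E) (bit (F.lor E) gd.1) = _
  simp only [forced_eq, salted_eq]
  cases bit (F.lor E) gd.1
  · cases leaf ms L P G r u F E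
    · cases ((F.lor (join gd.1 ms (leafTag (leftTag u)).succ 1 (F.lor G))).land E).beq 0
      · simp
      · cases search ms L P G r l (leftTag u)
          (F.lor (join gd.1 ms (leafTag (leftTag u)).succ 1 (F.lor G))) E <;>
          simp
    · rfl
  · rfl

lemma le_of_search (k : ℕ) {L : List (ℕ × ℕ)} (hL : ∀ gd ∈ L, gd.1 < 2 ^ n)
    (hG : ∀ x ∈ ones G, x < 2 ^ n) (hB : Closed G B) (hBlt : ∀ x ∈ B, x < 2 ^ n)
    {l : List (ℕ × ℕ)} (hl : l ⊆ L) {u : ℕ} (hF : ∀ x ∈ ones F, x ∈ B)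
    (hE : ∀ x ∈ ones E, x ∉ B)
    (h : search (masks n) L P G (rep (2 ^ n) k) l u F E = true) :
    deficitOf B L ≤ (cellsOver B (2 ^ n) P).card := by
  induction l generalizing u F E with
  | nil => exact le_of_leaf k hL hG hB hBlt hF hE h
  | cons gd l ih =>
    have ih {u F E} := @ih F E (fun x hx => hl (List.mem_cons_of_mem _ hx)) u
    have hg := hL gd (hl (by simp))
    obtain ⟨c, u₁, u₂, hs⟩ := search_cons (masks n) L P G (rep (2 ^ n) k) gd l u F E
    rw [hs] at h
    cases hb : bit (F.lor E) gd.1 with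
    | true =>
      rw [hb] at h
      exact ih hF hE h
    | false =>
      rw [hb] at h
      set J := join gd.1 (masks n) c 1 (F.lor G) with hJ
      rw [cond_false, Bool.or_eq_true, Bool.and_eq_true] at h
      rcases h with h | ⟨h₂, h₁⟩
      · exact le_of_leaf k hL hG hB hBlt hF hE h
      · by_cases hgB : gd.1 ∈ B
        · have hF' : ∀ x ∈ ones (F.lor J), x ∈ B := by
            intro x hx
            rw [ones_lor, Finset.mem_union] at hx
            rcases hx with hx | hx
            · exact hF x hx
            · have hFG : ∀ x ∈ ones (F.lor G), x ∈ ones F ∨ x ∈ ones G := fun x hx => by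
                simpa only [ones_lor, Finset.mem_union] using hx
              obtain ⟨y, hy, rfl⟩ := exists_of_mem_ones_join hg
                (fun x hx => (hFG x hx).elim (fun h => hBlt x (hF x h)) (hG x)) hx
              exact (hFG y hy).elim (fun h => hB.or_mem y (hF y h) _ hgB)
                fun h => hB.or_mem' y h _ hgB
          have h0 : ((F.lor J).land E).beq 0 = true := by
            rw [Nat.beq_eq]
            apply ones_injective
            rw [ones_zero, Finset.eq_empty_iff_forall_notMem]
            intro z hz
            change z ∈ ones ((F.lor J) &&& E) at hz
            simp only [mem_ones, Nat.testBit_and, Bool.and_eq_true] at hz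
            exact hE z (mem_ones.2 hz.2) (hF' z (mem_ones.2 hz.1))
          rw [h0] at h₁
          exact ih hF' hE h₁
        · refine ih hF (fun x hx => ?_) h₂
          rw [mem_ones, testBit_or_shiftLeft_one, Bool.or_eq_true, decide_eq_true_eq] at hx
          rcases hx with hx | rfl
          · exact hE x (mem_ones.2 hx)
          · exact hgB

end Soundness

/-- The total weight of the set coded by `x`, where `i` has weight `cs[i]`. -/
def weight : List ℕ → ℕ → ℕ
  | [], _ => 0
  | c :: cs, x => cond (x.testBit 0) c 0 + weight cs (x / 2)

/-- The codes `x` whose doubled weight is below the total, with the difference,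
largest difference first. -/
def deficits (n : ℕ) (cs : List ℕ) : List (ℕ × ℕ) :=
  (List.range cs.sum).flatMap fun e =>
    ((List.range (2 ^ n)).filter fun x => (2 * weight cs x).beq e).map fun x => (x, cs.sum - e)

/-- The code of the set of cells `x + 2 ^ n * j` with `j` less than the surplus of `x`. -/
def surplus (n : ℕ) (cs : List ℕ) : ℕ :=
  maskOf (fun z => Nat.ble (cs.sum + z / 2 ^ n + 1) (2 * weight cs (z % 2 ^ n)))
    (2 ^ n * cs.sum) 0

/-- Check that closed families over `A` have average weight at least half of the total. -/
noncomputable def certify (cs A : List ℕ) : Bool :=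
  forced cs.length fun n => forcedList (masks n) fun ms => forcedPairs (deficits n cs) fun L =>
  forced (surplus n cs) fun P => forced (joins ms A) fun G => forced (rep (2 ^ n) cs.sum) fun r =>
  search ms L P G r L 1 0 0

lemma mem_deficits {n : ℕ} {cs : List ℕ} {gd : ℕ × ℕ} :
    gd ∈ deficits n cs ↔
      gd.1 < 2 ^ n ∧ 2 * weight cs gd.1 < cs.sum ∧ gd.2 = cs.sum - 2 * weight cs gd.1 := by
  obtain ⟨g, d⟩ := gd
  simp only [deficits, List.mem_flatMap, List.mem_range, List.mem_map, List.mem_filter,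
    Nat.beq_eq, Prod.mk.injEq]
  constructor
  · rintro ⟨e, he, x, ⟨hx, rfl⟩, rfl, rfl⟩
    exact ⟨hx, he, rfl⟩
  · rintro ⟨hg, hlt, rfl⟩
    exact ⟨_, hlt, g, ⟨hg, rfl⟩, rfl, rfl⟩

lemma sum_le_deficitOf (n : ℕ) (cs : List ℕ) (B : Finset ℕ) (hB : ∀ x ∈ B, x < 2 ^ n) :
    ∑ x ∈ B, (cs.sum - 2 * weight cs x) ≤ deficitOf B (deficits n cs) := by
  set φ : ℕ × ℕ → ℕ := fun gd => if gd.1 ∈ B then gd.2 else 0 with hφ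
  set B' := B.filter fun x => 2 * weight cs x < cs.sum with hB'
  set S : Finset (ℕ × ℕ) := B'.map ⟨fun x => (x, cs.sum - 2 * weight cs x),
    fun x y h => (Prod.mk.inj h).1⟩ with hS
  have hle : S.val ≤ (deficits n cs : Multiset (ℕ × ℕ)) := by
    refine (Multiset.le_iff_subset S.nodup).2 fun gd hgd => ?_
    obtain ⟨x, hx, rfl⟩ := Finset.mem_map.1 hgd
    have hx := Finset.mem_filter.1 hx
    exact Multiset.mem_coe.2 (mem_deficits.2 ⟨hB x hx.1, hx.2, rfl⟩)
  have h1 : ∑ x ∈ B, (cs.sum - 2 * weight cs x) = ∑ gd ∈ S, φ gd := by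
    rw [hS, Finset.sum_map, hB', Finset.sum_filter]
    refine Finset.sum_congr rfl fun x hx => ?_
    change _ = if _ then (if x ∈ B then cs.sum - 2 * weight cs x else 0) else 0
    rw [if_pos hx]
    split_ifs with h <;> omega
  rw [h1]
  obtain ⟨u, hu⟩ := Multiset.le_iff_exists_add.1 (Multiset.map_le_map hle (f := φ))
  have h2 : deficitOf B (deficits n cs) =
      (Multiset.map φ (deficits n cs : Multiset (ℕ × ℕ))).sum := by
    simp [deficitOf, hφ]
  rw [h2, hu, Multiset.sum_add]
  exact Nat.le_add_right _ _

lemma card_cellsOver_surplus_le (n : ℕ) (cs : List ℕ) (B : Finset ℕ) :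
    (cellsOver B (2 ^ n) (surplus n cs)).card ≤ ∑ x ∈ B, (2 * weight cs x - cs.sum) := by
  have hmaps : Set.MapsTo (· % 2 ^ n) (cellsOver B (2 ^ n) (surplus n cs) : Set ℕ) (B : Set ℕ) :=
    fun z hz => (Finset.mem_filter.1 hz).2
  rw [Finset.card_eq_sum_card_fiberwise hmaps]
  refine Finset.sum_le_sum fun x _ => ?_
  rw [← Finset.card_range (2 * weight cs x - cs.sum)]
  refine Finset.card_le_card_of_injOn (· / 2 ^ n) (fun z hz => ?_) fun z hz z' hz' h => ?_
  · obtain ⟨hz, hzx⟩ := Finset.mem_filter.1 hz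
    have hz := (Finset.mem_filter.1 hz).1
    rw [mem_ones, surplus, testBit_maskOf] at hz
    simp only [Nat.zero_testBit, Bool.or_false, Bool.and_eq_true, Nat.ble_eq] at hz
    rw [hzx] at hz
    simp only [Finset.coe_range, Set.mem_Iio]
    omega
  · have h1 := (Finset.mem_filter.1 hz).2
    have h2 := (Finset.mem_filter.1 hz').2
    dsimp only at h1 h2 h
    rw [← Nat.div_add_mod z (2 ^ n), ← Nat.div_add_mod z' (2 ^ n), h, h1, h2]

theorem sum_le_of_certify {cs A : List ℕ} (hA : ∀ a ∈ A, a < 2 ^ cs.length)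
    (h : certify cs A = true) {B : Finset ℕ} (hBlt : ∀ x ∈ B, x < 2 ^ cs.length)
    (hB : Closed (joins (masks cs.length) A) B) :
    B.card * cs.sum ≤ ∑ x ∈ B, 2 * weight cs x := by
  simp only [certify, forced_eq, forcedList_eq, forcedPairs_eq] at h
  have hle := le_of_search (B := B) cs.sum (fun gd h => (mem_deficits.1 h).1)
    (fun x hx => (joins_induction hA (p := fun _ => True) trivial (fun _ _ => trivial)
      (fun _ _ _ _ => trivial) x hx).1) hB hBlt (List.Subset.refl _)
    (by simp) (by simp) h
  have h1 := sum_le_deficitOf cs.length cs B hBlt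
  have h2 := card_cellsOver_surplus_le cs.length cs B
  have h3 : ∑ x ∈ B, ((cs.sum - 2 * weight cs x) + 2 * weight cs x) =
      ∑ x ∈ B, ((2 * weight cs x - cs.sum) + cs.sum) :=
    Finset.sum_congr rfl fun x _ => by omega
  rw [Finset.sum_add_distrib, Finset.sum_add_distrib, Finset.sum_const, smul_eq_mul] at h3
  omega

/-! ### From certificates to union-closed families -/

/-- The set coded by `x`, relabelled by `σ`. -/
def decode (σ : ℕ → ℕ) (x : ℕ) : Finset ℕ := (ones x).image σ

lemma decode_or (σ : ℕ → ℕ) (x y : ℕ) : decode σ (x ||| y) = decode σ x ∪ decode σ y := by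
  rw [decode, ones_or, Finset.image_union, decode, decode]

lemma mem_decode {σ : ℕ → ℕ} {n x i : ℕ} (hσ : Set.InjOn σ (Finset.range n)) (hx : x < 2 ^ n)
    (hi : i < n) : σ i ∈ decode σ x ↔ x.testBit i = true := by
  rw [decode, Finset.mem_image]
  constructor
  · rintro ⟨j, hj, h⟩
    have hjn := lt_two_pow_of_mem_ones hx hj
    rw [hσ (by simpa using hjn) (by simpa using hi) h] at hj
    exact mem_ones.1 hj
  · exact fun h => ⟨i, mem_ones.2 h, rfl⟩

lemma exists_ones_eq {n : ℕ} {s : Finset ℕ} (hs : s ⊆ Finset.range n) :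
    ∃ x < 2 ^ n, ones x = s := by
  refine ⟨∑ i ∈ s, 2 ^ i, ?_, Finset.toFinset_bitIndices_sum_two_pow s⟩
  refine Nat.lt_pow_two_of_testBit _ fun i hi => ?_
  by_contra h
  rw [Bool.not_eq_false, ← mem_ones, ones, Finset.toFinset_bitIndices_sum_two_pow] at h
  exact absurd (Finset.mem_range.1 (hs h)) hi.not_gt

lemma exists_decode_eq {σ : ℕ → ℕ} {n : ℕ} {X : Finset ℕ} (hX : X ⊆ (Finset.range n).image σ) :
    ∃ x < 2 ^ n, decode σ x = X := by
  obtain ⟨s, hs, rfl⟩ := Finset.subset_image_iff.1 hX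
  obtain ⟨x, hx, rfl⟩ := exists_ones_eq (Finset.coe_subset.1 hs)
  exact ⟨x, hx, rfl⟩

lemma weight_eq_sum (cs : List ℕ) (x : ℕ) :
    weight cs x = ∑ i ∈ Finset.range cs.length, if x.testBit i then cs.getD i 0 else 0 := by
  induction cs generalizing x with
  | nil => simp [weight]
  | cons c cs ih =>
    rw [weight, ih, List.length_cons, Finset.sum_range_succ', add_comm]
    simp [Nat.testBit_succ, Bool.cond_eq_ite]

lemma list_sum_eq_sum_range (cs : List ℕ) :
    cs.sum = ∑ i ∈ Finset.range cs.length, cs.getD i 0 := by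
  induction cs with
  | nil => simp
  | cons c cs ih => rw [List.sum_cons, ih, List.length_cons, Finset.sum_range_succ', add_comm]; simp

theorem exists_card_le_of_certify {cs A : List ℕ} (hA : ∀ a ∈ A, a < 2 ^ cs.length)
    (hcs : 0 < cs.sum) (h : certify cs A = true) {σ : ℕ → ℕ}
    (hσ : Set.InjOn σ (Finset.range cs.length)) {F : Finset (Finset ℕ)} (hF : UC F)
    (hAF : ∀ a ∈ A, decode σ a ∈ F) :
    ∃ i < cs.length, F.card ≤ 2 * (memFam F (σ i)).card := by
  set n := cs.length with hn
  set I := (Finset.range n).image σ with hI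
  have hdI : ∀ x < 2 ^ n, decode σ x ⊆ I := fun x hx =>
    Finset.image_subset_image fun i hi => Finset.mem_range.2 (lt_two_pow_of_mem_ones hx hi)
  set wt : Finset ℕ → ℕ := fun S => ∑ i ∈ Finset.range n, if σ i ∈ S then cs.getD i 0 else 0
    with hwt
  have hfiber : ∀ T ∈ F.image (· \ I), (F.filter fun S => S \ I = T).card * cs.sum ≤
      ∑ S ∈ F with S \ I = T, 2 * wt S := by
    intro T hT
    obtain ⟨S₀, -, hS₀⟩ := Finset.mem_image.1 hT
    have hTI : ∀ i ∈ I, i ∉ T := fun i hi h => by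
      rw [← hS₀] at h
      exact (Finset.mem_sdiff.1 h).2 hi
    have hσT : ∀ i < n, σ i ∉ T := fun i hi =>
      hTI _ (Finset.mem_image_of_mem σ (Finset.mem_range.2 hi))
    set B := (Finset.range (2 ^ n)).filter fun x => decode σ x ∪ T ∈ F with hB
    have hBmem : ∀ x, x ∈ B ↔ x < 2 ^ n ∧ decode σ x ∪ T ∈ F := fun x => by simp [hB]
    have hmem : ∀ x < 2 ^ n, ∀ i < n, σ i ∈ decode σ x ∪ T ↔ x.testBit i = true := by
      intro x hx i hi
      rw [Finset.mem_union, mem_decode hσ hx hi, or_iff_left (hσT i hi)]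
    have hinj : Set.InjOn (fun x => decode σ x ∪ T) (B : Set ℕ) := by
      intro x hx y hy hxy
      have hx := ((hBmem x).1 hx).1
      have hy := ((hBmem y).1 hy).1
      refine Nat.eq_of_testBit_eq fun i => ?_
      by_cases hi : i < n
      · rw [Bool.eq_iff_iff, ← hmem x hx i hi, ← hmem y hy i hi]
        exact Finset.ext_iff.1 hxy (σ i)
      · have hle := Nat.pow_le_pow_right two_pos (not_lt.1 hi)
        rw [Nat.testBit_lt_two_pow (hx.trans_le hle), Nat.testBit_lt_two_pow (hy.trans_le hle)]
    have himage : (F.filter fun S => S \ I = T) = B.image fun x => decode σ x ∪ T := by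
      ext S
      simp only [Finset.mem_filter, Finset.mem_image, hBmem]
      constructor
      · rintro ⟨hS, rfl⟩
        obtain ⟨x, hx, hxS⟩ := exists_decode_eq (σ := σ) (n := n) (X := S ∩ I)
          Finset.inter_subset_right
        have hSx : decode σ x ∪ S \ I = S := by
          rw [hxS, Finset.union_comm, Finset.sdiff_union_inter]
        exact ⟨x, ⟨hx, hSx.symm ▸ hS⟩, hSx⟩
      · rintro ⟨x, ⟨hx, hxF⟩, rfl⟩
        refine ⟨hxF, ?_⟩
        rw [Finset.union_sdiff_distrib, Finset.sdiff_eq_empty_iff_subset.2 (hdI x hx),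
          Finset.empty_union, Finset.sdiff_eq_self_iff_disjoint.2]
        exact Finset.disjoint_right.2 hTI
    have hclosed : Closed (joins (masks n) A) B := by
      refine ⟨fun x hx y hy => ?_, fun x hx y hy => ?_⟩
      · rw [hBmem] at hx hy ⊢
        refine ⟨Nat.or_lt_two_pow hx.1 hy.1, ?_⟩
        rw [decode_or, Finset.union_union_distrib_right]
        exact hF _ hx.2 _ hy.2
      · obtain ⟨hxn, hxF⟩ := joins_induction hA (p := fun y => ∀ Z ∈ F, decode σ y ∪ Z ∈ F)
          (fun Z hZ => by simpa [decode] using hZ) (fun a ha Z hZ => hF _ (hAF a ha) _ hZ)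
          (fun y z hy hz Z hZ => by
            rw [decode_or, Finset.union_assoc]
            exact hy _ (hz _ hZ)) x hx
        rw [hBmem] at hy ⊢
        refine ⟨Nat.or_lt_two_pow hxn hy.1, ?_⟩
        rw [decode_or, Finset.union_assoc]
        exact hxF _ hy.2
    rw [himage, Finset.card_image_of_injOn hinj, Finset.sum_image hinj]
    refine (sum_le_of_certify hA h (fun x hx => ((hBmem x).1 hx).1) hclosed).trans_eq ?_
    refine Finset.sum_congr rfl fun x hx => ?_
    rw [weight_eq_sum]
    congr 1
    refine Finset.sum_congr rfl fun i hi => ?_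
    simp only [hmem x ((hBmem x).1 hx).1 i (Finset.mem_range.1 hi)]
  have htotal : F.card * cs.sum ≤ ∑ S ∈ F, 2 * wt S := by
    have hmaps : Set.MapsTo (· \ I) (F : Set (Finset ℕ)) (F.image (· \ I) : Set (Finset ℕ)) :=
      fun S hS => Finset.mem_coe.2 (Finset.mem_image_of_mem _ hS)
    rw [Finset.card_eq_sum_card_fiberwise hmaps, Finset.sum_mul,
      ← Finset.sum_fiberwise_of_maps_to hmaps]
    exact Finset.sum_le_sum hfiber
  have hswap : ∑ S ∈ F, 2 * wt S =
      ∑ i ∈ Finset.range n, cs.getD i 0 * (2 * (memFam F (σ i)).card) := by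
    simp only [hwt, Finset.mul_sum]
    rw [Finset.sum_comm]
    refine Finset.sum_congr rfl fun i _ => ?_
    rw [memFam, ← Finset.mul_sum, ← Finset.sum_filter, Finset.sum_const, smul_eq_mul]
    ring
  by_contra! hlt
  have hle : ∑ i ∈ Finset.range n, cs.getD i 0 * (2 * (memFam F (σ i)).card + 1) ≤
      ∑ i ∈ Finset.range n, cs.getD i 0 * F.card :=
    Finset.sum_le_sum fun i hi => Nat.mul_le_mul_left _ (hlt i (Finset.mem_range.1 hi))
  simp only [mul_add, mul_one, Finset.sum_add_distrib] at hle
  rw [← Finset.sum_mul, ← list_sum_eq_sum_range, ← hswap, mul_comm cs.sum] at hle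
  omega

/-! ### Families of triples of a seven-element set -/

/-- Whenever a family of at least four triples of a seven-element set contains the sets coded
by `A`, the union-closed families above it have an abundant element in its union. -/
def Settled (A : List ℕ) : Prop :=
  ∀ σ : ℕ → ℕ, Set.InjOn σ (Finset.range 7) →
  ∀ S ⊆ ((Finset.range 7).image σ).powersetCard 3, 4 ≤ S.card → (∀ a ∈ A, decode σ a ∈ S) →
  ∀ F : Finset (Finset ℕ), UC F → S ⊆ F → ∃ X ∈ S, ∃ i ∈ X, F.card ≤ 2 * (memFam F i).card

lemma settled_of_certify {cs A : List ℕ} (hn : cs.length ≤ 7) (hcs : 0 < cs.sum)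
    (hA : ∀ a ∈ A, a < 2 ^ cs.length)
    (hcov : ∀ i < cs.length, ∃ a ∈ A, a.testBit i = true) (h : certify cs A = true) :
    Settled A := by
  intro σ hσ S _ _ hAS F hF hSF
  obtain ⟨i, hi, hle⟩ := exists_card_le_of_certify hA hcs h
    (hσ.mono (Finset.coe_subset.2 (Finset.range_subset_range.2 hn))) hF
    fun a ha => hSF (hAS a ha)
  obtain ⟨a, ha, hai⟩ := hcov i hi
  exact ⟨_, hAS a ha, σ i, Finset.mem_image_of_mem σ (mem_ones.2 hai), hle⟩

/-- The map on `{0, …, 6}` whose value at `i` is the `i`-th decimal digit of `q`. -/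
def digit (q i : ℕ) : ℕ := q / 10 ^ i % 10

/-- The code of the image of `ones x` under `digit q`. -/
def permute (q x : ℕ) : ℕ :=
  (List.range 7).foldr (fun i y => cond (x.testBit i) (y ||| 2 ^ digit q i) y) 0

lemma ones_permute (q : ℕ) {x : ℕ} (hx : x < 2 ^ 7) :
    ones (permute q x) = (ones x).image (digit q) := by
  have key : ∀ l : List ℕ, ones (l.foldr (fun i y => cond (x.testBit i) (y ||| 2 ^ digit q i) y) 0)
      = (l.toFinset.filter fun i => x.testBit i = true).image (digit q) := by
    intro l
    induction l with
    | nil => simp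
    | cons i l ih =>
      rw [List.foldr_cons, List.toFinset_cons, Finset.filter_insert]
      cases x.testBit i with
      | false => simpa using ih
      | true =>
        have hpow : ones (2 ^ digit q i) = {digit q i} := by
          ext j
          rw [mem_ones, Nat.testBit_two_pow, decide_eq_true_iff, Finset.mem_singleton, eq_comm]
        rw [cond_true, ones_or, ih, if_pos rfl, Finset.image_insert, hpow, Finset.insert_eq,
          Finset.union_comm]
  rw [permute, key]
  congr 1
  ext i
  simp only [Finset.mem_filter, List.mem_toFinset, List.mem_range, mem_ones, and_iff_right_iff_imp]
  exact fun h => lt_two_pow_of_mem_ones hx (mem_ones.2 h)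

/-- The codes of the triples of `{0, …, 6}`. -/
def triples : List ℕ :=
  (List.range 128).filter fun x => ((List.range 7).filter fun i => x.testBit i).length == 3

lemma mem_triples {x : ℕ} (hx : x < 2 ^ 7) (h : (ones x).card = 3) : x ∈ triples := by
  rw [triples, List.mem_filter, List.mem_range, beq_iff_eq]
  refine ⟨hx, ?_⟩
  rw [← List.toFinset_card_of_nodup (List.nodup_range.filter _), ← h]
  congr 1
  ext i
  simp only [List.mem_toFinset, List.mem_filter, List.mem_range, mem_ones, and_iff_right_iff_imp]
  exact fun h => lt_two_pow_of_mem_ones hx (mem_ones.2 h)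

/-- Check that `digit q` permutes `{0, …, 6}`. -/
def isPerm (q : ℕ) : Bool :=
  (List.range 7).all fun j => (List.range 7).any fun i => (digit q i).beq j

/-- Check that every triple completes `A` to a relabelling of a member of `known`. -/
def covers (qs : List ℕ) (known : List (List ℕ)) (A : List ℕ) : Bool :=
  qs.all isPerm && triples.all fun t => A.contains t ||
    qs.any fun q => known.any fun K =>
      K.all fun a => Nat.ble (a + 1) 128 && (t :: A).contains (permute q a)

lemma image_digit_of_isPerm {q : ℕ} (h : isPerm q = true) :
    (Finset.range 7).image (digit q) = Finset.range 7 := by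
  have hsub : Finset.range 7 ⊆ (Finset.range 7).image (digit q) := by
    intro j hj
    simp only [isPerm, List.all_eq_true, List.any_eq_true, List.mem_range, Nat.beq_eq] at h
    obtain ⟨i, hi, rfl⟩ := h j (Finset.mem_range.1 hj)
    exact Finset.mem_image_of_mem _ (Finset.mem_range.2 hi)
  exact (Finset.eq_of_subset_of_card_le hsub Finset.card_image_le).symm

lemma settled_of_covers {qs : List ℕ} {known : List (List ℕ)} {A : List ℕ} (hA : A.length < 4)
    (h : covers qs known A = true) (hknown : ∀ K ∈ known, Settled K) : Settled A := by
  intro σ hσ S hS hcard hAS F hF hSF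
  obtain ⟨X, hX, hXA⟩ : ∃ X ∈ S, X ∉ (A.map (decode σ)).toFinset := by
    by_contra! hsub
    have := Finset.card_le_card hsub
    have := (A.map (decode σ)).toFinset_card_le
    rw [List.length_map] at this
    omega
  obtain ⟨hXσ, hX3⟩ := Finset.mem_powersetCard.1 (hS hX)
  obtain ⟨t, ht, rfl⟩ := exists_decode_eq hXσ
  have ht3 : (ones t).card = 3 := by
    rw [← hX3, decode, Finset.card_image_of_injOn]
    exact hσ.mono fun i hi => by simpa using lt_two_pow_of_mem_ones ht (Finset.mem_coe.1 hi)
  rw [covers, Bool.and_eq_true, List.all_eq_true, List.all_eq_true] at h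
  obtain ⟨hperm, h⟩ := h
  have hcov := h t (mem_triples ht ht3)
  rw [Bool.or_eq_true, List.contains_iff_mem] at hcov
  rcases hcov with hcov | hcov
  · exact absurd (by simpa using ⟨t, hcov, rfl⟩) hXA
  simp only [List.any_eq_true, List.all_eq_true, Bool.and_eq_true, Nat.ble_eq,
    List.contains_iff_mem] at hcov
  obtain ⟨q, hq, K, hK, hKA⟩ := hcov
  have himg := image_digit_of_isPerm (hperm q hq)
  have hinj : Set.InjOn (digit q) (Finset.range 7) :=
    Finset.injOn_of_card_image_eq (by rw [himg])
  refine hknown K hK (σ ∘ digit q) (hσ.comp hinj fun i hi => ?_) S ?_ hcard (fun a ha => ?_)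
    F hF hSF
  · rw [← himg, Finset.coe_image]
    exact Set.mem_image_of_mem _ hi
  · rwa [← Finset.image_image, himg]
  · obtain ⟨ha, hmem⟩ := hKA a ha
    have hdec : decode (σ ∘ digit q) a = decode σ (permute q a) := by
      rw [decode, decode, ones_permute q (by omega), Finset.image_image]
    rw [hdec]
    rcases List.mem_cons.1 hmem with h | h
    · rwa [h]
    · exact hAS _ h

/-- Check a list of families, each covered by the known families and its predecessors. -/
def coversAll : List (List ℕ) → List (List ℕ × List ℕ) → Bool
  | _, [] => true
  | known, row :: rows => Nat.ble row.1.length 3 && covers row.2 known row.1 &&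
      coversAll (row.1 :: known) rows

lemma settled_of_coversAll : ∀ {known : List (List ℕ)} {rows : List (List ℕ × List ℕ)},
    coversAll known rows = true → (∀ K ∈ known, Settled K) → ∀ row ∈ rows, Settled row.1
  | _, [], _, _ => by simp
  | known, row :: rows, h, hknown => by
    rw [coversAll, Bool.and_eq_true, Bool.and_eq_true, Nat.ble_eq] at h
    have hrow := settled_of_covers (Nat.lt_succ_of_le h.1.1) h.1.2 hknown
    rw [List.forall_mem_cons]
    exact ⟨hrow, settled_of_coversAll h.2 (List.forall_mem_cons.2 ⟨hrow, hknown⟩)⟩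

/-- Families of triples, each preceded by the weights of a certificate for it. -/
def certificates : List (List ℕ × List ℕ) := [
  ([3, 3, 2, 2, 2], [7, 11, 19]),
  ([1, 1, 1, 1], [7, 11, 13]),
  ([4, 3, 3, 2, 2], [7, 11, 21]),
  ([2, 2, 2, 2, 1], [7, 11, 28]),
  ([2, 2, 1, 2, 1, 1], [7, 25, 42]),
  ([5, 3, 2, 2, 3, 2, 2], [7, 11, 49, 81]),
  ([2, 2, 1, 1, 2, 1, 1], [7, 11, 49, 82]),
  ([3, 2, 3, 1, 3, 2, 2], [7, 11, 49, 84]),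
  ([4, 3, 2, 2, 3, 3, 2], [7, 11, 49, 112]),
  ([1, 1, 1, 1, 1, 1], [7, 11, 52, 56]),
  ([2, 2, 2, 2, 2, 1, 1], [7, 11, 52, 88]),
  ([3, 3, 4, 2, 3, 3, 2], [7, 11, 52, 112])]

/-- Check that `A` consists of subsets of the index set of `cs` and covers it. -/
def fits (cs A : List ℕ) : Bool :=
  Nat.ble cs.length 7 && Nat.ble 1 cs.sum && A.all (fun a => Nat.ble (a + 1) (2 ^ cs.length)) &&
    (List.range cs.length).all fun i => A.any fun a => a.testBit i

set_option maxHeartbeats 0 in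
lemma certify_of_mem_certificates : ∀ p ∈ certificates, certify p.1 p.2 = true := by
  have h : (certificates.all fun p => certify p.1 p.2) = true := by decide +kernel
  exact List.all_eq_true.1 h

lemma fits_of_mem_certificates : ∀ p ∈ certificates, fits p.1 p.2 = true := by
  have h : (certificates.all fun p => fits p.1 p.2) = true := by decide +kernel
  exact List.all_eq_true.1 h

lemma settled_of_mem_certificates : ∀ K ∈ certificates.map Prod.snd, Settled K := by
  intro K hK
  obtain ⟨p, hp, rfl⟩ := List.mem_map.1 hK
  have hfits := fits_of_mem_certificates p hp
  simp only [fits, Bool.and_eq_true, List.all_eq_true, List.any_eq_true, List.mem_range,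
    Nat.ble_eq] at hfits
  obtain ⟨⟨⟨hlen, hsum⟩, hA⟩, hcov⟩ := hfits
  exact settled_of_certify hlen hsum hA hcov (certify_of_mem_certificates p hp)

/-- Families of fewer than four triples, each followed by relabellings that show it to be covered
by its predecessors and the families in `certificates`. -/
def coverings : List (List ℕ × List ℕ) := [
  ([7, 11, 49], [6543210, 6453210, 5463201, 6542310, 6452310, 5463210, 6354210, 6345210, 5462310,
    6254310, 6245310, 5462301, 6321054, 6312054, 6213054]),
  ([7, 11, 52], [6543210, 6453201, 5463210, 4653210, 5643201, 4563201, 6542310, 6452310, 5462310,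
    6542301, 6452301, 5462301, 3106542, 3106452]),
  ([7, 11, 112], [6543210, 5463201, 4653210, 5642310, 6542301, 4652301, 5463210, 6452310, 5462310,
    6543201, 6453201, 5462301]),
  ([7, 25, 97], [6543210, 5643210, 4653210, 6534210, 5634210, 6435210, 5436210, 3654210, 6543120,
    5643120, 4653120, 6534120, 5634120, 6435120, 5436120, 3654120, 6215430, 5216430, 6215340,
    5216340, 6543021, 6534021, 6435021, 5436021, 6521043, 4321065, 6512043, 4312065, 6215043,
    5216043, 4213065, 3214065]),
  ([7, 25, 98], [6512430, 4302561, 6512340, 6543210, 5643210, 6534210, 5634210, 6435210, 5436210,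
    4635210, 4536210, 3645210, 3546210, 6542310, 6532410, 5634120, 6435120, 5436120, 6543021,
    6534021, 6435021, 6512043, 6215043, 5216043, 4302165, 4203165, 3204165]),
  ([7, 11], [6543210, 5463201, 4653210, 5642310, 6542301, 4652301, 5463210, 6452310, 5462310,
    6543201, 6453201, 5462301]),
  ([7, 25], [6543210, 6543120, 6521340, 6534120, 5621430, 5634210, 6435210, 5436210, 5643120,
    5634120, 6435120, 5436120, 6215430, 5216430, 6215340, 5216340, 6543021, 6534021, 6435021,
    5436021, 6521043, 6512043, 6215043, 5216043]),
  ([7, 56], [6543210, 6435210, 5436210, 6354210, 5364120, 4365120, 6543102, 5436102, 6543021,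
    6435021, 5436021, 6354021, 2016534, 2016435, 1062435, 1062354, 2106354]),
  ([7], [6543210, 5436210, 4635210, 3654210, 5364120, 4365120, 6543102, 5436102, 6543021, 6435021,
    5436021, 6354021, 5364201, 4365201, 6453102, 6354102, 5364102, 4365102]),
  ([], [6543210, 6542310, 6532410, 6432510, 5432610, 6541320, 6531420, 6431520, 5431620, 6521430,
    6421530, 5421630, 6321540, 5321640, 4321650, 6540321, 6530421, 6430521, 5430621, 6520431,
    6420531, 5420631, 6320541, 5320641, 4320651, 6510432, 6410532, 5410632, 6310542, 5310642,
    4310652, 6210543, 5210643, 4210653, 3210654])]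

lemma settled_nil : Settled [] := by
  have h : coversAll (certificates.map Prod.snd) coverings = true := by decide +kernel
  exact settled_of_coversAll h settled_of_mem_certificates _
    (List.mem_of_getLast? (a := ([], _)) rfl)


/-! ### Families with four triples -/

lemma subset_gen (S : Finset (Finset ℕ)) : S ⊆ gen S := fun X hX =>
  Finset.mem_image.2 ⟨{X}, Finset.mem_filter.2
    ⟨Finset.mem_powerset.2 (Finset.singleton_subset_iff.2 hX), Finset.singleton_nonempty X⟩,
    Finset.sup_singleton ..⟩

lemma gen_subset {S F : Finset (Finset ℕ)} (hF : UC F) (hSF : S ⊆ F) : gen S ⊆ F := by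
  intro X hX
  obtain ⟨T, hT, rfl⟩ := Finset.mem_image.1 hX
  obtain ⟨hTS, hne⟩ := Finset.mem_filter.1 hT
  rw [← Finset.sup'_eq_sup hne]
  exact Finset.sup'_mem (F : Set (Finset ℕ)) hF T hne id
    fun Y hY => hSF (Finset.mem_powerset.1 hTS hY)

lemma famU_gen_subset {S : Finset (Finset ℕ)} {I : Finset ℕ} (h : ∀ X ∈ S, X ⊆ I) :
    famU (gen S) ⊆ I := by
  have hpow : gen S ⊆ I.powerset := gen_subset
    (fun X hX Y hY => Finset.mem_powerset.2
      (Finset.union_subset (Finset.mem_powerset.1 hX) (Finset.mem_powerset.1 hY)))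
    fun X hX => Finset.mem_powerset.2 (h X hX)
  exact Finset.sup_le fun X hX => Finset.mem_powerset.1 (hpow hX)

theorem FC_gen_of_card {S : Finset (Finset ℕ)} (hS : S ⊆ (Finset.Icc 1 7).powersetCard 3)
    (hcard : 4 ≤ S.card) : FC (gen S) := by
  intro F hF hSF
  have himage : (Finset.range 7).image (· + 1) = Finset.Icc 1 7 := by decide
  obtain ⟨X, hX, i, hi, hle⟩ := settled_nil (· + 1) (add_left_injective 1).injOn S
    (by rwa [himage]) hcard (by simp) F hF ((subset_gen S).trans hSF)
  exact ⟨i, Finset.mem_sup.2 ⟨X, subset_gen S hX, hi⟩, hle⟩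

/-! ### Three triples without an abundant element -/

/-- A union-closed family of subsets of `{1, …, 13}`, given by pairs `(u, m)`: the binary digits
of `m` say which sets of code at most `127` it contains together with the set of code `u`. -/
def layers : List (ℕ × ℕ) := [
  (0, 181444813721499551478998194224596289664),
  (31, 294865346299334326212603282403121028565),
  (47, 294869845656110084712315260264632409557),
  (55, 249498863399984956250531979273729981363),
  (59, 249498863341894861678704278690850716595),
  (61, 182099043168073824125659105618181458175),
  (62, 190822101892443360909072960296934412175),
  (63, 340282366920938463463374607431768211455)]

/-- The codes of the sets in a layer. -/
def layerCodes (m : ℕ) : List ℕ := (List.range 128).filter (bit m)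

/-- The members of `layers`, as pairs of codes. -/
def sparseCodes : List (ℕ × ℕ) := layers.flatMap fun l => (layerCodes l.2).map fun a => (l.1, a)

/-- The family of sets described by `layers`. -/
def sparseFamily : Finset (Finset ℕ) :=
  ((sparseCodes.map fun p => 2 * (p.2 + 128 * p.1)).map ones).toFinset

lemma mem_layerCodes {m a : ℕ} : a ∈ layerCodes m ↔ a < 128 ∧ bit m a = true := by
  rw [layerCodes, List.mem_filter, List.mem_range]

lemma mem_sparseCodes {p : ℕ × ℕ} :
    p ∈ sparseCodes ↔ ∃ m, (p.1, m) ∈ layers ∧ p.2 ∈ layerCodes m := by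
  obtain ⟨u, a⟩ := p
  simp only [sparseCodes, List.mem_flatMap, List.mem_map, Prod.mk.injEq, Prod.exists]
  constructor
  · rintro ⟨_, m, hl, _, ha, rfl, rfl⟩
    exact ⟨m, hl, ha⟩
  · rintro ⟨m, hl, ha⟩
    exact ⟨u, m, hl, a, ha, rfl, rfl⟩

lemma mem_sparseFamily {X : Finset ℕ} :
    X ∈ sparseFamily ↔ ∃ p ∈ sparseCodes, ones (2 * (p.2 + 128 * p.1)) = X := by
  simp [sparseFamily]

lemma layers_closed : ∀ k ∈ layers, ∀ l ∈ layers, ∃ m, (k.1 ||| l.1, m) ∈ layers ∧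
    ∀ a ∈ layerCodes k.2, ∀ b ∈ layerCodes l.2, bit m (a ||| b) = true := by
  have h : (layers.all fun k => layers.all fun l => layers.any fun m =>
      m.1.beq (k.1.lor l.1) && forcedList (layerCodes l.2) fun bs =>
        (layerCodes k.2).all fun a => bs.all fun b => bit m.2 (a.lor b)) = true := by
    decide +kernel
  simp only [List.all_eq_true, List.any_eq_true, Bool.and_eq_true, Nat.beq_eq, forcedList_eq] at h
  intro k hk l hl
  obtain ⟨⟨u, m⟩, hm, rfl, hbit⟩ := h k hk l hl
  exact ⟨m, hm, hbit⟩

lemma uc_sparseFamily : UC sparseFamily := by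
  intro X hX Y hY
  simp only [mem_sparseFamily, mem_sparseCodes] at hX hY ⊢
  obtain ⟨⟨u, a⟩, ⟨k, hk, ha⟩, rfl⟩ := hX
  obtain ⟨⟨v, b⟩, ⟨l, hl, hb⟩, rfl⟩ := hY
  obtain ⟨m, hm, hbit⟩ := layers_closed _ hk _ hl
  have halt := (mem_layerCodes.1 ha).1
  have hblt := (mem_layerCodes.1 hb).1
  refine ⟨(u ||| v, a ||| b), ⟨m, hm, mem_layerCodes.2
    ⟨Nat.or_lt_two_pow (n := 7) halt hblt, hbit a ha b hb⟩⟩, ?_⟩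
  rw [← ones_or]
  congr 1
  have hor : ∀ {x y z w : ℕ}, x < 2 ^ 7 → y < 2 ^ 7 →
      2 * ((x ||| y) + 2 ^ 7 * (z ||| w)) = 2 * (x + 2 ^ 7 * z) ||| 2 * (y + 2 ^ 7 * w) := by
    intro x y z w hx hy
    refine Nat.eq_of_testBit_eq fun i => ?_
    have hxy := Nat.or_lt_two_pow hx hy
    rw [Nat.testBit_or]
    cases i with
    | zero => simp [Nat.testBit_zero]
    | succ i =>
      simp only [Nat.testBit_succ, Nat.mul_div_cancel_left _ two_pos]
      rw [add_comm, Nat.testBit_two_pow_mul_add _ hxy, add_comm, Nat.testBit_two_pow_mul_add _ hx,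
        add_comm y, Nat.testBit_two_pow_mul_add _ hy]
      split <;> rw [Nat.testBit_or]
  exact hor halt hblt

lemma card_sparseFamily : sparseFamily.card = 521 := by
  have h : (sparseCodes.map fun p => 2 * (p.2 + 128 * p.1)).Nodup ∧ sparseCodes.length = 521 := by
    decide +kernel
  rw [sparseFamily, List.toFinset_card_of_nodup (h.1.map ones_injective), List.length_map,
    List.length_map, h.2]

lemma card_memFam_sparseFamily {i : ℕ} (hi : i ∈ Finset.Icc 1 7) :
    2 * (memFam sparseFamily i).card < 521 := by
  have h : ∀ i ∈ Finset.Icc 1 7, 2 * ((sparseCodes.map fun p => 2 * (p.2 + 128 * p.1)).filter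
      fun x => x.testBit i).length < 521 := by decide +kernel
  refine lt_of_le_of_lt (Nat.mul_le_mul_left 2 ?_) (h i hi)
  rw [← List.length_map (f := ones)]
  refine (Finset.card_le_card fun X hX => ?_).trans (List.toFinset_card_le _)
  simp only [memFam, sparseFamily, Finset.mem_filter, List.mem_toFinset, List.mem_map] at hX ⊢
  obtain ⟨⟨x, hx, rfl⟩, hiX⟩ := hX
  exact ⟨x, List.mem_filter.2 ⟨List.mem_map.2 hx, mem_ones.1 hiX⟩, rfl⟩

/-- Three triples that do not generate a Frankl-Complete family. -/
def sparseTriples : Finset (Finset ℕ) := {{1, 2, 3}, {1, 2, 4}, {5, 6, 7}}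

lemma sparseTriples_subset_sparseFamily : sparseTriples ⊆ sparseFamily := by
  have h : ∀ a ∈ [7, 11, 112], (0, a) ∈ sparseCodes := by decide +kernel
  have hmem : ∀ a ∈ [7, 11, 112], ones (2 * (a + 128 * 0)) ∈ sparseFamily := fun a ha =>
    mem_sparseFamily.2 ⟨(0, a), h a ha, rfl⟩
  intro X hX
  simp only [sparseTriples, Finset.mem_insert, Finset.mem_singleton] at hX
  rcases hX with rfl | rfl | rfl
  · exact hmem 7 (by simp)
  · exact hmem 11 (by simp)
  · exact hmem 112 (by simp)

theorem nonFC_gen_sparseTriples : NonFC (gen sparseTriples) := by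
  refine ⟨sparseFamily, uc_sparseFamily, gen_subset uc_sparseFamily
    sparseTriples_subset_sparseFamily, fun i hi => ?_⟩
  rw [card_sparseFamily]
  exact card_memFam_sparseFamily (famU_gen_subset (by decide) hi)

end UnionClosed

/-- FC(3,7) = 4. -/
theorem FC_3_7 :
    (∀ S : Finset (Finset ℕ), S ⊆ (Finset.Icc 1 7).powersetCard 3 → S.card = 4 →
      FC (gen S)) ∧
    (∃ S : Finset (Finset ℕ), S ⊆ (Finset.Icc 1 7).powersetCard 3 ∧ S.card = 3 ∧
      NonFC (gen S)) := by
  exact ⟨fun S hS hcard => UnionClosed.FC_gen_of_card hS hcard.ge,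
    UnionClosed.sparseTriples, by decide, by decide, UnionClosed.nonFC_gen_sparseTriples⟩
end

section
/- For every n ≥ 4 there exists a family 𝒮 of ⌊n/2⌋ distinct 3-element subsets of [n] such that the union-closed family ⟨𝒮⟩ generated by 𝒮 is Non–Frankl-Complete (equivalently, ⌊n/2⌋ + 1 ≤ FC(3,n) for all n ≥ 4). -/
/-- A union-closed family of labelled subsets of `V`, containing the empty set and all members of
`S` with the empty label, in which every element of `V` lies in fewer than half of the members. -/
def HasScarceExtension (V : Finset ℕ) (S : Finset (Finset ℕ)) : Prop :=
  ∃ (ι : Type) (_ : Fintype ι) (_ : DecidableEq ι) (F : Finset (Finset ℕ × Finset ι)),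
    SupClosed (F : Set (Finset ℕ × Finset ι)) ∧ (∅, ∅) ∈ F ∧ (∀ A ∈ S, (A, ∅) ∈ F) ∧
      (∀ p ∈ F, p.1 ⊆ V) ∧ ∀ i ∈ V, 2 * (F.filter (fun p => i ∈ p.1)).card < F.card

theorem HasScarceExtension.nonFC_gen {V : Finset ℕ} {S : Finset (Finset ℕ)}
    (h : HasScarceExtension V S) : NonFC (gen S) := by
  obtain ⟨ι, _, _, F, hsup, hbot, hS, hV, hlt⟩ := h
  obtain ⟨N, hN⟩ := V.exists_nat_subset_range
  let g : ι ↪ ℕ := ⟨fun x => N + (Fintype.equivFin ι x : ℕ), fun x y hxy => by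
    simpa [Fin.val_inj] using hxy⟩
  have hg (x : ι) : N ≤ g x := Nat.le_add_right _ _
  let e : Finset ℕ × Finset ι → Finset ℕ := fun p => p.1 ∪ p.2.map g
  have hmem (p : Finset ℕ × Finset ι) (i : ℕ) (hi : i < N) : i ∈ e p ↔ i ∈ p.1 := by
    simp only [e, Finset.mem_union, Finset.mem_map, or_iff_left_iff_imp]
    rintro ⟨x, -, rfl⟩
    exact absurd hi (hg x).not_gt
  have hmem' (p) (hp : p ∈ F) (x : ι) : g x ∈ e p ↔ x ∈ p.2 := by
    have : g x ∉ p.1 := fun hx =>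
      (hg x).not_gt (Finset.mem_range.1 (hN (hV p hp hx)))
    simp [e, this]
  have hinj : Set.InjOn e F := by
    intro p hp q hq hpq
    ext i
    · by_cases hi : i < N
      · rw [← hmem p i hi, hpq, hmem q i hi]
      · have hn (r) (hr : r ∈ F) : i ∉ r.1 := fun h => hi (Finset.mem_range.1 (hN (hV r hr h)))
        simp [hn p hp, hn q hq]
    · rw [← hmem' p hp i, hpq, hmem' q hq i]
  have hUC : UC (F.image e) := by
    intro A hA B hB
    obtain ⟨p, hp, rfl⟩ := Finset.mem_image.1 hA
    obtain ⟨q, hq, rfl⟩ := Finset.mem_image.1 hB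
    refine Finset.mem_image.2 ⟨p ⊔ q, hsup hp hq, ?_⟩
    simp only [e, Prod.fst_sup, Prod.snd_sup, Finset.sup_eq_union, Finset.map_union]
    ac_rfl
  have hgen : gen S ⊆ F.image e := by
    intro A hA
    obtain ⟨T, hT, rfl⟩ := Finset.mem_image.1 hA
    have hTS := Finset.mem_powerset.1 (Finset.mem_filter.1 hT).1
    refine Finset.sup_induction (p := (· ∈ F.image e)) (Finset.mem_image.2 ⟨_, hbot, by simp [e]⟩)
      hUC fun A hA => Finset.mem_image.2 ⟨_, hS A (hTS hA), by simp [e]⟩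
  refine ⟨F.image e, hUC, hgen, fun i hi => ?_⟩
  have hiV : i ∈ V := by
    have hle : famU (gen S) ≤ V := by
      refine Finset.sup_le fun A hA => ?_
      obtain ⟨T, hT, rfl⟩ := Finset.mem_image.1 hA
      exact Finset.sup_le fun A hA =>
        hV _ (hS A (Finset.mem_powerset.1 (Finset.mem_filter.1 hT).1 hA))
    exact hle hi
  have hiN := Finset.mem_range.1 (hN hiV)
  have hfil : memFam (F.image e) i = (F.filter (fun p => i ∈ p.1)).image e := by
    rw [memFam, Finset.filter_image]
    congr 1
    exact Finset.filter_congr fun p _ => hmem p i hiN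
  rw [hfil, Finset.card_image_of_injOn hinj,
    Finset.card_image_of_injOn (hinj.mono (Finset.filter_subset _ _))]
  exact hlt i hiV

theorem HasScarceExtension.map {V : Finset ℕ} {S : Finset (Finset ℕ)}
    (h : HasScarceExtension V S) (f : ℕ ↪ ℕ) :
    HasScarceExtension (V.map f) (S.image (Finset.map f)) := by
  obtain ⟨ι, _, _, F, hsup, hbot, hS, hV, hlt⟩ := h
  let e : Finset ℕ × Finset ι → Finset ℕ × Finset ι := Prod.map (Finset.map f) id
  have hinj : Function.Injective e := (Finset.map_injective f).prodMap Function.injective_id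
  refine ⟨ι, inferInstance, inferInstance, F.image e, ?_, ?_, ?_, ?_, ?_⟩
  · intro p hp q hq
    obtain ⟨p, hp', rfl⟩ := Finset.mem_image.1 hp
    obtain ⟨q, hq', rfl⟩ := Finset.mem_image.1 hq
    exact Finset.mem_image.2 ⟨p ⊔ q, hsup hp' hq', by simp [e, Prod.ext_iff, Finset.map_union]⟩
  · exact Finset.mem_image.2 ⟨_, hbot, by simp [e]⟩
  · intro A hA
    obtain ⟨A, hA', rfl⟩ := Finset.mem_image.1 hA
    exact Finset.mem_image.2 ⟨_, hS A hA', by simp [e]⟩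
  · intro p hp
    obtain ⟨p, hp', rfl⟩ := Finset.mem_image.1 hp
    exact Finset.map_subset_map.2 (hV p hp')
  · intro i hi
    obtain ⟨i, hi', rfl⟩ := Finset.mem_map.1 hi
    rw [Finset.filter_image, Finset.card_image_of_injective _ hinj,
      Finset.card_image_of_injective _ hinj]
    simpa [e] using hlt i hi'

theorem HasScarceExtension.union {V W : Finset ℕ} {S T : Finset (Finset ℕ)}
    (hVS : HasScarceExtension V S) (hWT : HasScarceExtension W T) (hVW : Disjoint V W) :
    HasScarceExtension (V ∪ W) (S ∪ T) := by
  obtain ⟨ι, _, _, F, hsup, hbot, hS, hV, hlt⟩ := hVS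
  obtain ⟨κ, _, _, G, hsup', hbot', hT, hW, hlt'⟩ := hWT
  let e : (Finset ℕ × Finset ι) × (Finset ℕ × Finset κ) → Finset ℕ × Finset (ι ⊕ κ) :=
    fun r => (r.1.1 ∪ r.2.1, r.1.2.disjSum r.2.2)
  have hl (r) (hr : r ∈ F ×ˢ G) (i : ℕ) (hi : i ∈ V) : i ∈ (e r).1 ↔ i ∈ r.1.1 := by
    have : i ∉ r.2.1 := fun h => Finset.disjoint_left.1 hVW hi (hW _ (Finset.mem_product.1 hr).2 h)
    simp [e, this]
  have hr (r) (hr : r ∈ F ×ˢ G) (i : ℕ) (hi : i ∈ W) : i ∈ (e r).1 ↔ i ∈ r.2.1 := by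
    have : i ∉ r.1.1 := fun h => Finset.disjoint_right.1 hVW hi (hV _ (Finset.mem_product.1 hr).1 h)
    simp [e, this]
  have hinj : Set.InjOn e ↑(F ×ˢ G) := by
    intro r hr₁ s hs hrs
    have hr₂ := Finset.mem_product.1 hr₁
    have hs₂ := Finset.mem_product.1 hs
    have h₁ : r.1.1 = s.1.1 := by
      ext i
      by_cases hi : i ∈ V
      · rw [← hl r hr₁ i hi, hrs, hl s hs i hi]
      · exact iff_of_false (fun h => hi (hV _ hr₂.1 h)) (fun h => hi (hV _ hs₂.1 h))
    have h₂ : r.2.1 = s.2.1 := by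
      ext i
      by_cases hi : i ∈ W
      · rw [← hr r hr₁ i hi, hrs, hr s hs i hi]
      · exact iff_of_false (fun h => hi (hW _ hr₂.2 h)) (fun h => hi (hW _ hs₂.2 h))
    have h₃ := congrArg Prod.snd hrs
    have h₄ : r.1.2 = s.1.2 := by
      ext x
      simpa [e] using Finset.ext_iff.1 h₃ (Sum.inl x)
    have h₅ : r.2.2 = s.2.2 := by
      ext x
      simpa [e] using Finset.ext_iff.1 h₃ (Sum.inr x)
    exact Prod.ext (Prod.ext h₁ h₄) (Prod.ext h₂ h₅)
  have hF : 0 < F.card := Finset.card_pos.2 ⟨_, hbot⟩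
  have hG : 0 < G.card := Finset.card_pos.2 ⟨_, hbot'⟩
  refine ⟨ι ⊕ κ, inferInstance, inferInstance, (F ×ˢ G).image e, ?_, ?_, ?_, ?_, ?_⟩
  · intro p hp q hq
    obtain ⟨r, hr, rfl⟩ := Finset.mem_image.1 hp
    obtain ⟨s, hs, rfl⟩ := Finset.mem_image.1 hq
    rw [Finset.mem_product] at hr hs
    refine Finset.mem_image.2
      ⟨(r.1 ⊔ s.1, r.2 ⊔ s.2), Finset.mk_mem_product (hsup hr.1 hs.1) (hsup' hr.2 hs.2), ?_⟩
    refine Prod.ext ?_ ?_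
    · simp only [e, Prod.fst_sup, Finset.sup_eq_union]
      ac_rfl
    · ext x
      cases x <;> simp [e]
  · exact Finset.mem_image.2 ⟨_, Finset.mk_mem_product hbot hbot', by simp [e]⟩
  · intro A hA
    rcases Finset.mem_union.1 hA with hA | hA
    · exact Finset.mem_image.2 ⟨_, Finset.mk_mem_product (hS A hA) hbot', by simp [e]⟩
    · exact Finset.mem_image.2 ⟨_, Finset.mk_mem_product hbot (hT A hA), by simp [e]⟩
  · intro p hp
    obtain ⟨r, hr, rfl⟩ := Finset.mem_image.1 hp
    rw [Finset.mem_product] at hr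
    exact Finset.union_subset_union (hV _ hr.1) (hW _ hr.2)
  · intro i hi
    rw [Finset.filter_image, Finset.card_image_of_injOn hinj,
      Finset.card_image_of_injOn (hinj.mono (Finset.filter_subset _ _)), Finset.card_product]
    rcases Finset.mem_union.1 hi with hi | hi
    · rw [Finset.filter_congr fun r hr => hl r hr i hi,
        Finset.filter_product_left (fun p : Finset ℕ × Finset ι => i ∈ p.1),
        Finset.card_product]
      nlinarith [hlt i hi]
    · rw [Finset.filter_congr fun s hs => hr s hs i hi,
        Finset.filter_product_right (fun p : Finset ℕ × Finset κ => i ∈ p.1),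
        Finset.card_product]
      nlinarith [hlt' i hi]

theorem two_mul_card_filter_mem_powerset {V : Finset ℕ} {i : ℕ} (hi : i ∈ V) :
    2 * (V.powerset.filter (fun X => i ∈ X)).card = V.powerset.card := by
  have h : (V.powerset.filter (fun X => i ∉ X)).card =
      (V.powerset.filter (fun X => i ∈ X)).card := by
    refine Finset.card_bij' (fun X _ => insert i X) (fun X _ => X.erase i) ?_ ?_ ?_ ?_
    · intro X hX
      rw [Finset.mem_filter, Finset.mem_powerset] at hX ⊢
      exact ⟨Finset.insert_subset hi hX.1, Finset.mem_insert_self _ _⟩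
    · intro X hX
      rw [Finset.mem_filter, Finset.mem_powerset] at hX ⊢
      exact ⟨(Finset.erase_subset _ _).trans hX.1, Finset.notMem_erase _ _⟩
    · intro X hX
      exact Finset.erase_insert (Finset.mem_filter.1 hX).2
    · intro X hX
      exact Finset.insert_erase (Finset.mem_filter.1 hX).2
  have := Finset.card_filter_add_card_filter_not (s := V.powerset) (fun X => i ∈ X)
  omega

/-- The union-closed family of all unions of a subset of `Y` with a member of `C`. -/
def powersetUnion (Y : Finset ℕ) (C : Finset (Finset ℕ)) : Finset (Finset ℕ) :=
  (Y.powerset ×ˢ C).image (fun p => p.1 ∪ p.2)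

theorem mem_powersetUnion {Y : Finset ℕ} {C : Finset (Finset ℕ)} {X : Finset ℕ} :
    X ∈ powersetUnion Y C ↔ ∃ Z ⊆ Y, ∃ A ∈ C, Z ∪ A = X := by
  simp [powersetUnion, and_assoc]

theorem union_mem_powersetUnion {Y : Finset ℕ} {C : Finset (Finset ℕ)} (hC : UC C)
    {A X : Finset ℕ} (hA : A ∈ C) (hX : X ∈ powersetUnion Y C) : A ∪ X ∈ powersetUnion Y C := by
  obtain ⟨Z, hZ, B, hB, rfl⟩ := mem_powersetUnion.1 hX
  exact mem_powersetUnion.2 ⟨Z, hZ, A ∪ B, hC A hA B hB, by ac_rfl⟩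

theorem uc_powersetUnion (Y : Finset ℕ) {C : Finset (Finset ℕ)} (hC : UC C) :
    UC (powersetUnion Y C) := by
  intro X hX X' hX'
  obtain ⟨Z, hZ, B, hB, rfl⟩ := mem_powersetUnion.1 hX
  obtain ⟨Z', hZ', B', hB', rfl⟩ := mem_powersetUnion.1 hX'
  exact mem_powersetUnion.2
    ⟨Z ∪ Z', Finset.union_subset hZ hZ', B ∪ B', hC B hB B' hB', by ac_rfl⟩

theorem hasScarceExtension_of_sum_lt {ι : Type} [Fintype ι] [DecidableEq ι] [Nontrivial ι]
    {V : Finset ℕ} {S C : Finset (Finset ℕ)} (hC : UC C) (hbot : ∅ ∈ C) (hSC : S ⊆ C)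
    (hCV : ∀ A ∈ C, A ⊆ V) (Y : ι → Finset ℕ) (hY : ∀ j, Y j ⊆ V)
    (hlt : ∀ i ∈ V, 2 * ((memFam C i).card + ∑ j, (memFam (powersetUnion (Y j) C) i).card) <
      C.card + ∑ j, (powersetUnion (Y j) C).card) :
    HasScarceExtension V S := by
  let B : Finset ι → Finset (Finset ℕ) → Finset (Finset ℕ × Finset ι) := fun t X => X ×ˢ {t}
  let M : Finset (Finset ℕ × Finset ι) :=
    Finset.univ.biUnion fun j => B {j}ᶜ (powersetUnion (Y j) C)
  let F : Finset (Finset ℕ × Finset ι) := B ∅ C ∪ (M ∪ B Finset.univ V.powerset)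
  have hPV (j : ι) : ∀ X ∈ powersetUnion (Y j) C, X ⊆ V := by
    intro X hX
    obtain ⟨Z, hZ, A, hA, rfl⟩ := mem_powersetUnion.1 hX
    exact Finset.union_subset (hZ.trans (hY j)) (hCV A hA)
  have hF (p : Finset ℕ × Finset ι) : p ∈ F ↔ (p.1 ∈ C ∧ p.2 = ∅) ∨
      (∃ j, p.1 ∈ powersetUnion (Y j) C ∧ p.2 = {j}ᶜ) ∨ (p.1 ⊆ V ∧ p.2 = Finset.univ) := by
    obtain ⟨X, t⟩ := p
    simp only [F, M, B, Finset.mem_union, Finset.mem_biUnion, Finset.mem_univ, true_and,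
      Finset.mem_product, Finset.mem_singleton, Finset.mem_powerset]
  have hFV (p) (hp : p ∈ F) : p.1 ⊆ V := by
    rcases (hF p).1 hp with h | ⟨j, h⟩ | h
    · exact hCV _ h.1
    · exact hPV j _ h.1
    · exact h.1
  have hne (j : ι) : ({j}ᶜ : Finset ι) ≠ ∅ := by
    obtain ⟨k, hk⟩ := exists_ne j
    exact Finset.nonempty_iff_ne_empty.1 ⟨k, by simpa using hk⟩
  have hne' (j : ι) : ({j}ᶜ : Finset ι) ≠ Finset.univ := by simp
  have hcard (q : Finset ℕ → Prop) [DecidablePred q] : (F.filter (fun p => q p.1)).card =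
      (C.filter q).card + ∑ j, ((powersetUnion (Y j) C).filter q).card +
        (V.powerset.filter q).card := by
    have hB (t : Finset ι) (X : Finset (Finset ℕ)) :
        ((B t X).filter (fun p => q p.1)).card = (X.filter q).card := by
      rw [Finset.filter_product_left]
      simp
    have hdisj (s t : Finset ι) (X Z : Finset (Finset ℕ)) (hst : s ≠ t) :
        Disjoint (B s X) (B t Z) :=
      Finset.disjoint_product.2 (Or.inr (Finset.disjoint_singleton.2 hst))
    rw [Finset.filter_union, Finset.card_union_of_disjoint, Finset.filter_union,
      Finset.card_union_of_disjoint, Finset.filter_biUnion, Finset.card_biUnion]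
    · simp only [hB]
      ring
    · intro j _ k _ hjk
      exact Finset.disjoint_filter_filter (hdisj _ _ _ _ (by simpa using hjk))
    · refine Finset.disjoint_filter_filter ((Finset.disjoint_biUnion_left _ _ _).2 fun j _ => ?_)
      exact hdisj _ _ _ _ (hne' j)
    · refine Finset.disjoint_filter_filter (Finset.disjoint_union_right.2 ⟨?_, ?_⟩)
      · exact (Finset.disjoint_biUnion_right _ _ _).2 fun j _ => hdisj _ _ _ _ (hne j).symm
      · refine hdisj _ _ _ _ fun h => ?_
        obtain ⟨j, -⟩ := exists_pair_ne ι
        simpa using Finset.ext_iff.1 h j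
  refine ⟨ι, inferInstance, inferInstance, F, ?_, ?_, ?_, hFV, ?_⟩
  · intro p hp q hq
    rw [Finset.mem_coe] at hp hq ⊢
    have hpV := hFV p hp
    have hqV := hFV q hq
    have huniv (h : p.2 ∪ q.2 = Finset.univ) : p ⊔ q ∈ F :=
      (hF _).2 (Or.inr (Or.inr ⟨Finset.union_subset hpV hqV, h⟩))
    rcases (hF p).1 hp with hp | ⟨j, hp⟩ | hp
    · rcases (hF q).1 hq with hq | ⟨k, hq⟩ | hq
      · exact (hF _).2 (Or.inl ⟨hC _ hp.1 _ hq.1, by simp [hp.2, hq.2]⟩)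
      · exact (hF _).2 (Or.inr (Or.inl
          ⟨k, union_mem_powersetUnion hC hp.1 hq.1, by simp [hp.2, hq.2]⟩))
      · exact huniv (by simp [hq.2])
    · rcases (hF q).1 hq with hq | ⟨k, hq⟩ | hq
      · refine (hF _).2 (Or.inr (Or.inl ⟨j, ?_, by simp [hp.2, hq.2]⟩))
        rw [sup_comm]
        exact union_mem_powersetUnion hC hq.1 hp.1
      · by_cases hjk : j = k
        · subst hjk
          exact (hF _).2 (Or.inr (Or.inl
            ⟨j, uc_powersetUnion _ hC _ hp.1 _ hq.1, by simp [hp.2, hq.2]⟩))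
        · refine huniv ?_
          ext x
          simp only [hp.2, hq.2, Finset.mem_union, Finset.mem_compl, Finset.mem_singleton,
            Finset.mem_univ, iff_true]
          grind
      · exact huniv (by simp [hq.2])
    · exact huniv (by simp [hp.2])
  · exact (hF _).2 (Or.inl ⟨hbot, rfl⟩)
  · exact fun A hA => (hF _).2 (Or.inl ⟨hSC hA, rfl⟩)
  · intro i hi
    have h₁ := hcard (fun X => i ∈ X)
    have h₂ := hcard (fun _ => True)
    simp only [Finset.filter_true] at h₂
    have h₃ := hlt i hi
    simp only [memFam] at h₃
    have h₄ := two_mul_card_filter_mem_powerset hi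
    omega

theorem hasScarceExtension_four :
    HasScarceExtension (Finset.Icc 1 4) {{1, 2, 3}, {1, 3, 4}} := by
  have : Nontrivial (Fin 15 ⊕ Fin 3 ⊕ Fin 3) := ⟨.inl 0, .inr (.inl 0), by simp⟩
  refine hasScarceExtension_of_sum_lt (ι := Fin 15 ⊕ Fin 3 ⊕ Fin 3)
    (C := {∅, {1, 2, 3}, {1, 3, 4}, {1, 2, 3, 4}}) (by unfold UC; decide +kernel)
    (by decide) (by decide +kernel) (by decide +kernel)
    (Sum.elim (fun _ => {2, 4}) (Sum.elim (fun _ => {1, 2, 3}) (fun _ => {1, 3, 4}))) ?_ ?_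
  · rintro (j | j | j) <;> simp only [Sum.elim_inl, Sum.elim_inr] <;> decide
  · simp only [Fintype.sum_sum_type, Sum.elim_inl, Sum.elim_inr, Finset.sum_const,
      Finset.card_univ, Fintype.card_fin, smul_eq_mul]
    decide +kernel

theorem hasScarceExtension_six :
    HasScarceExtension (Finset.Icc 1 6) {{1, 2, 3}, {1, 2, 4}, {3, 5, 6}} := by
  have : Nontrivial (Fin 16 ⊕ Fin 6 ⊕ Fin 8) := ⟨.inl 0, .inr (.inl 0), by simp⟩
  refine hasScarceExtension_of_sum_lt (ι := Fin 16 ⊕ Fin 6 ⊕ Fin 8)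
    (C := {∅, {1, 2, 3}, {1, 2, 4}, {1, 2, 3, 4}, {3, 5, 6}, {1, 2, 3, 5, 6},
      {1, 2, 3, 4, 5, 6}}) (by unfold UC; decide +kernel)
    (by decide) (by decide +kernel) (by decide +kernel)
    (Sum.elim (fun _ => {3, 4, 5, 6}) (Sum.elim (fun _ => {1, 2, 4, 5, 6})
      (fun _ => {1, 2, 3}))) ?_ ?_
  · rintro (j | j | j) <;> simp only [Sum.elim_inl, Sum.elim_inr] <;> decide
  · simp only [Fintype.sum_sum_type, Sum.elim_inl, Sum.elim_inr, Finset.sum_const,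
      Finset.card_univ, Fintype.card_fin, smul_eq_mul]
    decide +kernel

theorem exists_hasScarceExtension (k : ℕ) (hk : 2 ≤ k) :
    ∃ S : Finset (Finset ℕ), S ⊆ (Finset.Icc 1 (2 * k)).powersetCard 3 ∧ S.card = k ∧
      HasScarceExtension (Finset.Icc 1 (2 * k)) S := by
  induction k using Nat.strong_induction_on with
  | _ k ih =>
    obtain rfl | rfl | hk4 : k = 2 ∨ k = 3 ∨ 4 ≤ k := by omega
    · exact ⟨_, by decide +kernel, by decide +kernel, hasScarceExtension_four⟩
    · exact ⟨_, by decide +kernel, by decide +kernel, hasScarceExtension_six⟩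
    obtain ⟨l, rfl⟩ := Nat.exists_eq_add_of_le' (show 2 ≤ k by omega)
    obtain ⟨S, hS, hcard, hext⟩ := ih l (by omega) (by omega)
    have hmap := hext.map (addRightEmbedding 4)
    rw [Finset.map_add_right_Icc] at hmap
    have hdisj : Disjoint (Finset.Icc 1 4) (Finset.Icc (1 + 4) (2 * l + 4)) := by
      rw [Finset.disjoint_left]
      intro x hx
      simp only [Finset.mem_Icc] at hx ⊢
      omega
    have hun : Finset.Icc 1 4 ∪ Finset.Icc (1 + 4) (2 * l + 4) = Finset.Icc 1 (2 * (l + 2)) := by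
      ext x
      simp only [Finset.mem_union, Finset.mem_Icc]
      omega
    have hS₄ : ({{1, 2, 3}, {1, 3, 4}} : Finset (Finset ℕ)) ⊆
        (Finset.Icc 1 4).powersetCard 3 := by decide +kernel
    have hS' : S.image (Finset.map (addRightEmbedding 4)) ⊆
        (Finset.Icc (1 + 4) (2 * l + 4)).powersetCard 3 := by
      intro A hA
      obtain ⟨A, hA', rfl⟩ := Finset.mem_image.1 hA
      have := Finset.mem_powersetCard.1 (hS hA')
      rw [Finset.mem_powersetCard, Finset.card_map, ← Finset.map_add_right_Icc]
      exact ⟨Finset.map_subset_map.2 this.1, this.2⟩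
    refine ⟨_, Finset.union_subset ?_ ?_, ?_, hun ▸ hasScarceExtension_four.union hmap hdisj⟩
    · exact hS₄.trans (Finset.powersetCard_mono (hun ▸ Finset.subset_union_left))
    · exact hS'.trans (Finset.powersetCard_mono (hun ▸ Finset.subset_union_right))
    · rw [Finset.card_union_of_disjoint, Finset.card_image_of_injective _
        (Finset.map_injective _), hcard]
      · rw [show Finset.card ({{1, 2, 3}, {1, 3, 4}} : Finset (Finset ℕ)) = 2 by decide +kernel,
          add_comm]
      · rw [Finset.disjoint_left]
        intro A hA hA'
        have h₁ := Finset.mem_powersetCard.1 (hS₄ hA)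
        have h₂ := Finset.mem_powersetCard.1 (hS' hA')
        have h₃ := Finset.disjoint_self_iff_empty A |>.1 (hdisj.mono h₁.1 h₂.1)
        simp [h₃] at h₁

/-- Morris' lower bound: ⌊n/2⌋ + 1 ≤ FC(3,n) for all n ≥ 4. -/
theorem morris_lower_bound (n : ℕ) (hn : 4 ≤ n) :
    ∃ S : Finset (Finset ℕ), S ⊆ (Finset.Icc 1 n).powersetCard 3 ∧
      S.card = n / 2 ∧ NonFC (gen S) := by
  obtain ⟨S, hS, hcard, hext⟩ := exists_hasScarceExtension (n / 2) (by omega)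
  exact ⟨S, hS.trans (Finset.powersetCard_mono (Finset.Icc_subset_Icc_right (by omega))), hcard,
    hext.nonFC_gen⟩
end

section
/- Let ℐ = {{1,2,3},{1,2,4},{3,5,6}}, let 𝒮 be a family of 3-sets of positive integers, and set 𝒯 = 𝒮 ∪ ℐ. If the union-closed family ⟨𝒯⟩ generated by 𝒯 is Non–Frankl-Complete, then |𝒯_4| = 1, and moreover |𝒯_5| = 1 or |𝒯_6| = 1. -/
/-! ### Subsets of a labelled ground set encoded as bit masks -/

/-- The set of those labels in `l` whose position is a set bit of the mask `y`. -/
def maskSet : List ℕ → ℕ → Finset ℕ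
  | [], _ => ∅
  | a :: l, y => if y.testBit 0 then insert a (maskSet l (y / 2)) else maskSet l (y / 2)

/-- The total weight of the positions of `w` that are set bits of the mask `y`. -/
def maskWeight : List ℕ → ℕ → ℕ
  | [], _ => 0
  | a :: w, y => (bif (y % 2).beq 1 then a else 0) + maskWeight w (y / 2)

theorem mem_maskSet {l : List ℕ} {y x : ℕ} :
    x ∈ maskSet l y ↔ ∃ i, ∃ h : i < l.length, l[i] = x ∧ y.testBit i := by
  induction l generalizing y with
  | nil => simp [maskSet]
  | cons a l ih =>
    have hsucc : x ∈ maskSet l (y / 2) ↔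
        ∃ i, ∃ h : i < l.length, l[i] = x ∧ y.testBit (i + 1) := by
      simp only [ih, Nat.testBit_succ]
    constructor
    · intro h
      have h' : (x = a ∧ y.testBit 0) ∨ x ∈ maskSet l (y / 2) := by
        unfold maskSet at h
        split_ifs at h with h0
        · rcases Finset.mem_insert.1 h with h | h
          exacts [Or.inl ⟨h, h0⟩, Or.inr h]
        · exact Or.inr h
      rcases h' with ⟨rfl, h0⟩ | h'
      · exact ⟨0, by simp, rfl, h0⟩
      · obtain ⟨i, hi, hx, hy⟩ := hsucc.1 h'
        exact ⟨i + 1, by simpa using hi, by simpa using hx, hy⟩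
    · rintro ⟨i, hi, hx, hy⟩
      unfold maskSet
      cases i with
      | zero => simp_all
      | succ i =>
        have := hsucc.2 ⟨i, by simpa using hi, by simpa using hx, hy⟩
        split_ifs
        · exact Finset.mem_insert_of_mem this
        · exact this

theorem maskSet_subset (l : List ℕ) (y : ℕ) : maskSet l y ⊆ l.toFinset := by
  intro x hx
  obtain ⟨i, hi, rfl, -⟩ := mem_maskSet.1 hx
  simp

theorem maskSet_or (l : List ℕ) (y z : ℕ) :
    maskSet l (y ||| z) = maskSet l y ∪ maskSet l z := by
  ext x
  simp only [Finset.mem_union, mem_maskSet, Nat.testBit_or, Bool.or_eq_true]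
  constructor
  · rintro ⟨i, hi, hx, hy | hy⟩
    exacts [Or.inl ⟨i, hi, hx, hy⟩, Or.inr ⟨i, hi, hx, hy⟩]
  · rintro (⟨i, hi, hx, hy⟩ | ⟨i, hi, hx, hy⟩)
    exacts [⟨i, hi, hx, Or.inl hy⟩, ⟨i, hi, hx, Or.inr hy⟩]

theorem getElem_mem_maskSet {l : List ℕ} (hl : l.Nodup) {y i : ℕ} (hi : i < l.length) :
    l[i] ∈ maskSet l y ↔ y.testBit i := by
  rw [mem_maskSet]
  constructor
  · rintro ⟨j, hj, hji, hy⟩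
    rwa [← (hl.getElem_inj_iff).1 hji]
  · exact fun h => ⟨i, hi, rfl, h⟩

theorem exists_maskSet_eq {l : List ℕ} (hl : l.Nodup) {s : Finset ℕ} (hs : s ⊆ l.toFinset) :
    ∃ y < 2 ^ l.length, maskSet l y = s := by
  refine ⟨Nat.ofBits fun i : Fin l.length => decide (l[i] ∈ s), Nat.ofBits_lt_two_pow _, ?_⟩
  ext x
  constructor
  · intro h
    obtain ⟨i, hi, rfl, hy⟩ := mem_maskSet.1 h
    simpa [Nat.testBit_ofBits_lt _ i hi] using hy
  · intro h
    obtain ⟨i, hi, rfl⟩ := List.getElem_of_mem (List.mem_toFinset.1 (hs h))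
    rw [getElem_mem_maskSet hl hi, Nat.testBit_ofBits_lt _ i hi]
    simpa using h

theorem maskSet_injOn {l : List ℕ} (hl : l.Nodup) {y z : ℕ} (hy : y < 2 ^ l.length)
    (hz : z < 2 ^ l.length) (h : maskSet l y = maskSet l z) : y = z := by
  apply Nat.eq_of_testBit_eq
  intro i
  by_cases hi : i < l.length
  · rw [Bool.eq_iff_iff, ← getElem_mem_maskSet hl hi, ← getElem_mem_maskSet hl hi, h]
  · have hle : 2 ^ l.length ≤ 2 ^ i := Nat.pow_le_pow_right (by norm_num) (by omega)
    rw [Nat.testBit_lt_two_pow (hy.trans_le hle), Nat.testBit_lt_two_pow (hz.trans_le hle)]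

theorem maskWeight_eq_sum {l w : List ℕ} (hlen : l.length = w.length) (hl : l.Nodup) (y : ℕ) :
    maskWeight w y = ((l.zip w).map fun p => if p.1 ∈ maskSet l y then p.2 else 0).sum := by
  induction l generalizing w y with
  | nil =>
    cases w with
    | nil => simp [maskWeight]
    | cons => simp at hlen
  | cons a l ih =>
    cases w with
    | nil => simp at hlen
    | cons b w =>
      obtain ⟨ha, hl'⟩ := List.nodup_cons.1 hl
      have ha' : a ∉ maskSet l (y / 2) := fun h =>
        ha (List.mem_toFinset.1 (maskSet_subset _ _ h))
      have hne : ∀ p ∈ l.zip w, p.1 ≠ a := by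
        rintro p hp rfl
        exact ha (List.of_mem_zip hp).1
      rw [maskWeight, ih (by simpa using hlen) hl', List.zip_cons_cons, List.map_cons,
        List.sum_cons]
      congr 1
      · simp only [maskSet, Nat.testBit_zero]
        by_cases h : y % 2 = 1
        · simp [h]
        · have h0 : y % 2 = 0 := by omega
          simp [h0, ha', show Nat.beq 0 1 = false from rfl]
      · congr 1
        apply List.map_congr_left
        intro p hp
        have : p.1 ∈ maskSet (a :: l) y ↔ p.1 ∈ maskSet l (y / 2) := by
          rw [show maskSet (a :: l) y = if y.testBit 0 then insert a (maskSet l (y / 2))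
            else maskSet l (y / 2) from rfl]
          split_ifs <;> simp [hne p hp]
        simp [this]

/-! ### Comparing weighted sums over masks -/

/-- Whether, for every prefix `a` extended by the lowest `n` bits, the coefficients attached to each
mask in `neg` add up to at most the coefficients attached to the same mask in `pos`. -/
def dominated : ℕ → ℕ → List (ℕ × ℕ) → List (ℕ × ℕ) → Bool
  | 0, a, neg, pos =>
    neg.all (fun t => t.1.beq a) && pos.all (fun t => t.1.beq a) &&
      ((neg.map Prod.snd).sum.ble (pos.map Prod.snd).sum)
  | n + 1, a, neg, pos =>
    dominated n a (neg.filter fun t => (t.1.land (2 ^ n)).beq 0)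
        (pos.filter fun t => (t.1.land (2 ^ n)).beq 0) &&
      dominated n (a + 2 ^ n) (neg.filter fun t => !(t.1.land (2 ^ n)).beq 0)
        (pos.filter fun t => !(t.1.land (2 ^ n)).beq 0)

/-- The linear form with coefficients `t` evaluated at `f`. -/
def linForm (t : List (ℕ × ℕ)) (f : ℕ → ℕ) : ℕ := (t.map fun p => p.2 * f p.1).sum

theorem linForm_append (s t : List (ℕ × ℕ)) (f : ℕ → ℕ) :
    linForm (s ++ t) f = linForm s f + linForm t f := by
  simp [linForm]

theorem linForm_filter_add (t : List (ℕ × ℕ)) (q : ℕ × ℕ → Bool) (f : ℕ → ℕ) :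
    linForm (t.filter q) f + linForm (t.filter fun p => !q p) f = linForm t f := by
  induction t with
  | nil => simp [linForm]
  | cons p t ih =>
    simp only [linForm] at ih ⊢
    cases h : q p <;> simp [h] <;> omega

theorem linForm_of_forall_eq {t : List (ℕ × ℕ)} {a : ℕ} (h : ∀ p ∈ t, p.1 = a) (f : ℕ → ℕ) :
    linForm t f = (t.map Prod.snd).sum * f a := by
  induction t with
  | nil => simp [linForm]
  | cons p t ih =>
    have := ih fun q hq => h q (List.mem_cons_of_mem _ hq)
    simp only [linForm, List.map_cons, List.sum_cons] at this ⊢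
    rw [this, h p (by simp), add_mul]

theorem linForm_le_of_dominated (f : ℕ → ℕ) {n a : ℕ} {neg pos : List (ℕ × ℕ)}
    (h : dominated n a neg pos) : linForm neg f ≤ linForm pos f := by
  induction n generalizing a neg pos with
  | zero =>
    simp only [dominated, Bool.and_eq_true, List.all_eq_true, Nat.beq_eq, Nat.ble_eq] at h
    obtain ⟨⟨h1, h2⟩, h3⟩ := h
    rw [linForm_of_forall_eq h1, linForm_of_forall_eq h2]
    exact Nat.mul_le_mul_right _ h3
  | succ n ih =>
    simp only [dominated, Bool.and_eq_true] at h
    rw [← linForm_filter_add neg fun t => (t.1.land (2 ^ n)).beq 0,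
      ← linForm_filter_add pos fun t => (t.1.land (2 ^ n)).beq 0]
    exact add_le_add (ih h.1) (ih h.2)

/-! ### Certificates -/

/-- The union of the masks in `A` that are contained in the mask `r`. -/
def hull : List ℕ → ℕ → ℕ
  | [], _ => 0
  | s :: A, r => bif (s.lor r).beq r then s.lor (hull A r) else hull A r

/-- A multiple `mult` of the inequality `x p + x q ≤ x (p ∪ q) + x r`. -/
structure Cut where
  p : ℕ
  q : ℕ
  r : ℕ
  mult : ℕ

/-- Exchange the bits `i` and `j` of a mask. -/
def swapBits (i j y : ℕ) : ℕ :=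
  bif (y.testBit i).xor (y.testBit j) then y.xor (2 ^ i + 2 ^ j) else y

/-- Apply a product of bit transpositions to a mask. -/
def permuteBits (g : List (ℕ × ℕ)) (y : ℕ) : ℕ := g.foldl (fun y t => swapBits t.1 t.2 y) y

/-- Apply a product of bit transpositions to all masks of a cut. -/
def Cut.permute (g : List (ℕ × ℕ)) (c : Cut) : Cut :=
  ⟨permuteBits g c.p, permuteBits g c.q, permuteBits g c.r, c.mult⟩

/-- Successively add to a list of cuts its images under the given symmetries. -/
def symmetrize (gs : List (List (ℕ × ℕ))) (cs : List Cut) : List Cut :=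
  gs.foldl (fun cs g => cs ++ cs.map (Cut.permute g)) cs

/-- Whether `r` is reachable from both `p` and `q` by adding members of `A`. -/
def Cut.valid (A : List ℕ) (c : Cut) : Bool :=
  (c.p.lor (hull A c.r)).beq c.r && (c.q.lor (hull A c.r)).beq c.r

/-- Whether the weights `w` satisfy Poonen's criterion for the family of masks `A`, as witnessed by
the multiplier `N` and the valid cuts `cs`. -/
def certifies (w A : List ℕ) (N : ℕ) (cs : List Cut) : Bool :=
  cs.all (Cut.valid A) &&
  dominated w.length 0
    ((List.range (2 ^ w.length)).map (fun y => (y, N * w.sum)) ++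
      (cs.map (fun c => (c.p.lor c.q, c.mult)) ++ cs.map (fun c => (c.r, c.mult))))
    ((List.range (2 ^ w.length)).map (fun y => (y, N * (2 * maskWeight w y))) ++
      (cs.map (fun c => (c.p, c.mult)) ++ cs.map (fun c => (c.q, c.mult))))

theorem mem_of_mem_union_hull {l A : List ℕ} {F : Finset (Finset ℕ)} (hF : UC F)
    (hA : ∀ s ∈ A, maskSet l s ∈ F) (r : ℕ) {Z : Finset ℕ} (hZ : Z ∈ F) :
    Z ∪ maskSet l (hull A r) ∈ F := by
  induction A generalizing Z with
  | nil =>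
    have : maskSet l 0 = ∅ := by
      ext x
      simp [mem_maskSet]
    simpa [hull, this] using hZ
  | cons s A ih =>
    have ih' := fun {Z} => ih (Z := Z) fun s hs => hA s (List.mem_cons_of_mem _ hs)
    unfold hull
    cases (s.lor r).beq r
    · exact ih' hZ
    · have : maskSet l (s.lor (hull A r)) = maskSet l s ∪ maskSet l (hull A r) :=
        maskSet_or _ _ _
      rw [cond_true, this, ← Finset.union_assoc]
      exact ih' (hF _ hZ _ (hA s (by simp)))

theorem Cut.indicator_le {l A : List ℕ} {F : Finset (Finset ℕ)} (hF : UC F)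
    (hA : ∀ s ∈ A, maskSet l s ∈ F) {c : Cut} (hc : c.valid A) (X : Finset ℕ) {f : ℕ → ℕ}
    (hf : ∀ y, f y = if X ∪ maskSet l y ∈ F then 1 else 0) :
    f c.p + f c.q ≤ f (c.p.lor c.q) + f c.r := by
  simp only [Cut.valid, Bool.and_eq_true, Nat.beq_eq] at hc
  have key : ∀ y, y.lor (hull A c.r) = c.r → X ∪ maskSet l y ∈ F → X ∪ maskSet l c.r ∈ F := by
    intro y hy h
    have := mem_of_mem_union_hull hF hA c.r h
    rwa [Finset.union_assoc, ← maskSet_or, show y ||| hull A c.r = c.r from hy] at this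
  have hp := key _ hc.1
  have hq := key _ hc.2
  have hpq : X ∪ maskSet l c.p ∈ F → X ∪ maskSet l c.q ∈ F →
      X ∪ maskSet l (c.p.lor c.q) ∈ F := by
    intro h1 h2
    have : maskSet l (c.p.lor c.q) = maskSet l c.p ∪ maskSet l c.q := maskSet_or _ _ _
    rw [this, Finset.union_union_distrib_left]
    exact hF _ h1 _ h2
  simp only [hf]
  split_ifs <;> simp_all

theorem sum_le_of_certifies {l w A : List ℕ} {N : ℕ} {cs : List Cut} (hN : 0 < N)
    (hcert : certifies w A N cs) {F : Finset (Finset ℕ)} (hF : UC F)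
    (hA : ∀ s ∈ A, maskSet l s ∈ F) (X : Finset ℕ) {f : ℕ → ℕ}
    (hf : ∀ y, f y = if X ∪ maskSet l y ∈ F then 1 else 0) :
    ∑ y ∈ Finset.range (2 ^ w.length), w.sum * f y ≤
      ∑ y ∈ Finset.range (2 ^ w.length), 2 * maskWeight w y * f y := by
  simp only [certifies, Bool.and_eq_true, List.all_eq_true] at hcert
  obtain ⟨hvalid, hdom⟩ := hcert
  have h := linForm_le_of_dominated f hdom
  have hcuts : linForm (cs.map fun c => (c.p, c.mult)) f + linForm (cs.map fun c => (c.q, c.mult)) f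
      ≤ linForm (cs.map fun c => (c.p.lor c.q, c.mult)) f +
        linForm (cs.map fun c => (c.r, c.mult)) f := by
    clear h hdom
    induction cs with
    | nil => simp [linForm]
    | cons c cs ih =>
      have h1 := ih fun c hc => hvalid c (List.mem_cons_of_mem _ hc)
      have h2 := Nat.mul_le_mul_left c.mult (Cut.indicator_le hF hA (hvalid c (by simp)) X hf)
      rw [mul_add, mul_add] at h2
      simp only [linForm, List.map_cons, List.sum_cons] at h1 ⊢
      omega
  have hrange : ∀ g : ℕ → ℕ, linForm ((List.range (2 ^ w.length)).map fun y => (y, N * g y)) f =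
      N * ∑ y ∈ Finset.range (2 ^ w.length), g y * f y := by
    intro g
    generalize 2 ^ w.length = m
    induction m with
    | zero => simp [linForm]
    | succ m ih =>
      rw [List.range_succ, List.map_append, linForm_append, ih, Finset.sum_range_succ, mul_add]
      simp [linForm, mul_assoc]
  rw [linForm_append, linForm_append, linForm_append, linForm_append,
    hrange (fun _ => w.sum), hrange (fun y => 2 * maskWeight w y)] at h
  exact Nat.le_of_mul_le_mul_left (by omega) hN

theorem sum_fiber_eq_sum_masks {l : List ℕ} (hl : l.Nodup) (F : Finset (Finset ℕ)) {X : Finset ℕ}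
    (hX : Disjoint X l.toFinset) (φ : Finset ℕ → ℕ) :
    ∑ G ∈ F with G \ l.toFinset = X, φ G =
      ∑ y ∈ Finset.range (2 ^ l.length) with X ∪ maskSet l y ∈ F, φ (X ∪ maskSet l y) := by
  have hsdiff : ∀ y, (X ∪ maskSet l y) \ l.toFinset = X := fun y => by
    rw [Finset.union_sdiff_distrib, Finset.sdiff_eq_empty_iff_subset.2 (maskSet_subset l y),
      Finset.union_empty, Finset.sdiff_eq_self_of_disjoint hX]
  have hinter : ∀ y, (X ∪ maskSet l y) ∩ l.toFinset = maskSet l y := fun y => by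
    rw [Finset.union_inter_distrib_right, Finset.disjoint_iff_inter_eq_empty.1 hX,
      Finset.empty_union, Finset.inter_eq_left.2 (maskSet_subset l y)]
  symm
  refine Finset.sum_bij (fun y _ => X ∪ maskSet l y) ?_ ?_ ?_ fun _ _ => rfl
  · intro y hy
    exact Finset.mem_filter.2 ⟨(Finset.mem_filter.1 hy).2, hsdiff y⟩
  · intro y hy z hz h
    simp only [Finset.mem_filter, Finset.mem_range] at hy hz
    refine maskSet_injOn hl hy.1 hz.1 ?_
    rw [← hinter y, ← hinter z, h]
  · intro G hG
    obtain ⟨hGF, rfl⟩ := Finset.mem_filter.1 hG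
    obtain ⟨y, hy, hyG⟩ := exists_maskSet_eq hl (Finset.inter_subset_right (s₁ := G))
    have hGy : G \ l.toFinset ∪ maskSet l y = G := by
      rw [hyG, Finset.sdiff_union_inter]
    exact ⟨y, by simp [hy, hGy, hGF], hGy⟩

/-- A family of masks with a certificate is Frankl-complete: a union-closed family containing its
image under any injective labelling has a label that lies in at least half of the sets. -/
theorem exists_frequent_of_certifies {w A : List ℕ} {N : ℕ} {cs : List Cut}
    (hcert : certifies w A N cs) (hN : 0 < N) (hw : 0 < w.sum)
    {F : Finset (Finset ℕ)} (hF : UC F) {l : List ℕ} (hl : l.Nodup) (hlen : l.length = w.length)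
    (hA : ∀ s ∈ A, maskSet l s ∈ F) :
    ∃ i ∈ l, F.card ≤ 2 * (memFam F i).card := by
  by_contra! hlow
  let wt : Finset ℕ → ℕ := fun G => ((l.zip w).map fun p => if p.1 ∈ G then p.2 else 0).sum
  have hle : ∑ G ∈ F, w.sum ≤ ∑ G ∈ F, 2 * wt G := by
    have hmaps : ∀ G ∈ F, G \ l.toFinset ∈ F.image (· \ l.toFinset) :=
      fun G hG => Finset.mem_image_of_mem _ hG
    rw [← Finset.sum_fiberwise_of_maps_to hmaps, ← Finset.sum_fiberwise_of_maps_to hmaps]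
    refine Finset.sum_le_sum fun X hX => ?_
    obtain ⟨G, -, rfl⟩ := Finset.mem_image.1 hX
    have hdisj : Disjoint (G \ l.toFinset) l.toFinset := Finset.sdiff_disjoint
    rw [sum_fiber_eq_sum_masks hl F hdisj, sum_fiber_eq_sum_masks hl F hdisj,
      Finset.sum_filter, Finset.sum_filter, hlen]
    have h := sum_le_of_certifies hN hcert hF hA (G \ l.toFinset) fun _ => rfl
    simp only [mul_ite, mul_one, mul_zero] at h
    refine h.trans_eq (Finset.sum_congr rfl fun y _ => ?_)
    have hwt : wt (G \ l.toFinset ∪ maskSet l y) = maskWeight w y := by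
      rw [maskWeight_eq_sum hlen hl]
      refine congrArg List.sum (List.map_congr_left fun p hp => ?_)
      have : p.1 ∈ l := (List.of_mem_zip hp).1
      simp [this]
    rw [hwt]
  have hswap : ∀ z : List (ℕ × ℕ),
      ∑ G ∈ F, (z.map fun p => if p.1 ∈ G then p.2 else 0).sum =
        (z.map fun p => p.2 * (memFam F p.1).card).sum := by
    intro z
    induction z with
    | nil => simp
    | cons p z ih =>
      simp only [List.map_cons, List.sum_cons, Finset.sum_add_distrib, ih]
      rw [← Finset.sum_filter, Finset.sum_const, smul_eq_mul, mul_comm, memFam]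
  have hstrict : ∀ z : List (ℕ × ℕ), (∀ p ∈ z, p.1 ∈ l) →
      2 * (z.map fun p => p.2 * (memFam F p.1).card).sum + (z.map Prod.snd).sum ≤
        (z.map Prod.snd).sum * F.card := by
    intro z hz
    induction z with
    | nil => simp
    | cons p z ih =>
      have h1 := ih fun q hq => hz q (List.mem_cons_of_mem _ hq)
      have h2 := Nat.mul_le_mul_left p.2 (hlow p.1 (hz p (by simp)))
      simp only [List.map_cons, List.sum_cons]
      rw [Nat.succ_eq_add_one] at h2
      nlinarith
  have h := hstrict (l.zip w) fun p hp => (List.of_mem_zip hp).1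
  rw [← hswap, List.map_snd_zip hlen.ge] at h
  rw [Finset.sum_const, smul_eq_mul, ← Finset.mul_sum, mul_comm] at hle
  change 2 * ∑ G ∈ F, wt G + w.sum ≤ _ at h
  omega

/-- `A` is a member of `F` each of whose elements lies in fewer than half of the sets of `F`. -/
def Rare (F : Finset (Finset ℕ)) (A : Finset ℕ) : Prop :=
  A ∈ F ∧ ∀ x ∈ A, 2 * (memFam F x).card < F.card

theorem not_rare_of_certifies {w A : List ℕ} {N : ℕ} {cs : List Cut}
    (hcert : certifies w A N cs) (hN : 0 < N) (hw : 0 < w.sum)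
    {F : Finset (Finset ℕ)} (hF : UC F) {l : List ℕ} (hl : l.Nodup) (hlen : l.length = w.length)
    (hcover : ∀ x ∈ l, ∃ s ∈ A, x ∈ maskSet l s) (hA : ∀ s ∈ A, Rare F (maskSet l s)) : False := by
  obtain ⟨x, hx, hle⟩ :=
    exists_frequent_of_certifies hcert hN hw hF hl hlen fun s hs => (hA s hs).1
  obtain ⟨s, hs, hxs⟩ := hcover x hx
  exact hle.not_gt ((hA s hs).2 x hxs)

/-! ### Frankl-complete configurations of 3-sets -/

/-- Cuts for the configuration `abc, abd, acd`. -/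
def cuts_abc_abd_acd : List Cut := [
  ⟨8, 4, 13, 2⟩, ⟨1, 1, 7, 2⟩, ⟨0, 0, 13, 1⟩, ⟨0, 0, 11, 3⟩, ⟨12, 2, 15, 2⟩, ⟨13, 11, 15, 1⟩]

theorem certifies_abc_abd_acd :
    certifies [1, 1, 1, 1] [7, 11, 13] 1 cuts_abc_abd_acd := by
  decide +kernel

theorem not_rare_abc_abd_acd {F : Finset (Finset ℕ)} (hF : UC F)
    {a b c d : ℕ} (hl : [a, b, c, d].Nodup)
    (h1 : Rare F {a, b, c}) (h2 : Rare F {a, b, d}) (h3 : Rare F {a, c, d}) : False :=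
  not_rare_of_certifies certifies_abc_abd_acd (by norm_num) (by norm_num) hF hl rfl
    (by simp [maskSet]) (by simp [maskSet, h1, h2, h3])

/-- Cuts for the configuration `abc, abd, abe`. -/
def cuts_abc_abd_abe : List Cut := [
  ⟨24, 2, 27, 4⟩, ⟨20, 2, 23, 2⟩, ⟨20, 1, 23, 2⟩, ⟨18, 8, 27, 2⟩, ⟨17, 4, 23, 2⟩, ⟨16, 9, 27, 2⟩,
  ⟨12, 1, 15, 4⟩, ⟨10, 4, 15, 2⟩, ⟨8, 5, 15, 2⟩, ⟨6, 16, 23, 2⟩, ⟨0, 0, 19, 4⟩, ⟨0, 0, 11, 4⟩,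
  ⟨26, 4, 31, 4⟩, ⟨22, 8, 31, 2⟩, ⟨0, 0, 7, 4⟩, ⟨21, 8, 31, 2⟩, ⟨16, 13, 31, 4⟩]

theorem certifies_abc_abd_abe :
    certifies [3, 3, 2, 2, 2] [7, 11, 19] 1 cuts_abc_abd_abe := by
  decide +kernel

theorem not_rare_abc_abd_abe {F : Finset (Finset ℕ)} (hF : UC F)
    {a b c d e : ℕ} (hl : [a, b, c, d, e].Nodup)
    (h1 : Rare F {a, b, c}) (h2 : Rare F {a, b, d}) (h3 : Rare F {a, b, e}) : False :=
  not_rare_of_certifies certifies_abc_abd_abe (by norm_num) (by norm_num) hF hl rfl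
    (by simp [maskSet]) (by simp [maskSet, h1, h2, h3])

/-- Cuts for the configuration `abc, abd, cde`. -/
def cuts_abc_abd_cde : List Cut := [
  ⟨24, 24, 27, 2⟩, ⟨24, 2, 31, 1⟩, ⟨20, 20, 23, 2⟩, ⟨20, 2, 31, 1⟩, ⟨18, 18, 30, 3⟩,
  ⟨17, 17, 29, 1⟩, ⟨16, 16, 27, 3⟩, ⟨16, 16, 23, 3⟩, ⟨12, 1, 15, 3⟩, ⟨10, 4, 15, 3⟩,
  ⟨8, 8, 15, 1⟩, ⟨6, 6, 30, 1⟩, ⟨2, 2, 30, 1⟩, ⟨8, 4, 31, 2⟩, ⟨8, 2, 31, 2⟩, ⟨28, 1, 31, 2⟩,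
  ⟨0, 0, 28, 3⟩, ⟨0, 0, 7, 3⟩, ⟨0, 0, 11, 3⟩, ⟨17, 5, 29, 1⟩, ⟨17, 9, 29, 1⟩, ⟨16, 3, 31, 1⟩]

theorem certifies_abc_abd_cde :
    certifies [2, 2, 2, 2, 1] [7, 11, 28] 1 cuts_abc_abd_cde := by
  decide +kernel

theorem not_rare_abc_abd_cde {F : Finset (Finset ℕ)} (hF : UC F)
    {a b c d e : ℕ} (hl : [a, b, c, d, e].Nodup)
    (h1 : Rare F {a, b, c}) (h2 : Rare F {a, b, d}) (h3 : Rare F {c, d, e}) : False :=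
  not_rare_of_certifies certifies_abc_abd_cde (by norm_num) (by norm_num) hF hl rfl
    (by simp [maskSet]) (by simp [maskSet, h1, h2, h3])

/-- Cuts for the configuration `abc, abd, ade`. -/
def cuts_abc_abd_ade : List Cut := [
  ⟨24, 6, 31, 7⟩, ⟨24, 2, 27, 7⟩, ⟨20, 20, 29, 1⟩, ⟨20, 10, 31, 3⟩, ⟨20, 2, 31, 5⟩,
  ⟨20, 1, 31, 8⟩, ⟨18, 12, 31, 5⟩, ⟨18, 4, 31, 5⟩, ⟨18, 1, 27, 4⟩, ⟨17, 2, 27, 8⟩,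
  ⟨16, 16, 27, 5⟩, ⟨16, 16, 23, 30⟩, ⟨12, 2, 15, 10⟩, ⟨9, 4, 15, 16⟩, ⟨8, 8, 15, 2⟩,
  ⟨5, 5, 29, 10⟩, ⟨4, 4, 29, 15⟩, ⟨13, 21, 29, 2⟩, ⟨22, 8, 31, 11⟩, ⟨8, 1, 27, 14⟩, ⟨4, 4, 15, 1⟩,
  ⟨0, 0, 11, 26⟩, ⟨0, 0, 7, 14⟩, ⟨0, 0, 25, 14⟩, ⟨16, 10, 31, 3⟩, ⟨11, 6, 15, 4⟩, ⟨20, 8, 31, 2⟩,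
  ⟨8, 4, 15, 1⟩, ⟨20, 6, 31, 3⟩, ⟨17, 3, 31, 2⟩]

theorem certifies_abc_abd_ade :
    certifies [7, 6, 4, 6, 4] [7, 11, 25] 2 cuts_abc_abd_ade := by
  decide +kernel

theorem not_rare_abc_abd_ade {F : Finset (Finset ℕ)} (hF : UC F)
    {a b c d e : ℕ} (hl : [a, b, c, d, e].Nodup)
    (h1 : Rare F {a, b, c}) (h2 : Rare F {a, b, d}) (h3 : Rare F {a, d, e}) : False :=
  not_rare_of_certifies certifies_abc_abd_ade (by norm_num) (by norm_num) hF hl rfl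
    (by simp [maskSet]) (by simp [maskSet, h1, h2, h3])

/-- Cuts for the configuration `abc, abd, cef, def`. -/
def cuts_abc_abd_cef_def : List Cut := [
  ⟨40, 40, 47, 12⟩, ⟨36, 36, 47, 12⟩, ⟨33, 12, 63, 6⟩, ⟨33, 5, 53, 6⟩, ⟨32, 32, 43, 12⟩,
  ⟨32, 32, 39, 12⟩, ⟨24, 20, 31, 2⟩, ⟨24, 18, 27, 10⟩, ⟨2, 2, 58, 12⟩, ⟨6, 6, 62, 12⟩,
  ⟨37, 9, 61, 6⟩, ⟨28, 25, 31, 2⟩, ⟨26, 20, 31, 12⟩, ⟨20, 20, 31, 6⟩, ⟨17, 5, 53, 6⟩,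
  ⟨16, 16, 27, 3⟩, ⟨16, 16, 23, 13⟩, ⟨12, 1, 15, 4⟩, ⟨10, 38, 62, 12⟩, ⟨9, 9, 61, 14⟩,
  ⟨8, 8, 15, 8⟩, ⟨16, 4, 60, 8⟩, ⟨8, 4, 60, 4⟩, ⟨1, 1, 57, 12⟩, ⟨0, 0, 52, 24⟩, ⟨27, 23, 31, 1⟩,
  ⟨8, 1, 59, 8⟩, ⟨8, 18, 59, 2⟩, ⟨52, 2, 55, 12⟩, ⟨52, 52, 55, 12⟩, ⟨17, 8, 59, 2⟩,
  ⟨17, 13, 61, 4⟩, ⟨21, 12, 63, 6⟩, ⟨0, 0, 56, 12⟩, ⟨56, 55, 63, 12⟩, ⟨48, 3, 59, 12⟩,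
  ⟨34, 4, 55, 12⟩]

theorem certifies_abc_abd_cef_def :
    certifies [1, 1, 1, 1, 1, 1] [7, 11, 52, 56] 6 cuts_abc_abd_cef_def := by
  decide +kernel

theorem not_rare_abc_abd_cef_def {F : Finset (Finset ℕ)} (hF : UC F)
    {a b c d e f : ℕ} (hl : [a, b, c, d, e, f].Nodup)
    (h1 : Rare F {a, b, c}) (h2 : Rare F {a, b, d}) (h3 : Rare F {c, e, f})
    (h4 : Rare F {d, e, f}) : False :=
  not_rare_of_certifies certifies_abc_abd_cef_def (by norm_num) (by norm_num) hF hl rfl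
    (by simp [maskSet]) (by simp [maskSet, h1, h2, h3, h4])

/-- Cuts for the configuration `abc, abd, cef, aef`. -/
def cuts_abc_abd_cef_aef : List Cut := [
  ⟨56, 10, 59, 2⟩, ⟨56, 6, 63, 12⟩, ⟨48, 10, 59, 28⟩, ⟨44, 9, 61, 22⟩, ⟨42, 42, 47, 6⟩,
  ⟨42, 4, 63, 14⟩, ⟨42, 1, 59, 6⟩, ⟨40, 40, 47, 50⟩, ⟨36, 9, 63, 6⟩, ⟨36, 3, 55, 8⟩,
  ⟨36, 1, 53, 14⟩, ⟨34, 34, 43, 14⟩, ⟨34, 33, 39, 14⟩, ⟨32, 10, 59, 12⟩, ⟨32, 8, 59, 8⟩,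
  ⟨0, 0, 49, 15⟩, ⟨32, 12, 63, 8⟩, ⟨4, 4, 53, 26⟩, ⟨32, 32, 43, 8⟩, ⟨32, 32, 39, 20⟩,
  ⟨24, 24, 31, 28⟩, ⟨20, 20, 31, 14⟩, ⟨16, 16, 27, 14⟩, ⟨16, 16, 23, 42⟩, ⟨12, 12, 61, 34⟩,
  ⟨8, 8, 57, 28⟩, ⟨8, 8, 15, 20⟩, ⟨2, 2, 51, 42⟩, ⟨0, 0, 11, 4⟩, ⟨0, 0, 7, 20⟩, ⟨18, 18, 27, 14⟩,
  ⟨58, 4, 63, 16⟩, ⟨0, 0, 52, 45⟩, ⟨18, 3, 55, 6⟩, ⟨18, 1, 55, 8⟩, ⟨20, 1, 55, 14⟩,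
  ⟨26, 14, 62, 14⟩, ⟨28, 17, 31, 14⟩, ⟨24, 5, 63, 14⟩, ⟨52, 8, 63, 14⟩, ⟨52, 6, 55, 16⟩,
  ⟨52, 2, 55, 14⟩, ⟨11, 7, 15, 4⟩, ⟨52, 49, 53, 1⟩, ⟨54, 7, 55, 2⟩]

theorem certifies_abc_abd_cef_aef :
    certifies [3, 2, 2, 1, 2, 2] [7, 11, 52, 49] 7 cuts_abc_abd_cef_aef := by
  decide +kernel

theorem not_rare_abc_abd_cef_aef {F : Finset (Finset ℕ)} (hF : UC F)
    {a b c d e f : ℕ} (hl : [a, b, c, d, e, f].Nodup)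
    (h1 : Rare F {a, b, c}) (h2 : Rare F {a, b, d}) (h3 : Rare F {c, e, f})
    (h4 : Rare F {a, e, f}) : False :=
  not_rare_of_certifies certifies_abc_abd_cef_aef (by norm_num) (by norm_num) hF hl rfl
    (by simp [maskSet]) (by simp [maskSet, h1, h2, h3, h4])

/-- Cuts for the configuration `abc, abd, cef, deg`. -/
def cuts_abc_abd_cef_deg : List Cut := [
  ⟨104, 104, 111, 24⟩, ⟨100, 104, 111, 4⟩, ⟨96, 96, 107, 48⟩, ⟨80, 80, 87, 56⟩, ⟨72, 72, 75, 24⟩,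
  ⟨66, 66, 118, 48⟩, ⟨32, 3, 63, 20⟩, ⟨28, 18, 31, 28⟩, ⟨19, 64, 95, 4⟩, ⟨33, 65, 125, 24⟩,
  ⟨20, 24, 31, 24⟩, ⟨16, 16, 27, 32⟩, ⟨12, 2, 15, 26⟩, ⟨52, 8, 124, 16⟩, ⟨49, 41, 121, 16⟩,
  ⟨56, 50, 123, 32⟩, ⟨0, 0, 88, 60⟩, ⟨10, 10, 62, 80⟩, ⟨40, 38, 47, 48⟩, ⟨2, 2, 90, 54⟩,
  ⟨36, 72, 127, 16⟩, ⟨17, 8, 91, 20⟩, ⟨4, 8, 127, 6⟩, ⟨32, 64, 127, 16⟩, ⟨64, 64, 71, 24⟩,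
  ⟨97, 8, 127, 16⟩, ⟨52, 31, 63, 16⟩, ⟨88, 88, 95, 28⟩, ⟨112, 67, 119, 20⟩, ⟨96, 67, 119, 4⟩,
  ⟨97, 13, 125, 24⟩, ⟨26, 26, 62, 30⟩, ⟨48, 40, 123, 8⟩, ⟨88, 88, 91, 20⟩, ⟨33, 4, 55, 16⟩,
  ⟨41, 69, 125, 8⟩, ⟨108, 98, 111, 16⟩, ⟨21, 25, 125, 2⟩, ⟨35, 16, 63, 12⟩, ⟨44, 15, 127, 6⟩,
  ⟨53, 89, 125, 11⟩, ⟨52, 88, 124, 2⟩, ⟨116, 86, 119, 16⟩, ⟨64, 64, 116, 16⟩, ⟨76, 76, 79, 10⟩,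
  ⟨21, 13, 93, 2⟩]

theorem certifies_abc_abd_cef_deg :
    certifies [5, 5, 5, 5, 4, 3, 3] [7, 11, 52, 88] 8
      (symmetrize [[(0, 1)], [(2, 3), (5, 6)]] cuts_abc_abd_cef_deg) := by
  decide +kernel

theorem not_rare_abc_abd_cef_deg {F : Finset (Finset ℕ)} (hF : UC F)
    {a b c d e f g : ℕ} (hl : [a, b, c, d, e, f, g].Nodup)
    (h1 : Rare F {a, b, c}) (h2 : Rare F {a, b, d}) (h3 : Rare F {c, e, f})
    (h4 : Rare F {d, e, g}) : False :=
  not_rare_of_certifies certifies_abc_abd_cef_deg (by norm_num) (by norm_num) hF hl rfl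
    (by simp [maskSet]) (by simp [maskSet, h1, h2, h3, h4])

/-- Cuts for the configuration `abc, abd, cef, efg`. -/
def cuts_abc_abd_cef_efg : List Cut := [
  ⟨112, 10, 123, 12⟩, ⟨112, 3, 119, 4⟩, ⟨96, 96, 107, 12⟩, ⟨96, 96, 103, 20⟩, ⟨76, 66, 79, 4⟩,
  ⟨65, 33, 117, 8⟩, ⟨64, 32, 112, 12⟩, ⟨48, 11, 63, 4⟩, ⟨48, 3, 55, 4⟩, ⟨0, 0, 112, 8⟩,
  ⟨10, 10, 62, 8⟩, ⟨0, 0, 7, 8⟩, ⟨62, 62, 126, 8⟩, ⟨92, 82, 95, 20⟩, ⟨12, 1, 63, 8⟩,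
  ⟨72, 24, 124, 8⟩, ⟨88, 4, 127, 12⟩, ⟨2, 2, 54, 12⟩, ⟨0, 0, 52, 4⟩, ⟨112, 2, 119, 8⟩,
  ⟨25, 13, 61, 20⟩, ⟨88, 84, 95, 8⟩, ⟨81, 5, 117, 4⟩, ⟨56, 49, 59, 4⟩, ⟨8, 6, 15, 8⟩,
  ⟨24, 18, 31, 12⟩, ⟨32, 32, 39, 12⟩, ⟨32, 32, 43, 4⟩, ⟨8, 8, 60, 4⟩, ⟨15, 15, 63, 4⟩,
  ⟨73, 45, 125, 12⟩, ⟨7, 7, 55, 8⟩, ⟨69, 33, 117, 12⟩, ⟨67, 35, 115, 4⟩, ⟨64, 36, 116, 4⟩,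
  ⟨25, 20, 31, 8⟩, ⟨68, 66, 71, 8⟩, ⟨72, 44, 124, 4⟩, ⟨113, 52, 119, 4⟩, ⟨124, 118, 127, 4⟩,
  ⟨117, 8, 127, 4⟩, ⟨71, 71, 79, 4⟩]

theorem certifies_abc_abd_cef_efg :
    certifies [3, 3, 4, 2, 3, 3, 2] [7, 11, 52, 112] 4
      (symmetrize [[(0, 1)], [(4, 5)]] cuts_abc_abd_cef_efg) := by
  decide +kernel

theorem not_rare_abc_abd_cef_efg {F : Finset (Finset ℕ)} (hF : UC F)
    {a b c d e f g : ℕ} (hl : [a, b, c, d, e, f, g].Nodup)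
    (h1 : Rare F {a, b, c}) (h2 : Rare F {a, b, d}) (h3 : Rare F {c, e, f})
    (h4 : Rare F {e, f, g}) : False :=
  not_rare_of_certifies certifies_abc_abd_cef_efg (by norm_num) (by norm_num) hF hl rfl
    (by simp [maskSet]) (by simp [maskSet, h1, h2, h3, h4])

/-- Cuts for the configuration `abc, abd, cef, aeg`. -/
def cuts_abc_abd_cef_aeg : List Cut := [
  ⟨112, 42, 123, 384⟩, ⟨112, 2, 119, 96⟩, ⟨108, 106, 111, 96⟩, ⟨108, 98, 111, 192⟩,
  ⟨108, 97, 111, 288⟩, ⟨108, 73, 125, 168⟩, ⟨104, 100, 111, 648⟩, ⟨100, 1, 119, 216⟩,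
  ⟨98, 65, 119, 120⟩, ⟨98, 1, 119, 168⟩, ⟨96, 96, 107, 580⟩, ⟨96, 96, 103, 846⟩,
  ⟨96, 56, 123, 56⟩, ⟨88, 10, 91, 134⟩, ⟨88, 6, 95, 672⟩, ⟨88, 2, 91, 382⟩, ⟨84, 73, 95, 120⟩,
  ⟨84, 66, 87, 266⟩, ⟨44, 35, 47, 314⟩, ⟨40, 40, 121, 672⟩, ⟨36, 35, 39, 240⟩, ⟨82, 3, 83, 240⟩,
  ⟨80, 72, 91, 252⟩, ⟨80, 68, 87, 98⟩, ⟨70, 70, 118, 304⟩, ⟨8, 8, 89, 372⟩, ⟨68, 74, 79, 96⟩,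
  ⟨24, 72, 89, 456⟩, ⟨76, 65, 79, 288⟩, ⟨22, 24, 31, 96⟩, ⟨42, 14, 62, 96⟩, ⟨68, 68, 79, 480⟩,
  ⟨66, 66, 118, 368⟩, ⟨64, 64, 75, 212⟩, ⟨64, 64, 71, 364⟩, ⟨34, 34, 115, 838⟩, ⟨24, 24, 31, 108⟩,
  ⟨20, 20, 31, 276⟩, ⟨18, 18, 54, 206⟩, ⟨18, 18, 27, 214⟩, ⟨16, 16, 27, 266⟩, ⟨16, 16, 23, 672⟩,
  ⟨12, 12, 93, 732⟩, ⟨10, 10, 62, 576⟩, ⟨9, 9, 61, 672⟩, ⟨8, 8, 60, 636⟩, ⟨4, 4, 85, 1100⟩,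
  ⟨2, 2, 54, 82⟩, ⟨1, 1, 53, 576⟩, ⟨49, 49, 59, 46⟩, ⟨17, 5, 53, 96⟩, ⟨50, 50, 115, 26⟩,
  ⟨28, 17, 31, 384⟩, ⟨26, 20, 31, 192⟩, ⟨40, 5, 63, 202⟩, ⟨37, 8, 63, 96⟩, ⟨33, 2, 55, 672⟩,
  ⟨53, 8, 63, 192⟩, ⟨52, 52, 63, 794⟩, ⟨18, 40, 63, 156⟩, ⟨85, 85, 87, 656⟩, ⟨89, 60, 125, 540⟩,
  ⟨25, 32, 127, 96⟩, ⟨75, 32, 127, 92⟩, ⟨64, 36, 117, 318⟩, ⟨36, 71, 127, 18⟩, ⟨64, 32, 117, 546⟩,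
  ⟨24, 20, 127, 204⟩, ⟨48, 48, 59, 408⟩, ⟨90, 90, 126, 672⟩, ⟨48, 41, 123, 168⟩,
  ⟨81, 48, 119, 288⟩, ⟨32, 32, 43, 706⟩, ⟨69, 36, 119, 96⟩, ⟨66, 5, 119, 134⟩, ⟨74, 74, 126, 384⟩,
  ⟨68, 36, 119, 66⟩, ⟨65, 65, 75, 72⟩, ⟨16, 13, 95, 96⟩, ⟨0, 0, 52, 535⟩, ⟨80, 80, 116, 228⟩,
  ⟨0, 0, 11, 430⟩, ⟨0, 0, 81, 734⟩, ⟨0, 0, 7, 125⟩, ⟨76, 38, 127, 192⟩, ⟨5, 80, 87, 36⟩,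
  ⟨7, 52, 55, 29⟩, ⟨96, 41, 123, 120⟩, ⟨67, 67, 75, 96⟩, ⟨50, 3, 55, 240⟩, ⟨35, 16, 55, 214⟩,
  ⟨43, 81, 127, 318⟩, ⟨56, 11, 127, 400⟩, ⟨8, 8, 15, 142⟩, ⟨50, 50, 59, 10⟩, ⟨81, 55, 119, 128⟩,
  ⟨18, 1, 91, 96⟩, ⟨81, 14, 95, 96⟩, ⟨11, 4, 15, 126⟩, ⟨14, 14, 15, 96⟩, ⟨68, 28, 95, 108⟩,
  ⟨104, 82, 127, 24⟩, ⟨72, 72, 124, 348⟩, ⟨65, 44, 127, 192⟩, ⟨66, 38, 127, 96⟩,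
  ⟨116, 12, 127, 132⟩, ⟨105, 101, 111, 24⟩, ⟨120, 120, 123, 80⟩, ⟨43, 36, 47, 100⟩,
  ⟨56, 49, 123, 24⟩, ⟨50, 120, 123, 12⟩, ⟨120, 58, 123, 60⟩, ⟨80, 26, 95, 96⟩, ⟨82, 8, 95, 2⟩,
  ⟨49, 34, 123, 26⟩, ⟨80, 10, 95, 154⟩, ⟨40, 36, 47, 26⟩, ⟨82, 4, 127, 22⟩, ⟨92, 5, 127, 12⟩,
  ⟨45, 15, 127, 10⟩, ⟨68, 2, 127, 16⟩]

theorem certifies_abc_abd_cef_aeg :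
    certifies [4, 3, 3, 2, 3, 2, 2] [7, 11, 52, 81] 96 cuts_abc_abd_cef_aeg := by
  decide +kernel

theorem not_rare_abc_abd_cef_aeg {F : Finset (Finset ℕ)} (hF : UC F)
    {a b c d e f g : ℕ} (hl : [a, b, c, d, e, f, g].Nodup)
    (h1 : Rare F {a, b, c}) (h2 : Rare F {a, b, d}) (h3 : Rare F {c, e, f})
    (h4 : Rare F {a, e, g}) : False :=
  not_rare_of_certifies certifies_abc_abd_cef_aeg (by norm_num) (by norm_num) hF hl rfl
    (by simp [maskSet]) (by simp [maskSet, h1, h2, h3, h4])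

/-- Cuts for the configuration `abc, abd, cef, ceg`. -/
def cuts_abc_abd_cef_ceg : List Cut := [
  ⟨112, 3, 119, 15⟩, ⟨105, 100, 111, 41⟩, ⟨105, 25, 125, 24⟩, ⟨104, 12, 124, 4⟩, ⟨97, 5, 117, 26⟩,
  ⟨96, 96, 103, 36⟩, ⟨80, 80, 91, 56⟩, ⟨74, 74, 126, 41⟩, ⟨74, 74, 94, 26⟩, ⟨72, 72, 92, 2⟩,
  ⟨68, 68, 79, 6⟩, ⟨66, 66, 86, 22⟩, ⟨64, 64, 75, 15⟩, ⟨64, 64, 71, 40⟩, ⟨56, 6, 63, 8⟩,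
  ⟨56, 2, 63, 8⟩, ⟨52, 10, 63, 50⟩, ⟨52, 2, 55, 58⟩, ⟨48, 3, 55, 13⟩, ⟨44, 34, 47, 45⟩,
  ⟨96, 16, 119, 9⟩, ⟨16, 16, 23, 26⟩, ⟨4, 4, 84, 38⟩, ⟨0, 0, 84, 62⟩, ⟨0, 0, 7, 14⟩,
  ⟨36, 64, 119, 29⟩, ⟨20, 20, 31, 18⟩, ⟨24, 17, 27, 14⟩, ⟨28, 18, 31, 26⟩, ⟨10, 10, 94, 60⟩,
  ⟨32, 64, 116, 12⟩, ⟨43, 64, 127, 7⟩, ⟨36, 8, 127, 16⟩, ⟨40, 66, 127, 33⟩, ⟨25, 13, 125, 14⟩,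
  ⟨112, 112, 123, 14⟩, ⟨8, 2, 11, 38⟩, ⟨104, 98, 111, 11⟩, ⟨96, 27, 127, 2⟩, ⟨56, 72, 124, 24⟩,
  ⟨4, 18, 119, 6⟩, ⟨11, 7, 15, 10⟩, ⟨11, 11, 95, 40⟩, ⟨40, 37, 47, 16⟩, ⟨33, 65, 117, 10⟩,
  ⟨33, 81, 117, 24⟩, ⟨40, 36, 47, 5⟩, ⟨104, 98, 107, 13⟩, ⟨49, 81, 117, 12⟩, ⟨35, 16, 55, 17⟩,
  ⟨120, 114, 123, 28⟩, ⟨35, 64, 119, 4⟩, ⟨45, 73, 125, 13⟩, ⟨101, 12, 127, 2⟩, ⟨24, 12, 60, 22⟩,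
  ⟨96, 19, 119, 4⟩, ⟨51, 64, 127, 1⟩, ⟨48, 67, 127, 3⟩, ⟨40, 18, 63, 8⟩, ⟨122, 122, 126, 12⟩,
  ⟨96, 83, 127, 5⟩, ⟨119, 119, 127, 7⟩, ⟨8, 6, 63, 6⟩, ⟨20, 18, 23, 2⟩]

theorem certifies_abc_abd_cef_ceg :
    certifies [3, 3, 4, 2, 3, 2, 2] [7, 11, 52, 84] 16
      (symmetrize [[(0, 1)], [(5, 6)]] cuts_abc_abd_cef_ceg) := by
  decide +kernel

theorem not_rare_abc_abd_cef_ceg {F : Finset (Finset ℕ)} (hF : UC F)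
    {a b c d e f g : ℕ} (hl : [a, b, c, d, e, f, g].Nodup)
    (h1 : Rare F {a, b, c}) (h2 : Rare F {a, b, d}) (h3 : Rare F {c, e, f})
    (h4 : Rare F {c, e, g}) : False :=
  not_rare_of_certifies certifies_abc_abd_cef_ceg (by norm_num) (by norm_num) hF hl rfl
    (by simp [maskSet]) (by simp [maskSet, h1, h2, h3, h4])

/-- Cuts for the configuration `abc, abd, cef, dgh`. -/
def cuts_abc_abd_cef_dgh : List Cut := [
  ⟨240, 3, 255, 4⟩, ⟨232, 232, 239, 8⟩, ⟨224, 224, 231, 16⟩, ⟨216, 216, 219, 16⟩,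
  ⟨200, 200, 252, 12⟩, ⟨194, 194, 246, 16⟩, ⟨192, 192, 244, 4⟩, ⟨192, 192, 199, 12⟩,
  ⟨244, 199, 247, 4⟩, ⟨160, 160, 171, 32⟩, ⟨138, 138, 190, 40⟩, ⟨136, 136, 188, 8⟩,
  ⟨130, 130, 182, 16⟩, ⟨128, 128, 180, 16⟩, ⟨128, 128, 139, 8⟩, ⟨128, 128, 135, 16⟩,
  ⟨84, 81, 87, 32⟩, ⟨87, 91, 95, 16⟩, ⟨17, 4, 55, 16⟩, ⟨203, 203, 207, 8⟩, ⟨0, 0, 200, 8⟩,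
  ⟨53, 9, 253, 8⟩, ⟨0, 0, 11, 4⟩, ⟨24, 150, 223, 24⟩, ⟨28, 18, 223, 8⟩, ⟨52, 10, 63, 4⟩,
  ⟨7, 11, 15, 2⟩, ⟨120, 114, 123, 8⟩, ⟨56, 178, 251, 8⟩, ⟨25, 13, 61, 4⟩, ⟨25, 20, 31, 12⟩,
  ⟨20, 18, 31, 4⟩, ⟨112, 67, 119, 8⟩, ⟨135, 135, 143, 8⟩, ⟨2, 2, 202, 4⟩, ⟨252, 2, 255, 8⟩,
  ⟨12, 2, 63, 4⟩, ⟨85, 29, 221, 8⟩, ⟨17, 5, 53, 4⟩]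

theorem certifies_abc_abd_cef_dgh :
    certifies [2, 2, 2, 2, 1, 1, 1, 1] [7, 11, 52, 200] 16
      (symmetrize [[(0, 1)], [(4, 5)], [(6, 7)], [(2, 3), (4, 6), (5, 7)]]
        cuts_abc_abd_cef_dgh) := by
  decide +kernel

theorem not_rare_abc_abd_cef_dgh {F : Finset (Finset ℕ)} (hF : UC F)
    {a b c d e f g h : ℕ} (hl : [a, b, c, d, e, f, g, h].Nodup)
    (h1 : Rare F {a, b, c}) (h2 : Rare F {a, b, d}) (h3 : Rare F {c, e, f})
    (h4 : Rare F {d, g, h}) : False :=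
  not_rare_of_certifies certifies_abc_abd_cef_dgh (by norm_num) (by norm_num) hF hl rfl
    (by simp [maskSet]) (by simp [maskSet, h1, h2, h3, h4])

/-- Cuts for the configuration `abc, abd, cef, egh, fgh`. -/
def cuts_abc_abd_cef_egh_fgh : List Cut := [
  ⟨208, 52, 244, 12⟩, ⟨215, 11, 223, 2⟩, ⟨176, 176, 187, 20⟩, ⟨162, 162, 182, 40⟩,
  ⟨160, 160, 171, 16⟩, ⟨160, 160, 167, 32⟩, ⟨139, 139, 191, 32⟩, ⟨72, 40, 248, 16⟩,
  ⟨140, 140, 188, 16⟩, ⟨138, 138, 190, 44⟩, ⟨128, 128, 139, 20⟩, ⟨68, 68, 71, 4⟩,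
  ⟨14, 14, 238, 36⟩, ⟨10, 10, 62, 32⟩, ⟨7, 7, 55, 8⟩, ⟨6, 6, 230, 28⟩, ⟨3, 3, 227, 16⟩,
  ⟨2, 2, 54, 28⟩, ⟨62, 62, 254, 24⟩, ⟨34, 34, 242, 20⟩, ⟨42, 42, 250, 24⟩, ⟨216, 18, 219, 24⟩,
  ⟨46, 46, 238, 20⟩, ⟨199, 199, 207, 4⟩, ⟨44, 44, 236, 16⟩, ⟨0, 0, 7, 3⟩, ⟨248, 248, 252, 16⟩,
  ⟨200, 194, 203, 8⟩, ⟨64, 48, 244, 12⟩, ⟨4, 4, 228, 8⟩, ⟨38, 38, 230, 12⟩, ⟨69, 32, 231, 24⟩,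
  ⟨192, 192, 199, 12⟩, ⟨60, 54, 63, 4⟩, ⟨0, 0, 224, 17⟩, ⟨12, 2, 223, 16⟩, ⟨24, 40, 60, 4⟩,
  ⟨132, 132, 180, 20⟩, ⟨88, 86, 95, 48⟩, ⟨116, 71, 119, 4⟩, ⟨54, 54, 246, 20⟩, ⟨208, 224, 240, 5⟩,
  ⟨193, 4, 215, 4⟩, ⟨8, 8, 232, 24⟩, ⟨34, 34, 226, 8⟩, ⟨244, 244, 247, 24⟩, ⟨65, 37, 245, 8⟩,
  ⟨19, 163, 243, 16⟩, ⟨84, 66, 119, 24⟩, ⟨25, 20, 31, 8⟩, ⟨240, 11, 251, 6⟩, ⟨67, 32, 235, 16⟩,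
  ⟨27, 43, 63, 4⟩, ⟨72, 66, 75, 16⟩, ⟨49, 129, 245, 8⟩, ⟨81, 20, 255, 8⟩, ⟨139, 139, 143, 8⟩,
  ⟨0, 0, 52, 8⟩, ⟨201, 196, 207, 4⟩, ⟨235, 235, 239, 12⟩, ⟨219, 15, 223, 4⟩, ⟨116, 77, 127, 8⟩,
  ⟨75, 59, 251, 4⟩, ⟨9, 9, 233, 4⟩, ⟨203, 203, 207, 4⟩, ⟨64, 20, 255, 8⟩, ⟨89, 41, 253, 8⟩,
  ⟨73, 57, 253, 12⟩, ⟨89, 105, 125, 4⟩, ⟨201, 4, 255, 8⟩, ⟨56, 50, 59, 4⟩, ⟨7, 224, 231, 3⟩,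
  ⟨56, 56, 248, 8⟩, ⟨24, 22, 255, 4⟩, ⟨11, 11, 63, 4⟩, ⟨24, 34, 251, 4⟩, ⟨217, 233, 249, 2⟩]

theorem certifies_abc_abd_cef_egh_fgh :
    certifies [3, 3, 4, 2, 4, 4, 4, 4] [7, 11, 52, 208, 224] 8
      (symmetrize [[(0, 1)], [(4, 5)], [(6, 7)]] cuts_abc_abd_cef_egh_fgh) := by
  decide +kernel

theorem not_rare_abc_abd_cef_egh_fgh {F : Finset (Finset ℕ)} (hF : UC F)
    {a b c d e f g h : ℕ} (hl : [a, b, c, d, e, f, g, h].Nodup)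
    (h1 : Rare F {a, b, c}) (h2 : Rare F {a, b, d}) (h3 : Rare F {c, e, f}) (h4 : Rare F {e, g, h})
    (h5 : Rare F {f, g, h}) : False :=
  not_rare_of_certifies certifies_abc_abd_cef_egh_fgh (by norm_num) (by norm_num) hF hl rfl
    (by simp [maskSet]) (by simp [maskSet, h1, h2, h3, h4, h5])

/-- Cuts for the configuration `abc, abd, cef, egh, fgi`. -/
def cuts_abc_abd_cef_egh_fgi : List Cut := [
  ⟨465, 5, 501, 339822⟩, ⟨456, 456, 463, 142160⟩, ⟨448, 448, 455, 142160⟩,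
  ⟨416, 416, 423, 153346⟩, ⟨401, 389, 437, 98568⟩, ⟨395, 395, 447, 113719⟩,
  ⟨394, 394, 446, 341184⟩, ⟨386, 386, 438, 328164⟩, ⟨153, 281, 505, 284310⟩, ⟨153, 265, 505, 10⟩,
  ⟨392, 392, 444, 111586⟩, ⟨384, 384, 436, 254368⟩, ⟨384, 384, 391, 65497⟩,
  ⟨353, 353, 373, 113728⟩, ⟨352, 352, 372, 130912⟩, ⟨344, 344, 351, 227456⟩,
  ⟨506, 506, 510, 52287⟩, ⟨436, 391, 439, 122361⟩, ⟨427, 427, 431, 245474⟩,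
  ⟨409, 425, 445, 170592⟩, ⟨409, 41, 509, 56864⟩, ⟨258, 258, 466, 443476⟩,
  ⟨266, 266, 318, 645216⟩, ⟨172, 162, 175, 113728⟩, ⟨360, 360, 367, 297366⟩,
  ⟨296, 296, 303, 154370⟩, ⟨288, 288, 295, 255280⟩, ⟨272, 272, 279, 170592⟩,
  ⟨269, 269, 477, 288116⟩, ⟨268, 268, 476, 284320⟩, ⟨267, 267, 319, 52152⟩,
  ⟨264, 264, 316, 170592⟩, ⟨263, 263, 311, 454912⟩, ⟨8, 8, 360, 212070⟩, ⟨224, 132, 487, 54432⟩,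
  ⟨223, 43, 255, 66990⟩, ⟨323, 323, 467, 170592⟩, ⟨11, 216, 219, 85296⟩, ⟨336, 336, 343, 398048⟩,
  ⟨290, 290, 310, 395908⟩, ⟨69, 37, 357, 310320⟩, ⟨32, 32, 240, 204164⟩, ⟨424, 424, 427, 296258⟩,
  ⟨144, 144, 180, 11794⟩, ⟨120, 75, 127, 28432⟩, ⟨340, 340, 351, 12426⟩, ⟨98, 98, 242, 28644⟩,
  ⟨96, 96, 103, 173024⟩, ⟨89, 13, 253, 82434⟩, ⟨1, 1, 53, 709164⟩, ⟨74, 74, 126, 259600⟩,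
  ⟨71, 71, 119, 255888⟩, ⟨68, 66, 79, 82864⟩, ⟨66, 66, 118, 310532⟩, ⟨50, 50, 370, 47558⟩,
  ⟨48, 48, 59, 11646⟩, ⟨42, 42, 250, 583810⟩, ⟨35, 35, 243, 284320⟩, ⟨46, 46, 366, 227456⟩,
  ⟨198, 198, 486, 113728⟩, ⟨64, 64, 71, 227456⟩, ⟨262, 262, 470, 285178⟩, ⟨14, 14, 366, 315614⟩,
  ⟨57, 73, 253, 195312⟩, ⟨78, 78, 366, 25570⟩, ⟨88, 82, 95, 284320⟩, ⟨79, 79, 127, 196592⟩,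
  ⟨54, 54, 374, 595436⟩, ⟨240, 43, 251, 147300⟩, ⟨56, 33, 251, 160312⟩, ⟨16, 32, 244, 125374⟩,
  ⟨80, 256, 372, 225024⟩, ⟨51, 51, 243, 113728⟩, ⟨0, 0, 208, 17980⟩, ⟨204, 194, 207, 394252⟩,
  ⟨334, 334, 478, 539274⟩, ⟨192, 36, 500, 181180⟩, ⟨7, 7, 359, 283524⟩, ⟨500, 55, 503, 184808⟩,
  ⟨28, 28, 220, 113728⟩, ⟨152, 264, 508, 243678⟩, ⟨147, 291, 499, 56864⟩, ⟨163, 67, 499, 113728⟩,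
  ⟨137, 105, 253, 378326⟩, ⟨260, 260, 468, 98914⟩, ⟨65, 49, 501, 59084⟩, ⟨388, 388, 391, 85296⟩,
  ⟨176, 131, 191, 170592⟩, ⟨10, 10, 362, 415022⟩, ⟨156, 130, 191, 264618⟩, ⟨0, 0, 7, 436932⟩,
  ⟨208, 6, 215, 114524⟩, ⟨160, 272, 511, 61434⟩, ⟨225, 140, 495, 73724⟩, ⟨217, 361, 509, 220659⟩,
  ⟨10, 10, 62, 267346⟩, ⟨40, 40, 47, 49778⟩, ⟨432, 387, 447, 51281⟩, ⟨449, 324, 471, 170592⟩,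
  ⟨17, 4, 55, 171526⟩, ⟨244, 7, 247, 140126⟩, ⟨312, 312, 315, 113728⟩, ⟨267, 267, 475, 53068⟩,
  ⟨203, 168, 491, 288116⟩, ⟨40, 40, 248, 113728⟩, ⟨256, 256, 263, 341184⟩,
  ⟨256, 256, 308, 101934⟩, ⟨453, 264, 479, 56864⟩, ⟨100, 100, 103, 54432⟩, ⟨128, 256, 507, 35545⟩,
  ⟨408, 388, 447, 56864⟩, ⟨15, 15, 63, 106642⟩, ⟨33, 33, 241, 577986⟩, ⟨72, 72, 124, 113728⟩,
  ⟨67, 48, 247, 56864⟩, ⟨233, 12, 255, 280820⟩, ⟨57, 297, 381, 142678⟩, ⟨133, 97, 501, 110730⟩,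
  ⟨129, 101, 245, 256454⟩, ⟨168, 280, 504, 26534⟩, ⟨440, 440, 443, 57108⟩, ⟨200, 76, 223, 82434⟩,
  ⟨3, 3, 355, 113728⟩, ⟨161, 273, 497, 198772⟩, ⟨171, 171, 175, 113728⟩, ⟨24, 40, 504, 158488⟩,
  ⟨330, 330, 474, 423618⟩, ⟨106, 106, 126, 138448⟩, ⟨131, 259, 499, 56864⟩,
  ⟨280, 280, 283, 56864⟩, ⟨452, 452, 463, 28432⟩, ⟨448, 448, 459, 28432⟩, ⟨155, 148, 159, 20132⟩,
  ⟨385, 276, 471, 69884⟩, ⟨145, 261, 501, 172732⟩, ⟨48, 3, 247, 170592⟩, ⟨225, 68, 247, 87728⟩,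
  ⟨16, 160, 496, 113728⟩, ⟨153, 140, 191, 24414⟩, ⟨169, 301, 509, 170602⟩,
  ⟨335, 335, 479, 223660⟩, ⟨304, 304, 315, 113728⟩, ⟨473, 340, 479, 82434⟩, ⟨36, 36, 356, 159056⟩,
  ⟨84, 66, 127, 59296⟩, ⟨258, 258, 310, 172732⟩, ⟨8, 148, 255, 150460⟩, ⟨249, 61, 253, 96754⟩,
  ⟨397, 41, 509, 155422⟩, ⟨64, 64, 116, 56864⟩, ⟨320, 320, 327, 330596⟩, ⟨392, 59, 507, 123550⟩,
  ⟨97, 97, 117, 30652⟩, ⟨122, 122, 378, 81584⟩, ⟨504, 114, 507, 2220⟩, ⟨112, 11, 511, 113728⟩,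
  ⟨193, 44, 511, 116590⟩, ⟨136, 108, 252, 199024⟩, ⟨164, 271, 511, 100708⟩,
  ⟨144, 260, 500, 187838⟩, ⟨83, 32, 503, 56864⟩, ⟨139, 267, 507, 70127⟩, ⟨328, 328, 331, 174388⟩,
  ⟨420, 420, 423, 187838⟩, ⟨457, 260, 479, 113728⟩, ⟨141, 269, 509, 83398⟩, ⟨72, 38, 255, 145022⟩,
  ⟨75, 75, 79, 113728⟩, ⟨72, 44, 252, 54002⟩, ⟨201, 77, 253, 145022⟩, ⟨7, 7, 55, 155442⟩,
  ⟨236, 233, 239, 97506⟩, ⟨200, 104, 252, 56864⟩, ⟨504, 504, 508, 40642⟩, ⟨259, 259, 467, 113728⟩,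
  ⟨155, 299, 507, 18366⟩, ⟨56, 56, 59, 140336⟩, ⟨347, 347, 351, 117524⟩, ⟨151, 271, 511, 51866⟩,
  ⟨464, 464, 471, 56864⟩, ⟨401, 396, 447, 119320⟩, ⟨267, 267, 271, 95710⟩, ⟨64, 48, 247, 56864⟩,
  ⟨185, 52, 255, 28950⟩, ⟨241, 369, 497, 99638⟩, ⟨68, 68, 116, 28432⟩, ⟨161, 37, 245, 57368⟩,
  ⟨400, 387, 439, 62447⟩, ⟨278, 278, 470, 57368⟩, ⟨387, 51, 499, 56864⟩, ⟨395, 395, 399, 41704⟩,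
  ⟨322, 322, 466, 123802⟩, ⟨200, 4, 223, 141226⟩, ⟨76, 40, 252, 88158⟩, ⟨324, 324, 468, 56864⟩,
  ⟨327, 327, 471, 216868⟩, ⟨228, 356, 500, 71678⟩, ⟨434, 434, 438, 28180⟩, ⟨193, 160, 495, 47724⟩,
  ⟨400, 11, 507, 56864⟩, ⟨400, 27, 507, 6080⟩, ⟨408, 424, 444, 59006⟩, ⟨295, 295, 303, 32822⟩,
  ⟨49, 8, 63, 63950⟩, ⟨212, 2, 247, 30068⟩, ⟨106, 106, 362, 26296⟩, ⟨392, 390, 399, 15160⟩,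
  ⟨392, 268, 479, 5592⟩, ⟨401, 268, 479, 9568⟩, ⟨432, 432, 436, 10153⟩, ⟨228, 136, 495, 12210⟩,
  ⟨27, 15, 511, 7086⟩, ⟨153, 60, 511, 3500⟩, ⟨12, 12, 60, 3500⟩, ⟨20, 36, 52, 259⟩,
  ⟨302, 302, 318, 4702⟩, ⟨403, 416, 439, 5583⟩, ⟨356, 356, 367, 446⟩, ⟨140, 20, 223, 430⟩,
  ⟨81, 5, 245, 566⟩]

theorem certifies_abc_abd_cef_egh_fgi :
    certifies [3, 3, 5, 1, 5, 5, 4, 3, 3] [7, 11, 52, 208, 352] 56864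
      (symmetrize [[(0, 1)], [(4, 5), (7, 8)]] cuts_abc_abd_cef_egh_fgi) := by
  decide +kernel

theorem not_rare_abc_abd_cef_egh_fgi {F : Finset (Finset ℕ)} (hF : UC F)
    {a b c d e f g h i : ℕ} (hl : [a, b, c, d, e, f, g, h, i].Nodup)
    (h1 : Rare F {a, b, c}) (h2 : Rare F {a, b, d}) (h3 : Rare F {c, e, f}) (h4 : Rare F {e, g, h})
    (h5 : Rare F {f, g, i}) : False :=
  not_rare_of_certifies certifies_abc_abd_cef_egh_fgi (by norm_num) (by norm_num) hF hl rfl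
    (by simp [maskSet]) (by simp [maskSet, h1, h2, h3, h4, h5])

/-- Cuts for the configuration `abc, abd, cef, egh, fij`. -/
def cuts_abc_abd_cef_egh_fij : List Cut := [
  ⟨976, 773, 983, 2⟩, ⟨976, 770, 983, 64⟩, ⟨988, 770, 991, 30⟩, ⟨969, 964, 975, 4⟩,
  ⟨961, 5, 1013, 4⟩, ⟨930, 930, 950, 142⟩, ⟨864, 864, 871, 222⟩, ⟨809, 809, 829, 144⟩,
  ⟨800, 800, 807, 51⟩, ⟨782, 782, 990, 114⟩, ⟨780, 780, 988, 40⟩, ⟨768, 768, 976, 58⟩,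
  ⟨672, 672, 679, 128⟩, ⟨650, 650, 702, 256⟩, ⟨648, 648, 700, 96⟩, ⟨647, 647, 695, 176⟩,
  ⟨642, 642, 694, 256⟩, ⟨935, 935, 951, 94⟩, ⟨884, 884, 887, 16⟩, ⟨848, 848, 855, 112⟩,
  ⟨640, 640, 647, 128⟩, ⟨554, 554, 762, 160⟩, ⟨552, 552, 760, 64⟩, ⟨547, 547, 755, 136⟩,
  ⟨544, 544, 551, 46⟩, ⟨528, 528, 535, 32⟩, ⟨524, 524, 732, 64⟩, ⟨523, 523, 575, 64⟩,
  ⟨0, 0, 52, 76⟩, ⟨40, 40, 248, 8⟩, ⟨7, 7, 55, 28⟩, ⟨1, 1, 53, 128⟩, ⟨522, 522, 574, 466⟩,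
  ⟨53, 8, 63, 34⟩, ⟨574, 574, 766, 276⟩, ⟨518, 518, 726, 32⟩, ⟨514, 514, 722, 110⟩,
  ⟨771, 771, 979, 45⟩, ⟨457, 233, 1001, 62⟩, ⟨201, 13, 1021, 64⟩, ⟨10, 10, 810, 112⟩,
  ⟨28, 18, 31, 10⟩, ⟨907, 907, 911, 48⟩, ⟨42, 42, 250, 16⟩, ⟨260, 260, 468, 32⟩,
  ⟨963, 963, 967, 4⟩, ⟨448, 32, 1008, 48⟩, ⟨683, 683, 687, 96⟩, ⟨512, 512, 564, 96⟩,
  ⟨72, 65, 75, 146⟩, ⟨776, 776, 984, 10⟩, ⟨960, 960, 967, 20⟩, ⟨128, 128, 135, 2⟩,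
  ⟨35, 35, 243, 56⟩, ⟨4, 4, 804, 34⟩, ⟨52, 52, 820, 56⟩, ⟨512, 512, 720, 158⟩, ⟨71, 116, 119, 64⟩,
  ⟨515, 515, 723, 92⟩, ⟨75, 27, 1019, 30⟩, ⟨212, 776, 1023, 42⟩, ⟨236, 226, 239, 34⟩,
  ⟨784, 784, 791, 51⟩, ⟨779, 779, 987, 46⟩, ⟨55, 807, 823, 8⟩, ⟨52, 807, 823, 2⟩,
  ⟨3, 820, 823, 32⟩, ⟨1008, 52, 1012, 22⟩, ⟨453, 229, 997, 18⟩, ⟨640, 640, 692, 80⟩,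
  ⟨544, 544, 752, 32⟩, ⟨460, 450, 463, 28⟩, ⟨546, 546, 754, 160⟩, ⟨451, 227, 1003, 8⟩,
  ⟨555, 555, 559, 44⟩, ⟨6, 6, 806, 76⟩, ⟨12, 12, 812, 8⟩, ⟨514, 514, 566, 160⟩,
  ⟨333, 285, 477, 114⟩, ⟨527, 527, 735, 180⟩, ⟨467, 243, 1011, 28⟩, ⟨345, 361, 381, 64⟩,
  ⟨448, 292, 500, 64⟩, ⟨327, 331, 335, 32⟩, ⟨337, 97, 885, 64⟩, ⟨208, 11, 219, 4⟩,
  ⟨520, 520, 572, 16⟩, ⟨331, 283, 511, 48⟩, ⟨323, 283, 511, 16⟩, ⟨99, 51, 243, 4⟩,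
  ⟨272, 272, 283, 58⟩, ⟨328, 326, 383, 64⟩, ⟨54, 54, 822, 78⟩, ⟨456, 300, 508, 60⟩,
  ⟨1008, 1008, 1015, 6⟩, ⟨208, 807, 1015, 1⟩, ⟨247, 820, 1015, 30⟩, ⟨209, 801, 1009, 32⟩,
  ⟨449, 260, 503, 32⟩, ⟨451, 32, 1019, 26⟩, ⟨80, 67, 887, 68⟩, ⟨80, 3, 247, 4⟩,
  ⟨461, 41, 1021, 14⟩, ⟨201, 45, 253, 30⟩, ⟨88, 76, 124, 48⟩, ⟨63, 63, 831, 10⟩,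
  ⟨969, 772, 991, 12⟩, ⟨659, 659, 663, 32⟩, ⟨484, 490, 495, 96⟩, ⟨943, 943, 959, 20⟩,
  ⟨211, 803, 1011, 8⟩, ⟨232, 226, 235, 30⟩, ⟨449, 33, 1013, 108⟩, ⟨105, 100, 111, 64⟩,
  ⟨325, 277, 469, 128⟩, ⟨231, 235, 239, 11⟩, ⟨24, 40, 60, 12⟩, ⟨120, 114, 123, 48⟩,
  ⟨467, 267, 475, 32⟩, ⟨3, 3, 803, 8⟩, ⟨453, 289, 501, 28⟩, ⟨960, 960, 971, 8⟩,
  ⟨463, 47, 1023, 30⟩, ⟨97, 68, 127, 96⟩, ⟨452, 228, 996, 54⟩, ⟨456, 454, 463, 18⟩,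
  ⟨34, 34, 242, 32⟩, ⟨344, 338, 347, 144⟩, ⟨15, 15, 815, 56⟩, ⟨347, 123, 891, 26⟩,
  ⟨336, 123, 891, 16⟩, ⟨347, 112, 891, 54⟩, ⟨336, 112, 891, 10⟩, ⟨77, 29, 221, 12⟩,
  ⟨971, 967, 975, 4⟩, ⟨324, 322, 327, 64⟩, ⟨99, 16, 247, 30⟩, ⟨87, 835, 887, 14⟩,
  ⟨774, 774, 982, 62⟩, ⟨193, 37, 245, 50⟩, ⟨11, 11, 15, 36⟩, ⟨523, 523, 527, 148⟩,
  ⟨108, 98, 111, 48⟩, ⟨232, 12, 1020, 10⟩, ⟨488, 482, 491, 82⟩, ⟨481, 261, 501, 58⟩,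
  ⟨457, 41, 1017, 98⟩, ⟨972, 962, 975, 16⟩, ⟨456, 40, 1016, 50⟩, ⟨192, 36, 244, 46⟩,
  ⟨923, 923, 927, 34⟩, ⟨104, 88, 892, 16⟩, ⟨896, 896, 903, 32⟩, ⟨201, 4, 255, 18⟩,
  ⟨39, 39, 47, 18⟩, ⟨977, 772, 991, 32⟩, ⟨980, 770, 991, 14⟩, ⟨335, 287, 511, 48⟩,
  ⟨775, 775, 783, 8⟩, ⟨1016, 1016, 1020, 22⟩, ⟨105, 57, 249, 48⟩, ⟨771, 771, 779, 6⟩,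
  ⟨332, 280, 508, 80⟩, ⟨333, 281, 509, 14⟩, ⟨105, 77, 125, 34⟩, ⟨56, 49, 59, 32⟩,
  ⟨522, 522, 730, 32⟩, ⟨97, 81, 885, 16⟩, ⟨368, 323, 383, 96⟩, ⟨24, 12, 252, 6⟩,
  ⟨216, 214, 255, 68⟩, ⟨200, 44, 252, 36⟩, ⟨345, 340, 351, 32⟩, ⟨8, 8, 60, 6⟩,
  ⟨489, 269, 509, 114⟩, ⟨107, 48, 251, 28⟩, ⟨452, 288, 500, 10⟩, ⟨345, 324, 383, 48⟩,
  ⟨8, 8, 808, 28⟩, ⟨60, 60, 828, 14⟩, ⟨344, 360, 380, 16⟩, ⟨449, 293, 501, 56⟩,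
  ⟨771, 771, 775, 5⟩, ⟨472, 262, 511, 110⟩, ⟨1017, 829, 1021, 16⟩, ⟨1018, 1018, 1022, 2⟩,
  ⟨99, 59, 251, 28⟩, ⟨336, 96, 884, 70⟩, ⟨199, 995, 999, 5⟩, ⟨520, 520, 728, 62⟩,
  ⟨221, 777, 1021, 16⟩, ⟨968, 12, 1020, 20⟩, ⟨896, 896, 907, 16⟩, ⟨104, 76, 892, 16⟩,
  ⟨69, 21, 213, 24⟩, ⟨451, 235, 1007, 16⟩, ⟨345, 121, 889, 64⟩, ⟨947, 947, 955, 36⟩,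
  ⟨328, 280, 472, 16⟩, ⟨92, 82, 95, 20⟩, ⟨11, 11, 63, 4⟩, ⟨348, 338, 351, 48⟩, ⟨784, 784, 795, 5⟩,
  ⟨240, 3, 255, 8⟩, ⟨371, 299, 507, 16⟩, ⟨115, 91, 891, 2⟩, ⟨961, 772, 983, 12⟩, ⟨20, 18, 23, 10⟩,
  ⟨1019, 1019, 1023, 4⟩, ⟨984, 770, 987, 2⟩, ⟨43, 43, 47, 10⟩, ⟨460, 236, 1004, 4⟩,
  ⟨508, 502, 511, 12⟩, ⟨62, 62, 830, 2⟩, ⟨531, 531, 539, 2⟩, ⟨483, 263, 511, 2⟩]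

theorem certifies_abc_abd_cef_egh_fij :
    certifies [3, 3, 6, 2, 6, 6, 3, 3, 3, 3] [7, 11, 52, 208, 800] 32
      (symmetrize [[(0, 1)], [(6, 7)], [(8, 9)], [(4, 5), (6, 8), (7, 9)]]
        cuts_abc_abd_cef_egh_fij) := by
  decide +kernel

theorem not_rare_abc_abd_cef_egh_fij {F : Finset (Finset ℕ)} (hF : UC F)
    {a b c d e f g h i j : ℕ} (hl : [a, b, c, d, e, f, g, h, i, j].Nodup)
    (h1 : Rare F {a, b, c}) (h2 : Rare F {a, b, d}) (h3 : Rare F {c, e, f}) (h4 : Rare F {e, g, h})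
    (h5 : Rare F {f, i, j}) : False :=
  not_rare_of_certifies certifies_abc_abd_cef_egh_fij (by norm_num) (by norm_num) hF hl rfl
    (by simp [maskSet]) (by simp [maskSet, h1, h2, h3, h4, h5])

/-! ### Completing the configuration `abc, abd, cef` -/

section

variable {F : Finset (Finset ℕ)} {a b c d e f x y z : ℕ}

theorem exists_eq_triple_of_mem {A : Finset ℕ} (hA : A.card = 3) (hx : x ∈ A) :
    ∃ y z, x ≠ y ∧ x ≠ z ∧ y ≠ z ∧ A = {x, y, z} := by
  obtain ⟨y, z, hyz, h⟩ := Finset.card_eq_two.1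
    (show (A.erase x).card = 2 by rw [Finset.card_erase_of_mem hx, hA])
  have hA' : A = {x, y, z} := by rw [← h, Finset.insert_erase hx]
  have hy : y ∈ A.erase x := by simp [h]
  have hz : z ∈ A.erase x := by simp [h]
  exact ⟨y, z, (Finset.ne_of_mem_erase hy).symm, (Finset.ne_of_mem_erase hz).symm, hyz, hA'⟩

theorem Rare.swap (h : Rare F {x, y, z}) : Rare F {y, x, z} := by
  rwa [Finset.insert_comm]

theorem Rare.swap_right (h : Rare F {x, y, z}) : Rare F {x, z, y} := by
  rwa [Finset.pair_comm]

theorem not_rare_abc_abd_ady (hF : UC F) (hl : [a, b, c, d].Nodup)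
    (h1 : Rare F {a, b, c}) (h2 : Rare F {a, b, d}) (hy : y ∉ [a, b, d])
    (h : Rare F {d, a, y}) : False := by
  by_cases hc : y = c
  · subst hc
    exact not_rare_abc_abd_acd hF hl h1 h2 h.swap.swap_right
  · exact not_rare_abc_abd_ade hF (by grind) h1 h2 h.swap

theorem not_rare_abc_abd_cef_dey (hF : UC F) (hl : [a, b, c, d, e, f].Nodup)
    (h1 : Rare F {a, b, c}) (h2 : Rare F {a, b, d}) (h3 : Rare F {c, e, f})
    (hy : y ∉ [a, b, c, d, e]) (h : Rare F {d, e, y}) : False := by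
  by_cases hf : y = f
  · subst hf
    exact not_rare_abc_abd_cef_def hF hl h1 h2 h3 h
  · exact not_rare_abc_abd_cef_deg hF (by grind) h1 h2 h3 h

/-- The only rare 3-set through `d` is `abd`. -/
theorem eq_of_rare_of_mem (hF : UC F) (hl : [a, b, c, d, e, f].Nodup)
    (h1 : Rare F {a, b, c}) (h2 : Rare F {a, b, d}) (h3 : Rare F {c, e, f}) {A : Finset ℕ}
    (hA : A.card = 3) (hd : d ∈ A) (h : Rare F A) : A = {a, b, d} := by
  obtain ⟨y, z, hdy, hdz, hyz, rfl⟩ := exists_eq_triple_of_mem hA hd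
  have h1' := h1.swap
  have h2' := h2.swap
  have h3' := h3.swap_right
  have h' := h.swap_right
  by_contra hne
  have hne' : ¬ ((y = a ∧ z = b) ∨ (y = b ∧ z = a)) := by
    rintro (⟨rfl, rfl⟩ | ⟨rfl, rfl⟩) <;> exact hne (by ext; simp; tauto)
  have key_a : ∀ y z, d ≠ z → y ≠ z → ¬ (y = a ∧ z = b) → Rare F {d, y, z} → y ≠ a := by
    rintro y z hdz hyz hne h rfl
    exact not_rare_abc_abd_ady hF (by grind) h1 h2 (by grind) h
  have key_b : ∀ y z, d ≠ z → y ≠ z → ¬ (y = b ∧ z = a) → Rare F {d, y, z} → y ≠ b := by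
    rintro y z hdz hyz hne h rfl
    exact not_rare_abc_abd_ady hF (by grind) h1' h2' (by grind) h
  have hya := key_a y z hdz hyz (by tauto) h
  have hza := key_a z y hdy hyz.symm (by tauto) h'
  have hyb := key_b y z hdz hyz (by tauto) h
  have hzb := key_b z y hdy hyz.symm (by tauto) h'
  have key_c : ∀ z, d ≠ z → c ≠ z → z ≠ a → z ≠ b → ¬ Rare F {d, c, z} := fun z h4 h5 h6 h7 h =>
    not_rare_abc_abd_cde hF (by grind) h1 h2 h.swap
  have hyc : y ≠ c := by
    rintro rfl
    exact key_c z hdz hyz hza hzb h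
  have hzc : z ≠ c := by
    rintro rfl
    exact key_c y hdy hyz.symm hya hyb h'
  have hye : y ≠ e := by
    rintro rfl
    exact not_rare_abc_abd_cef_dey hF hl h1 h2 h3 (by grind) h
  have hze : z ≠ e := by
    rintro rfl
    exact not_rare_abc_abd_cef_dey hF hl h1 h2 h3 (by grind) h'
  have hyf : y ≠ f := by
    rintro rfl
    exact not_rare_abc_abd_cef_dey hF (by grind) h1 h2 h3' (by grind) h
  have hzf : z ≠ f := by
    rintro rfl
    exact not_rare_abc_abd_cef_dey hF (by grind) h1 h2 h3' (by grind) h'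
  exact not_rare_abc_abd_cef_dgh hF (by grind) h1 h2 h3 h

theorem not_rare_abc_abd_cef_eay (hF : UC F) (hl : [a, b, c, d, e, f].Nodup)
    (h1 : Rare F {a, b, c}) (h2 : Rare F {a, b, d}) (h3 : Rare F {c, e, f})
    (hy : y ∉ [a, d, e]) (h : Rare F {e, a, y}) : False := by
  by_cases hb : y = b
  · subst hb
    exact not_rare_abc_abd_abe hF (by grind) h1 h2 h.swap.swap_right
  by_cases hc : y = c
  · subst hc
    exact not_rare_abc_abd_ade hF (by grind) h2 h1 h.swap.swap_right
  by_cases hf : y = f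
  · subst hf
    exact not_rare_abc_abd_cef_aef hF hl h1 h2 h3 h.swap
  · exact not_rare_abc_abd_cef_aeg hF (by grind) h1 h2 h3 h.swap

/-- A rare 3-set through `e` other than `cef` that misses `d` has no further element in common with
`abc, abd, cef`. -/
theorem exists_eq_triple_of_rare_of_mem (hF : UC F) (hl : [a, b, c, d, e, f].Nodup)
    (h1 : Rare F {a, b, c}) (h2 : Rare F {a, b, d}) (h3 : Rare F {c, e, f}) {A : Finset ℕ}
    (hA : A.card = 3) (he : e ∈ A) (hd : d ∉ A) (hne : A ≠ {c, e, f}) (h : Rare F A) :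
    ∃ y z, [a, b, c, d, e, f, y, z].Nodup ∧ Rare F {e, y, z} := by
  obtain ⟨y, z, hey, hez, hyz, rfl⟩ := exists_eq_triple_of_mem hA he
  have h1' := h1.swap
  have h2' := h2.swap
  have h' := h.swap_right
  have hdy : y ≠ d := by rintro rfl; simp at hd
  have hdz : z ≠ d := by rintro rfl; simp at hd
  have hne' : ¬ ((y = c ∧ z = f) ∨ (y = f ∧ z = c)) := by
    rintro (⟨rfl, rfl⟩ | ⟨rfl, rfl⟩) <;> exact hne (by ext; simp; tauto)
  have hya : y ≠ a := by
    rintro rfl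
    exact not_rare_abc_abd_cef_eay hF hl h1 h2 h3 (by grind) h
  have hza : z ≠ a := by
    rintro rfl
    exact not_rare_abc_abd_cef_eay hF hl h1 h2 h3 (by grind) h'
  have hyb : y ≠ b := by
    rintro rfl
    exact not_rare_abc_abd_cef_eay hF (by grind) h1' h2' h3 (by grind) h
  have hzb : z ≠ b := by
    rintro rfl
    exact not_rare_abc_abd_cef_eay hF (by grind) h1' h2' h3 (by grind) h'
  have hyc : y ≠ c := by
    rintro rfl
    exact not_rare_abc_abd_cef_ceg hF (by grind) h1 h2 h3 h.swap
  have hzc : z ≠ c := by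
    rintro rfl
    exact not_rare_abc_abd_cef_ceg hF (by grind) h1 h2 h3 h'.swap
  have hyf : y ≠ f := by
    rintro rfl
    exact not_rare_abc_abd_cef_efg hF (by grind) h1 h2 h3 h
  have hzf : z ≠ f := by
    rintro rfl
    exact not_rare_abc_abd_cef_efg hF (by grind) h1 h2 h3 h'
  exact ⟨y, z, by grind, h⟩

theorem not_rare_of_mem_of_mem (hF : UC F) (hl : [a, b, c, d, e, f].Nodup)
    (h1 : Rare F {a, b, c}) (h2 : Rare F {a, b, d}) (h3 : Rare F {c, e, f}) {A B : Finset ℕ}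
    (hA : A.card = 3) (heA : e ∈ A) (hdA : d ∉ A) (hneA : A ≠ {c, e, f}) (hrA : Rare F A)
    (hB : B.card = 3) (hfB : f ∈ B) (hdB : d ∉ B) (hneB : B ≠ {c, e, f}) (hrB : Rare F B) :
    False := by
  obtain ⟨g, h, hgh, h4⟩ := exists_eq_triple_of_rare_of_mem hF hl h1 h2 h3 hA heA hdA hneA hrA
  obtain ⟨i, j, hij, h5⟩ := exists_eq_triple_of_rare_of_mem hF (by grind) h1 h2 h3.swap_right hB hfB
    hdB (by rwa [Finset.pair_comm f e]) hrB
  have h4' := h4.swap_right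
  have h5' := h5.swap_right
  by_cases hig : i = g
  · subst hig
    by_cases hjh : j = h
    · subst hjh
      exact not_rare_abc_abd_cef_egh_fgh hF hgh h1 h2 h3 h4 h5
    · exact not_rare_abc_abd_cef_egh_fgi hF
        (by grind (gen := 30) only [= List.nodup_cons, = List.mem_cons, List.not_mem_nil,
          List.nodup_nil])
        h1 h2 h3 h4 h5
  by_cases hih : i = h
  · subst hih
    by_cases hjg : j = g
    · subst hjg
      exact not_rare_abc_abd_cef_egh_fgh hF hgh h1 h2 h3 h4 h5'
    · exact not_rare_abc_abd_cef_egh_fgi hF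
        (by grind (gen := 30) only [= List.nodup_cons, = List.mem_cons, List.not_mem_nil,
          List.nodup_nil])
        h1 h2 h3 h4' h5
  by_cases hjg : j = g
  · subst hjg
    exact not_rare_abc_abd_cef_egh_fgi hF
        (by grind (gen := 30) only [= List.nodup_cons, = List.mem_cons, List.not_mem_nil,
          List.nodup_nil])
        h1 h2 h3 h4 h5'
  by_cases hjh : j = h
  · subst hjh
    exact not_rare_abc_abd_cef_egh_fgi hF
        (by grind (gen := 30) only [= List.nodup_cons, = List.mem_cons, List.not_mem_nil,
          List.nodup_nil])
        h1 h2 h3 h4' h5'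
  exact not_rare_abc_abd_cef_egh_fij hF
        (by grind (gen := 30) only [= List.nodup_cons, = List.mem_cons, List.not_mem_nil,
          List.nodup_nil])
        h1 h2 h3 h4 h5

end

theorem rare_of_mem_of_gen_subset {F T : Finset (Finset ℕ)} (hT : gen T ⊆ F)
    (hlow : ∀ i ∈ famU (gen T), 2 * (memFam F i).card < F.card) {A : Finset ℕ} (hA : A ∈ T) :
    Rare F A := by
  have hgen : A ∈ gen T := by
    simp only [gen, Finset.mem_image, Finset.mem_filter, Finset.mem_powerset]
    exact ⟨{A}, by simpa using hA, by simp⟩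
  exact ⟨hT hgen, fun x hx => hlow x (Finset.mem_sup.2 ⟨A, hgen, hx⟩)⟩

theorem exists_ne_of_card_memFam_ne_one {T : Finset (Finset ℕ)} {i : ℕ}
    (h : (memFam T i).card ≠ 1) {B : Finset ℕ} (hB : B ∈ T) (hi : i ∈ B) :
    ∃ A ∈ T, i ∈ A ∧ A ≠ B := by
  by_contra! hall
  refine h (Finset.card_eq_one.2 ⟨B, ?_⟩)
  ext A
  simp only [memFam, Finset.mem_filter, Finset.mem_singleton]
  exact ⟨fun hA => hall A hA.1 hA.2, by rintro rfl; exact ⟨hB, hi⟩⟩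

theorem nonfc_with_I_counts (S : Finset (Finset ℕ))
    (h3 : ∀ A ∈ S, A.card = 3) (hpos : ∀ A ∈ S, ∀ x ∈ A, 0 < x)
    (T : Finset (Finset ℕ))
    (hT : T = S ∪ ({{1,2,3},{1,2,4},{3,5,6}} : Finset (Finset ℕ)))
    (hnfc : NonFC (gen T)) :
    (memFam T 4).card = 1 ∧ ((memFam T 5).card = 1 ∨ (memFam T 6).card = 1) := by
  obtain ⟨F, hF, hTF, hlow⟩ := hnfc
  have hrare : ∀ A ∈ T, Rare F A := fun A hA => rare_of_mem_of_gen_subset hTF hlow hA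
  have hcard : ∀ A ∈ T, A.card = 3 := by
    intro A hA
    rw [hT, Finset.mem_union] at hA
    rcases hA with hA | hA
    · exact h3 A hA
    · simp only [Finset.mem_insert, Finset.mem_singleton] at hA
      rcases hA with rfl | rfl | rfl <;> rfl
  have m1 : {1, 2, 3} ∈ T := by simp [hT]
  have m2 : {1, 2, 4} ∈ T := by simp [hT]
  have m3 : {3, 5, 6} ∈ T := by simp [hT]
  have hl : [1, 2, 3, 4, 5, 6].Nodup := by decide
  have h4 : ∀ A ∈ T, 4 ∈ A → A = {1, 2, 4} := fun A hA hd =>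
    eq_of_rare_of_mem hF hl (hrare _ m1) (hrare _ m2) (hrare _ m3) (hcard A hA) hd (hrare A hA)
  refine ⟨by_contra fun h => ?_, by_contra fun h => ?_⟩
  · obtain ⟨A, hA, hd, hne⟩ := exists_ne_of_card_memFam_ne_one h m2 (by simp)
    exact hne (h4 A hA hd)
  · rw [not_or] at h
    obtain ⟨A, hA, heA, hneA⟩ := exists_ne_of_card_memFam_ne_one h.1 m3 (by simp)
    obtain ⟨B, hB, hfB, hneB⟩ := exists_ne_of_card_memFam_ne_one h.2 m3 (by simp)
    have hdA : 4 ∉ A := fun hd => by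
      rw [h4 A hA hd] at heA
      simp at heA
    have hdB : 4 ∉ B := fun hd => by
      rw [h4 B hB hd] at hfB
      simp at hfB
    exact not_rare_of_mem_of_mem hF hl (hrare _ m1) (hrare _ m2) (hrare _ m3)
      (hcard A hA) heA hdA hneA (hrare A hA) (hcard B hB) hfB hdB hneB (hrare B hB)
end
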